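/- For each i ∈ ℕ let nᵢ ∈ ℕ, let (θ^i_j)_{j≥1} be a sequence of Lipschitz maps θ^i_j : ℝ^{nᵢ} → ℝ^{nᵢ}, let Wᵢ be a countable collection of weights in ℝ^{nᵢ}, let U ⊆ ℝ be an open interval, and let φᵢ : U → ℝ^{nᵢ} be a nondegenerate analytic map. Then the Hausdorff dimension of ⋂_{i≥1} ⋂_{r ∈ Wᵢ} ⋂_{j≥1} φᵢ⁻¹(Bad_{θ^i_j}(r)) equals 1. -/

import Mathlib

/- STATEMENT 2: Corollary (curves, Lebesgue case): the countable intersection of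
preimages of inhomogeneous bad sets along analytic nondegenerate curves has
Hausdorff dimension 1. -/

open Filter Set
open scoped ENNReal

/-- distance from `y` to the nearest integer, `|y|_ℤ`. -/
noncomputable def distInt (y : ℝ) : ℝ := |y - round y|

/-- `wpow t s = t ^ (1/s)`, with the convention `t ^ (1/0) := 0`. -/
noncomputable def wpow (t s : ℝ) : ℝ := if s = 0 then 0 else t ^ (1 / s)

/-- `liminf` over `q ∈ ℤ \ {0}`, `|q| → ∞`, of
`max_{1 ≤ i ≤ n} |q·yᵢ − θᵢ|_ℤ^{1/rᵢ} · |q|` (valued in `ℝ≥0∞`). -/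
noncomputable def badLiminf {n : ℕ} (r y θv : Fin n → ℝ) : ℝ≥0∞ :=
  Filter.liminf
    (fun q : ℤ =>
      ENNReal.ofReal ((⨆ i, wpow (distInt ((q : ℝ) * y i - θv i)) (r i)) * |(q : ℝ)|))
    (Filter.comap (fun q : ℤ => |q|) Filter.atTop)

/-! ### Sums over the nodes of a tree of words -/

/-- Sum of `f` over the descendants of `w` at relative depth `n`. -/
noncomputable def csum {β : Type*} [Fintype β] (f : List β → ℝ) : ℕ → List β → ℝ
  | 0, w => f w
  | n + 1, w => ∑ b, csum f n (b :: w)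

open Classical in
/-- Real-valued indicator of a predicate on words. -/
noncomputable def ind {β : Type*} (P : List β → Prop) (w : List β) : ℝ := if P w then 1 else 0

section csum
variable {β : Type*} [Fintype β]

theorem ind_nonneg {β : Type*} (P : List β → Prop) (w : List β) : 0 ≤ ind P w := by
  unfold ind; split_ifs <;> norm_num

theorem ind_le_one {β : Type*} (P : List β → Prop) (w : List β) : ind P w ≤ 1 := by
  unfold ind; split_ifs <;> norm_num

theorem ind_of {β : Type*} {P : List β → Prop} {w : List β} (h : P w) : ind P w = 1 := by
  simp [ind, h]

theorem ind_of_not {β : Type*} {P : List β → Prop} {w : List β} (h : ¬ P w) : ind P w = 0 := by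
  simp [ind, h]

theorem csum_mono {f g : List β → ℝ} (n : ℕ) (w : List β)
    (h : ∀ u, w <:+ u → u.length = w.length + n → f u ≤ g u) : csum f n w ≤ csum g n w := by
  induction n generalizing w with
  | zero => exact h w List.suffix_rfl rfl
  | succ n ih =>
    refine Finset.sum_le_sum fun b _ => ih _ fun u hu hl => h u ?_ ?_
    · exact (List.suffix_cons b w).trans hu
    · rw [hl, List.length_cons]; omega

theorem csum_nonneg {f : List β → ℝ} (h : ∀ u, 0 ≤ f u) (n : ℕ) (w : List β) :
    0 ≤ csum f n w := by
  induction n generalizing w with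
  | zero => exact h w
  | succ n ih => exact Finset.sum_nonneg fun b _ => ih _

theorem csum_add (f g : List β → ℝ) (n : ℕ) (w : List β) :
    csum (fun u => f u + g u) n w = csum f n w + csum g n w := by
  induction n generalizing w with
  | zero => rfl
  | succ n ih => simp only [csum, ih, Finset.sum_add_distrib]

theorem csum_const_mul (c : ℝ) (f : List β → ℝ) (n : ℕ) (w : List β) :
    csum (fun u => c * f u) n w = c * csum f n w := by
  induction n generalizing w with
  | zero => rfl
  | succ n ih => simp only [csum, ih, Finset.mul_sum]

theorem csum_finset_sum {ι : Type*} (s : Finset ι) (f : ι → List β → ℝ) (n : ℕ) (w : List β) :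
    csum (fun u => ∑ i ∈ s, f i u) n w = ∑ i ∈ s, csum (f i) n w := by
  induction n generalizing w with
  | zero => rfl
  | succ n ih => simp only [csum, ih]; rw [Finset.sum_comm]

theorem csum_csum (f : List β → ℝ) (a p : ℕ) (w : List β) :
    csum (csum f p) a w = csum f (a + p) w := by
  induction a generalizing w with
  | zero => simp [csum]
  | succ a ih => rw [Nat.add_right_comm]; simp only [csum, ih]

theorem csum_const (c : ℝ) (n : ℕ) (w : List β) :
    csum (fun _ => c) n w = c * (Fintype.card β : ℝ) ^ n := by
  induction n generalizing w with
  | zero => simp [csum]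
  | succ n ih => simp only [csum, ih, Finset.sum_const, Finset.card_univ, nsmul_eq_mul]; ring

theorem csum_le_of_forall {f : List β → ℝ} {c : ℝ} (h : ∀ u, f u ≤ c) (n : ℕ) (w : List β) :
    csum f n w ≤ c * (Fintype.card β : ℝ) ^ n :=
  (csum_mono n w fun u _ _ => h u).trans_eq (csum_const c n w)

theorem csum_drop_mul (g f : List β → ℝ) (p : ℕ) (w : List β) :
    csum (fun u => g (u.drop p) * f u) p w = g w * csum f p w := by
  have key : ∀ p w, ∀ k, csum (fun u => g (u.drop (p + k)) * f u) p w
      = g (w.drop k) * csum f p w := by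
    intro p
    induction p with
    | zero => intro w k; simp [csum]
    | succ p ih =>
      intro w k
      simp only [csum, Finset.mul_sum]
      refine Finset.sum_congr rfl fun b _ => ?_
      have := ih (b :: w) (k + 1)
      rw [List.drop_succ_cons] at this
      rw [← this, show p + 1 + k = p + (k + 1) by ring]
  simpa using key p w 0

theorem csum_eq_zero_of {P : List β → Prop} (n : ℕ) (w : List β)
    (h : ∀ u, w <:+ u → u.length = w.length + n → ¬ P u) : csum (ind P) n w = 0 := by
  refine le_antisymm ?_ (csum_nonneg (ind_nonneg P) n w)
  calc csum (ind P) n w ≤ csum (fun _ => 0) n w :=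
        csum_mono n w fun u hu hl => (ind_of_not (h u hu hl)).le
    _ = 0 := by rw [csum_const]; ring

theorem csum_ind_mono {P Q : List β → Prop} (n : ℕ) (w : List β)
    (h : ∀ u, w <:+ u → u.length = w.length + n → P u → Q u) :
    csum (ind P) n w ≤ csum (ind Q) n w := by
  refine csum_mono n w fun u hu hl => ?_
  by_cases hP : P u
  · rw [ind_of hP, ind_of (h u hu hl hP)]
  · rw [ind_of_not hP]; exact ind_nonneg _ _

theorem ind_or_le {β : Type*} (P Q : List β → Prop) (w : List β) :
    ind (fun u => P u ∨ Q u) w ≤ ind P w + ind Q w := by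
  by_cases hP : P w <;> by_cases hQ : Q w <;> simp [ind, hP, hQ]

end csum

/-! ### Extracting a large subtree -/

/-- Nodes from which removal-free subtrees of height `n` can be found. -/
def aliveAux {β : Type*} [Fintype β] (rm : List β → Prop) : ℕ → List β → Prop
  | 0, w => ¬ rm w
  | n + 1, w => ¬ rm w ∧ 2 * csum (ind fun u => ¬ aliveAux rm n u) 1 w < Fintype.card β

theorem aliveAux_antitone {β : Type*} [Fintype β] (rm : List β → Prop) (n : ℕ) (w : List β) :
    aliveAux rm (n + 1) w → aliveAux rm n w := by
  induction n generalizing w with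
  | zero => exact fun h => h.1
  | succ n ih =>
    rintro ⟨h1, h2⟩
    refine ⟨h1, lt_of_le_of_lt ?_ h2⟩
    gcongr
    exact csum_ind_mono _ _ fun u _ _ hu h => hu (ih u h)

theorem aliveAux_antitone' {β : Type*} [Fintype β] (rm : List β → Prop) {m n : ℕ} (h : m ≤ n)
    (w : List β) : aliveAux rm n w → aliveAux rm m w := by
  induction n, h using Nat.le_induction with
  | base => exact id
  | succ n _ ih => exact fun h => ih (aliveAux_antitone rm n w h)

theorem aliveAux_nil {β : Type*} [Fintype β] [Nonempty β] (rm : List β → Prop)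
    (ty : ℕ → List β → Prop) (δ : ℕ → ℕ → ℝ) (hnil : ¬ rm [])
    (hty : ∀ w, rm w → ∃ p, 1 ≤ p ∧ p ≤ w.length ∧ ty p w)
    (hcount : ∀ w p, 1 ≤ p → (∀ s, s <:+ w → ¬ rm s) →
      csum (ind (ty p)) p w ≤ δ (w.length + p) p * (Fintype.card β : ℝ) ^ p)
    (hδ0 : ∀ i p, 0 ≤ δ i p)
    (hδ : ∀ i, ∑ p ∈ Finset.Icc 1 i, δ i p * 4 ^ p ≤ 1) (n : ℕ) : aliveAux rm n [] := by
  by_contra hn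
  set R : ℝ := (Fintype.card β : ℝ) with hR
  have hRpos : 0 < R := by rw [hR]; exact_mod_cast Fintype.card_pos
  set Bd : List β → Prop := fun w => ∀ s, s <:+ w → ¬ rm s ∧ ¬ aliveAux rm (n - s.length) s
    with hBd
  set N : ℕ → ℝ := fun i => csum (ind Bd) i [] with hN
  have hN0 : ∀ i, 0 ≤ N i := fun i => csum_nonneg (ind_nonneg _) _ _
  have hone : ∀ i, i < n → ∀ w : List β, w.length = i →
      R / 2 * ind Bd w ≤ csum (ind Bd) 1 w +
        csum (fun u => ind Bd (u.drop 1) * ind rm u) 1 w := by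
    intro i hi w hw
    by_cases hB : Bd w
    · have h1 := hB w List.suffix_rfl
      rw [csum_drop_mul, ind_of hB, one_mul, ← csum_add, mul_one]
      have h2 := h1.2
      rw [show n - w.length = (n - (i + 1)) + 1 by omega] at h2
      have h3 : R ≤ 2 * csum (ind fun u => ¬ aliveAux rm (n - (i + 1)) u) 1 w := by
        by_contra hc
        exact h2 ⟨h1.1, not_le.mp hc⟩
      have h4 : csum (ind fun u => ¬ aliveAux rm (n - (i + 1)) u) 1 w ≤
          csum (fun u => ind Bd u + ind rm u) 1 w := by
        simp only [csum]
        refine Finset.sum_le_sum fun b _ => ?_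
        by_cases hA : aliveAux rm (n - (i + 1)) (b :: w)
        · rw [ind_of_not (P := fun u => ¬ aliveAux rm (n - (i + 1)) u) (not_not.mpr hA)]
          exact add_nonneg (ind_nonneg _ _) (ind_nonneg _ _)
        · rw [ind_of (P := fun u => ¬ aliveAux rm (n - (i + 1)) u) hA]
          by_cases hr : rm (b :: w)
          · rw [ind_of hr]; linarith [ind_nonneg Bd (b :: w)]
          · have : Bd (b :: w) := by
              intro s hs
              rcases List.suffix_cons_iff.mp hs with rfl | hs
              · exact ⟨hr, by rw [List.length_cons, hw]; exact hA⟩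
              · exact hB s hs
            rw [ind_of this]; linarith [ind_nonneg rm (b :: w)]
      linarith
    · rw [ind_of_not hB, mul_zero]
      exact add_nonneg (csum_nonneg (ind_nonneg _) _ _)
        (csum_nonneg (fun u => mul_nonneg (ind_nonneg _ _) (ind_nonneg _ _)) _ _)
  have hL : ∀ i, csum (fun u => ind Bd (u.drop 1) * ind rm u) (i + 1) [] ≤
      ∑ p ∈ Finset.Icc 1 (i + 1), N (i + 1 - p) * (δ (i + 1) p * R ^ p) := by
    intro i
    calc csum (fun u => ind Bd (u.drop 1) * ind rm u) (i + 1) []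
        ≤ csum (fun u => ∑ p ∈ Finset.Icc 1 (i + 1), ind Bd (u.drop p) * ind (ty p) u) (i + 1) []
          := by
          refine csum_mono _ _ fun u _ hl => ?_
          have hnn : ∀ p ∈ Finset.Icc 1 (i + 1), 0 ≤ ind Bd (u.drop p) * ind (ty p) u :=
            fun p _ => mul_nonneg (ind_nonneg _ _) (ind_nonneg _ _)
          by_cases hB : Bd (u.drop 1)
          · by_cases hr : rm u
            · obtain ⟨p, hp1, hp2, hp⟩ := hty u hr
              have hBp : Bd (u.drop p) := by
                intro s hs
                refine hB s (hs.trans ?_)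
                obtain ⟨k, rfl⟩ := Nat.exists_eq_add_of_le hp1
                rw [← List.drop_drop]
                exact List.drop_suffix _ _
              have hmem : p ∈ Finset.Icc 1 (i + 1) := by
                rw [Finset.mem_Icc]; simp at hl; omega
              refine le_trans ?_ (Finset.single_le_sum hnn hmem)
              rw [ind_of hB, ind_of hr, ind_of hBp, ind_of hp]
            · rw [ind_of_not hr, mul_zero]; exact Finset.sum_nonneg hnn
          · rw [ind_of_not hB, zero_mul]; exact Finset.sum_nonneg hnn
      _ = ∑ p ∈ Finset.Icc 1 (i + 1), csum (fun u => ind Bd (u.drop p) * ind (ty p) u) (i + 1) []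
          := csum_finset_sum _ _ _ _
      _ ≤ _ := by
          refine Finset.sum_le_sum fun p hp => ?_
          rw [Finset.mem_Icc] at hp
          have e : i + 1 = (i + 1 - p) + p := by omega
          conv_lhs => rw [e]
          rw [← csum_csum, hN]
          simp only
          rw [mul_comm (csum _ _ _), ← csum_const_mul]
          refine csum_mono _ _ fun u _ hl => ?_
          rw [csum_drop_mul]
          by_cases hB : Bd u
          · have := hcount u p hp.1 fun s hs => (hB s hs).1
            rw [ind_of hB, one_mul, mul_one]
            simp only [List.length_nil, zero_add] at hl
            rwa [hl, ← e] at this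
          · rw [ind_of_not hB]; simp
  have hgrow : ∀ i, i ≤ n → ∀ j, j ≤ i → (R / 4) ^ (i - j) * N j ≤ N i := by
    intro i
    induction i with
    | zero => intro _ j hj; obtain rfl : j = 0 := by omega
              simp
    | succ i ih =>
      intro hi
      have ih' := ih (by omega)
      have h1 : R / 2 * N i ≤ N (i + 1) +
          csum (fun u => ind Bd (u.drop 1) * ind rm u) (i + 1) [] := by
        rw [hN]; simp only
        rw [← csum_const_mul, ← csum_csum, ← csum_csum (fun u => ind Bd (u.drop 1) * ind rm u),
          ← csum_add]
        exact csum_mono _ _ fun u _ hl => hone i (by omega) u (by simpa using hl)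
      have h2 : csum (fun u => ind Bd (u.drop 1) * ind rm u) (i + 1) [] ≤ R / 4 * N i := by
        refine (hL i).trans ?_
        calc ∑ p ∈ Finset.Icc 1 (i + 1), N (i + 1 - p) * (δ (i + 1) p * R ^ p)
            ≤ ∑ p ∈ Finset.Icc 1 (i + 1), (R / 4 * N i) * (δ (i + 1) p * 4 ^ p) := by
              refine Finset.sum_le_sum fun p hp => ?_
              rw [Finset.mem_Icc] at hp
              have h3 := ih' (i + 1 - p) (by omega)
              rw [show i - (i + 1 - p) = p - 1 by omega] at h3
              have e : R ^ p = (R / 4) * (R / 4) ^ (p - 1) * 4 ^ p := by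
                rw [← pow_succ', show p - 1 + 1 = p by omega, ← mul_pow]; ring_nf
              rw [e]
              have h5 : 0 ≤ R / 4 * (δ (i + 1) p * 4 ^ p) :=
                mul_nonneg (by positivity) (mul_nonneg (hδ0 _ _) (by positivity))
              nlinarith [mul_le_mul_of_nonneg_left h3 h5]
          _ = (R / 4 * N i) * ∑ p ∈ Finset.Icc 1 (i + 1), δ (i + 1) p * 4 ^ p := by
              rw [Finset.mul_sum]
          _ ≤ (R / 4 * N i) * 1 :=
              mul_le_mul_of_nonneg_left (hδ _) (mul_nonneg (by positivity) (hN0 _))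
          _ = _ := mul_one _
      intro j hj
      rcases Nat.lt_or_ge i j with h | h
      · obtain rfl : j = i + 1 := by omega
        simp
      · have h3 := ih' j h
        rw [show i + 1 - j = (i - j) + 1 by omega, pow_succ']
        have : R / 4 * ((R / 4) ^ (i - j) * N j) ≤ R / 4 * N i :=
          mul_le_mul_of_nonneg_left h3 (by positivity)
        linarith
  have hend : N n = 0 := by
    refine csum_eq_zero_of _ _ fun u _ hl hB => ?_
    have := hB u List.suffix_rfl
    simp only [List.length_nil, zero_add] at hl
    rw [hl, Nat.sub_self] at this
    exact this.2 this.1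
  have hstart : N 0 = 1 := by
    refine ind_of ?_
    intro s hs
    rw [List.suffix_nil] at hs
    subst hs
    exact ⟨hnil, hn⟩
  have := hgrow n le_rfl 0 (by omega)
  rw [hend, hstart] at this
  have : 0 < (R / 4) ^ (n - 0) * 1 := by positivity
  linarith

theorem exists_alive {β : Type*} [Fintype β] [Nonempty β] (rm : List β → Prop)
    (ty : ℕ → List β → Prop) (δ : ℕ → ℕ → ℝ) (hnil : ¬ rm [])
    (hty : ∀ w, rm w → ∃ p, 1 ≤ p ∧ p ≤ w.length ∧ ty p w)
    (hcount : ∀ w p, 1 ≤ p → (∀ s, s <:+ w → ¬ rm s) →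
      csum (ind (ty p)) p w ≤ δ (w.length + p) p * (Fintype.card β : ℝ) ^ p)
    (hδ0 : ∀ i p, 0 ≤ δ i p)
    (hδ : ∀ i, ∑ p ∈ Finset.Icc 1 i, δ i p * 4 ^ p ≤ 1) :
    ∃ alive : List β → Prop, alive [] ∧ ∀ w, alive w → ¬ rm w ∧
      2 * csum (ind fun u => ¬ alive u) 1 w < Fintype.card β := by
  refine ⟨fun w => ∀ n, aliveAux rm n w,
    aliveAux_nil rm ty δ hnil hty hcount hδ0 hδ, fun w hw => ⟨hw 0, ?_⟩⟩
  have : ∀ b : β, ∃ n, (¬ ∀ n, aliveAux rm n (b :: w)) → ¬ aliveAux rm n (b :: w) := by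
    intro b
    by_cases h : ∀ n, aliveAux rm n (b :: w)
    · exact ⟨0, fun h' => absurd h h'⟩
    · obtain ⟨n, hn⟩ := not_forall.mp h
      exact ⟨n, fun _ => hn⟩
  choose f hf using this
  refine lt_of_le_of_lt ?_ (hw (Finset.univ.sup f + 1)).2
  gcongr
  refine Finset.sum_le_sum fun b _ => ?_
  simp only [csum]
  by_cases h : ∀ n, aliveAux rm n (b :: w)
  · rw [ind_of_not (P := fun u => ¬ ∀ n, aliveAux rm n u) (not_not.mpr h)]
    exact ind_nonneg _ _
  · rw [ind_of (P := fun u => ¬ aliveAux rm (Finset.univ.sup f) u)]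
    · exact ind_le_one _ _
    · exact fun h' => hf b h (aliveAux_antitone' rm (Finset.le_sup (Finset.mem_univ b)) _ h')

/-! ### Quantitative nondivergence on a binary tree -/

/-- Every vector of `B \ A` can be separated off by a step of a flag of small subspaces. -/
def FlagProtected {E : Type*} [AddCommGroup E] [Module ℚ E]
    (sm : Submodule ℚ E → ℝ → List Bool → Prop) (A B : Submodule ℚ E) (ε : ℝ)
    (w : List Bool) : Prop :=
  ∀ v ∈ B, v ∉ A → ∃ C, A ≤ C ∧ C ≤ B ∧ v ∉ C ∧ (C = A ∨ sm C 1 w) ∧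
    (C ⊔ Submodule.span ℚ {v} = B ∨ ¬ sm (C ⊔ Submodule.span ℚ {v}) ε w)

theorem FlagProtected.glue {E : Type*} [AddCommGroup E] [Module ℚ E]
    {sm : Submodule ℚ E → ℝ → List Bool → Prop} {A V B : Submodule ℚ E} {ε : ℝ}
    {w : List Bool} (hAV : A ≤ V) (hVB : V ≤ B) (h1 : sm V 1 w) (hε : ¬ sm V ε w)
    (hA : FlagProtected sm A V ε w) (hB : FlagProtected sm V B ε w) :
    FlagProtected sm A B ε w := by
  intro v hvB hvA
  by_cases hv : v ∈ V
  · obtain ⟨C, hAC, hCV, hvC, hs, hl⟩ := hA v hv hvA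
    refine ⟨C, hAC, hCV.trans hVB, hvC, hs, Or.inr ?_⟩
    rcases hl with hl | hl
    · rwa [hl]
    · exact hl
  · obtain ⟨C, hVC, hCB, hvC, hs, hl⟩ := hB v hvB hv
    refine ⟨C, hAV.trans hVC, hCB, hvC, Or.inr ?_, hl⟩
    rcases hs with rfl | hs
    · exact h1
    · exact hs

theorem sm_descendant {E : Type*} [AddCommGroup E] [Module ℚ E]
    {sm : Submodule ℚ E → ℝ → List Bool → Prop}
    (hchild : ∀ V ε b w, sm V ε w → sm V ε (b :: w)) {V : Submodule ℚ E} {ε : ℝ}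
    {w u : List Bool} (hwu : w <:+ u) (h : sm V ε w) : sm V ε u := by
  obtain ⟨t, rfl⟩ := hwu
  induction t with
  | nil => exact h
  | cons b t ih => exact hchild _ _ _ _ ih

theorem flagProtected_count {E : Type*} [AddCommGroup E] [Module ℚ E] [FiniteDimensional ℚ E]
    (C α : ℝ) (hC : 1 ≤ C) (hα : 0 < α) (d : ℕ) : ∃ K : ℝ, 1 ≤ K ∧
    ∀ (sm : Submodule ℚ E → ℝ → List Bool → Prop)
      (_ : ∀ V ε ε' w, ε ≤ ε' → sm V ε w → sm V ε' w)
      (_ : ∀ V ε b w, sm V ε w → sm V ε (b :: w))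
      (_ : ∀ V ρ ε w n, 0 < ρ → 0 < ε → ¬ sm V ρ w →
        csum (ind (sm V ε)) n w ≤ C * (ε / ρ) ^ α * 2 ^ n)
      (A B : Submodule ℚ E) (ρ ε : ℝ) (n : ℕ) (w : List Bool), A ≤ B →
      Module.finrank ℚ B ≤ Module.finrank ℚ A + d → 0 < ρ → ρ ≤ 1 → 0 < ε →
      (∀ V, A < V → V < B → ¬ sm V ρ w) →
      csum (ind fun u => ¬ FlagProtected sm A B ε u) n w ≤ K * (ε / ρ) ^ α * 2 ^ n := by
  induction d with
  | zero =>
    refine ⟨1, le_rfl, ?_⟩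
    intro sm _ _ _ A B ρ ε n w hAB hd hρ hρ1 hε _
    have : A = B := Submodule.eq_of_le_of_finrank_le hAB (by simpa using hd)
    subst this
    rw [csum_eq_zero_of]
    · positivity
    · intro u _ _ h
      exact h fun v hv hv' => absurd hv hv'
  | succ d ih =>
    obtain ⟨K, hK1, hK⟩ := ih
    set c : ℝ := (1 / (4 * C)) ^ (1 / α) with hc
    have hcpos : 0 < c := by positivity
    have hcα : c ^ α = 1 / (4 * C) := by
      rw [hc, ← Real.rpow_mul (by positivity), one_div_mul_cancel hα.ne', Real.rpow_one]
    have hcα' : (c ^ α)⁻¹ = 4 * C := by rw [hcα]; simp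
    refine ⟨(C + 2 * K) * (4 * C), by nlinarith, ?_⟩
    intro sm hmono hchild hgood A B ρ ε n w hAB hd hρ hρ1 hε hV
    have hx : 0 < (ε / ρ) ^ α := by positivity
    rcases lt_or_ge ρ ε with h | hερ
    · have h1 : 1 ≤ (ε / ρ) ^ α :=
        Real.one_le_rpow ((one_le_div hρ).mpr h.le) hα.le
      have h2 := csum_le_of_forall (f := ind fun u => ¬ FlagProtected sm A B ε u)
        (ind_le_one _) n w
      simp only [Fintype.card_bool, one_mul, Nat.cast_ofNat] at h2
      refine h2.trans ?_
      have : (1 : ℝ) ≤ (C + 2 * K) * (4 * C) * (ε / ρ) ^ α := by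
        have : (1 : ℝ) ≤ (C + 2 * K) * (4 * C) := by nlinarith
        nlinarith
      have h3 : (0 : ℝ) < 2 ^ n := by positivity
      nlinarith
    induction n generalizing w with
    | zero =>
      rw [csum_eq_zero_of]
      · positivity
      intro u hwu hl h
      obtain rfl : w = u := List.IsSuffix.eq_of_length hwu (by simpa using hl.symm)
      apply h
      intro v hvB hvA
      refine ⟨A, le_rfl, hAB, hvA, Or.inl rfl, ?_⟩
      have hle : A ⊔ Submodule.span ℚ {v} ≤ B :=
        sup_le hAB ((Submodule.span_singleton_le_iff_mem v B).mpr hvB)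
      rcases eq_or_lt_of_le hle with h | h
      · exact Or.inl h
      · refine Or.inr fun hs => hV _ ?_ h (hmono _ _ _ _ hερ hs)
        refine lt_of_le_of_ne le_sup_left fun h' => hvA ?_
        rw [h']
        exact Submodule.mem_sup_right (Submodule.mem_span_singleton_self v)
    | succ n ihn =>
      have hb : ∀ b, csum (ind fun u => ¬ FlagProtected sm A B ε u) n (b :: w) ≤
          (C + 2 * K) * (4 * C) * (ε / ρ) ^ α * 2 ^ n := by
        intro b
        by_cases hall : ∀ V, A < V → V < B → ¬ sm V ρ (b :: w)
        · exact ihn _ hall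
        push Not at hall
        obtain ⟨V, hAV, hVB, hsm⟩ := hall
        have hnot : ∀ V', A < V' → V' < B → ¬ sm V' (c * ρ) (b :: w) := by
          intro V' h1 h2 h3
          have h4 := hgood V' ρ (c * ρ) w 1 hρ (by positivity) (hV V' h1 h2)
          rw [mul_div_assoc, div_self hρ.ne', mul_one, hcα] at h4
          have h5 : ind (sm V' (c * ρ)) (b :: w) ≤ csum (ind (sm V' (c * ρ))) 1 w := by
            simp only [csum]
            exact Finset.single_le_sum (f := fun b => ind (sm V' (c * ρ)) (b :: w))
              (fun _ _ => ind_nonneg _ _) (Finset.mem_univ b)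
          rw [ind_of h3] at h5
          have : C * (1 / (4 * C)) * 2 ^ 1 = 1 / 2 := by field_simp; norm_num
          rw [this] at h4
          linarith
        have hcρ : 0 < c * ρ := by positivity
        have hcρ1 : c * ρ ≤ 1 := by
          have : c ≤ 1 := Real.rpow_le_one (by positivity)
            (by rw [div_le_one (by positivity)]; linarith) (by positivity)
          nlinarith
        have hr1 := Submodule.finrank_lt_finrank_of_lt hAV
        have hr2 := Submodule.finrank_lt_finrank_of_lt hVB
        have e1 := hK sm hmono hchild hgood A V (c * ρ) ε n (b :: w) hAV.le (by omega) hcρ hcρ1 hε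
          fun V' h1 h2 => hnot V' h1 (h2.trans hVB)
        have e2 := hK sm hmono hchild hgood V B (c * ρ) ε n (b :: w) hVB.le (by omega) hcρ hcρ1 hε
          fun V' h1 h2 => hnot V' (hAV.trans h1) h2
        have e3 := hgood V (c * ρ) ε (b :: w) n hcρ hε (hnot V hAV hVB)
        have hpow : (ε / (c * ρ)) ^ α = (4 * C) * (ε / ρ) ^ α := by
          rw [mul_comm c ρ, ← div_div, Real.div_rpow (by positivity) hcpos.le, div_eq_mul_inv,
            hcα', mul_comm]
        rw [hpow] at e1 e2 e3
        have : csum (ind fun u => ¬ FlagProtected sm A B ε u) n (b :: w) ≤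
            csum (fun u => ind (sm V ε) u + (ind (fun u => ¬ FlagProtected sm A V ε u) u +
              ind (fun u => ¬ FlagProtected sm V B ε u) u)) n (b :: w) := by
          refine csum_mono _ _ fun u hu _ => ?_
          have n1 := ind_nonneg (sm V ε) u
          have n2 := ind_nonneg (fun u => ¬ FlagProtected sm A V ε u) u
          have n3 := ind_nonneg (fun u => ¬ FlagProtected sm V B ε u) u
          by_cases h1 : sm V ε u
          · rw [ind_of h1]
            linarith [ind_le_one (fun u => ¬ FlagProtected sm A B ε u) u]
          by_cases h2 : FlagProtected sm A V ε u
          · by_cases h3 : FlagProtected sm V B ε u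
            · have := FlagProtected.glue hAV.le hVB.le
                (hmono _ _ _ _ hρ1 (sm_descendant hchild hu hsm)) h1 h2 h3
              rw [ind_of_not (P := fun u => ¬ FlagProtected sm A B ε u) (not_not.mpr this)]
              linarith
            · rw [ind_of (P := fun u => ¬ FlagProtected sm V B ε u) h3]
              linarith [ind_le_one (fun u => ¬ FlagProtected sm A B ε u) u]
          · rw [ind_of (P := fun u => ¬ FlagProtected sm A V ε u) h2]
            linarith [ind_le_one (fun u => ¬ FlagProtected sm A B ε u) u]
        rw [csum_add, csum_add] at this
        calc _ ≤ _ := this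
          _ ≤ C * (4 * C * (ε / ρ) ^ α) * 2 ^ n + (K * (4 * C * (ε / ρ) ^ α) * 2 ^ n +
              K * (4 * C * (ε / ρ) ^ α) * 2 ^ n) := by linarith
          _ = _ := by ring
      simp only [csum, Fintype.sum_bool]
      rw [pow_succ]
      linarith [hb true, hb false]

/-! ### Trees of intervals -/

/-- A tree of nested compact intervals; the interval of `w` has length `len / q ^ w.length`. -/
structure NTree (β : Type) where
  len : ℝ
  q : ℝ
  c : List β → ℝ
  len_pos : 0 < len
  two_le : 2 ≤ q
  left : ∀ b w, c w ≤ c (b :: w)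
  right : ∀ b w, c (b :: w) + len / q ^ (w.length + 1) ≤ c w + len / q ^ w.length

namespace NTree
variable {β : Type}

/-- Length of the intervals of level `n`. -/
noncomputable def size (T : NTree β) (n : ℕ) : ℝ := T.len / T.q ^ n

/-- The interval attached to `w`. -/
def cell (T : NTree β) (w : List β) : Set ℝ := Icc (T.c w) (T.c w + T.size w.length)

theorem q_pos (T : NTree β) : 0 < T.q := by linarith [T.two_le]

theorem size_pos (T : NTree β) (n : ℕ) : 0 < T.size n :=
  div_pos T.len_pos (pow_pos T.q_pos n)

theorem size_zero (T : NTree β) : T.size 0 = T.len := by simp [size]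

theorem size_add (T : NTree β) (m n : ℕ) : T.size (m + n) = T.size m / T.q ^ n := by
  unfold size; rw [pow_add, div_div]

theorem size_succ (T : NTree β) (n : ℕ) : T.size (n + 1) = T.size n / T.q := by
  rw [size_add, pow_one]

theorem size_anti (T : NTree β) {m n : ℕ} (h : m ≤ n) : T.size n ≤ T.size m := by
  unfold size
  have := T.two_le
  have := T.len_pos
  have := T.q_pos
  gcongr
  linarith

theorem cell_cons_subset (T : NTree β) (b : β) (w : List β) : T.cell (b :: w) ⊆ T.cell w := by
  intro x hx
  have h1 := T.left b w
  have h2 := T.right b w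
  simp only [cell, mem_Icc, size, List.length_cons] at hx ⊢
  constructor <;> linarith [hx.1, hx.2]

theorem cell_subset_of_suffix (T : NTree β) {w u : List β} (h : w <:+ u) :
    T.cell u ⊆ T.cell w := by
  obtain ⟨t, rfl⟩ := h
  induction t with
  | nil => exact subset_rfl
  | cons b t ih => exact (T.cell_cons_subset _ _).trans ih

theorem c_mem (T : NTree β) (w : List β) : T.c w ∈ T.cell w :=
  ⟨le_rfl, by linarith [T.size_pos w.length]⟩

theorem abs_sub_le (T : NTree β) {w : List β} {x y : ℝ} (hx : x ∈ T.cell w)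
    (hy : y ∈ T.cell w) : |x - y| ≤ T.size w.length := by
  rw [cell, mem_Icc] at hx hy
  rw [abs_le]
  constructor <;> linarith [hx.1, hx.2, hy.1, hy.2]

/-- The limit set of the tree. -/
def lim (T : NTree β) : Set ℝ := {x | ∀ n, ∃ w : List β, w.length = n ∧ x ∈ T.cell w}

/-- Every interval of `T'` is inside an interval of `T` of at least the same level. -/
def Sub {γ : Type} (T' : NTree γ) (T : NTree β) : Prop :=
  ∀ w, ∃ u : List β, w.length ≤ u.length ∧ T'.cell w ⊆ T.cell u

theorem Sub.trans {γ δ : Type} {T'' : NTree δ} {T' : NTree γ} {T : NTree β} (h : T''.Sub T')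
    (h' : T'.Sub T) : T''.Sub T := by
  intro w
  obtain ⟨u, hu, hs⟩ := h w
  obtain ⟨v, hv, hs'⟩ := h' u
  exact ⟨v, hu.trans hv, hs.trans hs'⟩

theorem Sub.lim_subset {γ : Type} {T' : NTree γ} {T : NTree β} (h : T'.Sub T) :
    T'.lim ⊆ T.lim := by
  intro x hx n
  obtain ⟨w, hw, hxw⟩ := hx n
  obtain ⟨u, hu, hs⟩ := h w
  refine ⟨u.drop (u.length - n), by rw [List.length_drop]; omega, ?_⟩
  exact T.cell_subset_of_suffix (List.drop_suffix _ _) (hs hxw)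

theorem mem_cell_nil_of_mem_lim (T : NTree β) {x : ℝ} (hx : x ∈ T.lim) : x ∈ T.cell [] := by
  obtain ⟨w, hw, hx⟩ := hx 0
  rwa [List.length_eq_zero_iff.mp hw] at hx

theorem exists_mem_lim (T : NTree β) [Nonempty β] (u : List β) :
    ∃ x ∈ T.cell u, x ∈ T.lim := by
  obtain ⟨b⟩ := ‹Nonempty β›
  have h := IsCompact.nonempty_iInter_of_sequence_nonempty_isCompact_isClosed
    (fun n => T.cell (List.replicate n b ++ u))
    (fun n => by
      simp only [List.replicate_succ, List.cons_append]
      exact T.cell_cons_subset _ _)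
    (fun n => ⟨_, T.c_mem _⟩) isCompact_Icc (fun n => isClosed_Icc)
  obtain ⟨x, hx⟩ := h
  rw [mem_iInter] at hx
  refine ⟨x, by simpa using hx 0, fun n => ?_⟩
  refine ⟨(List.replicate n b ++ u).drop u.length, by simp, ?_⟩
  exact T.cell_subset_of_suffix (List.drop_suffix _ _) (hx n)

/-- The subtree of the descendants of `u`. -/
noncomputable def root (T : NTree β) (u : List β) : NTree β where
  len := T.size u.length
  q := T.q
  c w := T.c (w ++ u)
  len_pos := T.size_pos _
  two_le := T.two_le
  left b w := T.left b (w ++ u)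
  right b w := by
    have := T.right b (w ++ u)
    simp only [List.length_append, List.cons_append] at this ⊢
    rw [← size_add, ← size_add]
    rw [show w.length + u.length + 1 = u.length + (w.length + 1) by ring,
      show w.length + u.length = u.length + w.length by ring] at this
    exact this

theorem root_size (T : NTree β) (u : List β) (n : ℕ) :
    (T.root u).size n = T.size (u.length + n) := (T.size_add _ _).symm

theorem root_cell (T : NTree β) (u w : List β) : (T.root u).cell w = T.cell (w ++ u) := by
  unfold cell
  rw [root_size, List.length_append, add_comm w.length]
  rfl

theorem root_sub (T : NTree β) (u : List β) : (T.root u).Sub T :=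
  fun w => ⟨w ++ u, by simp, (T.root_cell u w).le⟩

/-- Siblings in a binary tree are separated by at least their common length. -/
def IsGap (T : NTree Bool) : Prop :=
  ∀ w, T.c (false :: w) + 2 * T.size (w.length + 1) ≤ T.c (true :: w)

theorem IsGap.root {T : NTree Bool} (h : T.IsGap) (u : List Bool) : (T.root u).IsGap := by
  intro w
  have := h (w ++ u)
  rw [List.length_append, add_comm w.length, add_assoc] at this
  rw [root_size]
  exact this

theorem IsGap.separated {T : NTree Bool} (h : T.IsGap) {u v w : List Bool}
    (huv : u.length = v.length) (hne : u ≠ v) :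
    T.c (u ++ w) + 2 * T.size (w.length + u.length) ≤ T.c (v ++ w) ∨
      T.c (v ++ w) + 2 * T.size (w.length + u.length) ≤ T.c (u ++ w) := by
  induction u generalizing v with
  | nil => exact absurd (List.length_eq_zero_iff.mp huv.symm).symm hne
  | cons b u ih =>
    cases v with
    | nil => simp at huv
    | cons b' v =>
      simp only [List.length_cons, add_left_inj] at huv
      simp only [List.cons_append, List.length_cons, ← add_assoc]
      have l1 := T.left b (u ++ w)
      have l2 := T.left b' (v ++ w)
      have r1 := T.right b (u ++ w)
      have r2 := T.right b' (v ++ w)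
      have hs := T.size_anti (Nat.le_succ (w.length + u.length))
      simp only [List.length_append, ← huv] at r1 r2
      rw [add_comm u.length] at r1 r2
      change _ + T.size (_ + 1) ≤ _ + T.size _ at r1
      change _ + T.size (_ + 1) ≤ _ + T.size _ at r2
      simp only [Nat.succ_eq_add_one] at hs
      by_cases he : u = v
      · subst he
        have hb : b ≠ b' := fun hb => hne (by rw [hb])
        have g := h (u ++ w)
        rw [List.length_append, add_comm u.length] at g
        cases b <;> cases b' <;> simp_all
      · rcases ih huv he with h1 | h1
        · left; linarith
        · right; linarith

/-- Concatenation of the letters of a word of blocks. -/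
def flat {h : ℕ} : List (Fin h → Bool) → List Bool
  | [] => []
  | b :: w => List.ofFn b ++ flat w

theorem flat_length {h : ℕ} (w : List (Fin h → Bool)) : (flat w).length = h * w.length := by
  induction w with
  | nil => rfl
  | cons b w ih => simp [flat, ih]; ring

theorem sum_ofFn (f : List Bool → ℝ) (h : ℕ) (w : List Bool) :
    ∑ b : Fin h → Bool, f (List.ofFn b ++ w) = csum f h w := by
  induction h generalizing f with
  | zero => simp [csum]
  | succ h ih =>
    rw [← csum_csum, ← ih, ← (Fin.consEquiv fun _ => Bool).sum_comp, Fintype.sum_prod_type,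
      Finset.sum_comm]
    refine Finset.sum_congr rfl fun b _ => ?_
    simp [csum, Fin.consEquiv, List.ofFn_succ]

theorem csum_flat (f : List Bool → ℝ) {h : ℕ} (p : ℕ) (w : List (Fin h → Bool)) :
    csum (fun u => f (flat u)) p w = csum f (h * p) (flat w) := by
  induction p generalizing w with
  | zero => rfl
  | succ p ih =>
    simp only [csum, ih, flat]
    rw [sum_ofFn (csum f (h * p)), csum_csum]
    congr 1; ring

theorem c_le_append (T : NTree β) (u w : List β) : T.c w ≤ T.c (u ++ w) := by
  induction u with
  | nil => exact le_rfl
  | cons b u ih => exact ih.trans (T.left _ _)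

theorem append_le (T : NTree β) (u w : List β) :
    T.c (u ++ w) + T.size (w.length + u.length) ≤ T.c w + T.size w.length := by
  induction u with
  | nil => exact le_rfl
  | cons b u ih =>
    refine le_trans ?_ ih
    have := T.right b (u ++ w)
    rw [List.length_append, add_comm u.length] at this
    exact this

/-- The tree obtained by looking only at every `h`-th level. -/
noncomputable def block (T : NTree Bool) (h : ℕ) (hh : 1 ≤ h) : NTree (Fin h → Bool) where
  len := T.len
  q := T.q ^ h
  c w := T.c (flat w)
  len_pos := T.len_pos
  two_le := T.two_le.trans (le_self_pow₀ (by linarith [T.two_le]) (by omega))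
  left b w := T.c_le_append _ _
  right b w := by
    have := T.append_le (List.ofFn b) (flat w)
    rw [flat_length, List.length_ofFn, ← Nat.mul_succ] at this
    rw [← pow_mul, ← pow_mul]
    exact this

theorem block_size (T : NTree Bool) {h : ℕ} (hh : 1 ≤ h) (n : ℕ) :
    (T.block h hh).size n = T.size (h * n) := by
  unfold size; rw [pow_mul]; rfl

theorem block_cell (T : NTree Bool) {h : ℕ} (hh : 1 ≤ h) (w : List (Fin h → Bool)) :
    (T.block h hh).cell w = T.cell (flat w) := by
  unfold cell; rw [block_size, flat_length]; rfl

theorem block_sub (T : NTree Bool) {h : ℕ} (hh : 1 ≤ h) : (T.block h hh).Sub T :=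
  fun w => ⟨flat w, by rw [flat_length]; nlinarith, (T.block_cell hh w).le⟩

theorem IsGap.block_separated {T : NTree Bool} (hT : T.IsGap) {h : ℕ} (hh : 1 ≤ h)
    (w : List (Fin h → Bool)) {b b' : Fin h → Bool} (hne : b ≠ b') :
    (T.block h hh).c (b :: w) + 2 * (T.block h hh).size (w.length + 1) ≤
        (T.block h hh).c (b' :: w) ∨
      (T.block h hh).c (b' :: w) + 2 * (T.block h hh).size (w.length + 1) ≤
        (T.block h hh).c (b :: w) := by
  have := hT.separated (u := List.ofFn b) (v := List.ofFn b') (w := flat w) (by simp)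
    (fun he => hne (List.ofFn_injective he))
  rw [flat_length, List.length_ofFn, ← Nat.mul_succ] at this
  rw [block_size]
  exact this

/-- A subtree with two well separated children at each node. -/
theorem exists_gap_subtree (T : NTree β) (alive : List β → Prop) (h0 : alive [])
    (hpair : ∀ w, alive w → ∃ b b', alive (b :: w) ∧ alive (b' :: w) ∧
      T.c (b :: w) + 2 * T.size (w.length + 1) ≤ T.c (b' :: w)) :
    ∃ T' : NTree Bool, T'.IsGap ∧ T'.len = T.len ∧ T'.q = T.q ∧
      ∀ w, ∃ u, u.length = w.length ∧ alive u ∧ T'.cell w = T.cell u := by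
  have : Nonempty β := let ⟨b, _⟩ := hpair [] h0; ⟨b⟩
  choose! f g hf hg hfg using hpair
  let ν : List Bool → List β := fun w =>
    w.rec [] fun b _ u => if b then g u :: u else f u :: u
  have ν_true : ∀ w, ν (true :: w) = g (ν w) :: ν w := fun w => rfl
  have ν_false : ∀ w, ν (false :: w) = f (ν w) :: ν w := fun w => rfl
  have hlen : ∀ w, (ν w).length = w.length := by
    intro w
    induction w with
    | nil => rfl
    | cons b w ih => cases b <;> simp [ν_true, ν_false, ih]
  have halive : ∀ w, alive (ν w) := by
    intro w
    induction w with
    | nil => exact h0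
    | cons b w ih =>
      cases b
      · exact hf _ ih
      · exact hg _ ih
  refine ⟨⟨T.len, T.q, fun w => T.c (ν w), T.len_pos, T.two_le, ?_, ?_⟩, ?_, rfl, rfl, ?_⟩
  · intro b w
    cases b
    · exact T.left _ _
    · exact T.left _ _
  · intro b w
    rw [← hlen w]
    cases b
    · exact T.right _ _
    · exact T.right _ _
  · intro w
    have := hfg _ (halive w)
    rw [hlen w] at this
    exact this
  · intro w
    refine ⟨ν w, hlen w, halive w, ?_⟩
    unfold cell size
    rw [hlen]

theorem sub_of_cells {γ : Type} {T' : NTree γ} {T : NTree β} {P : List β → Prop}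
    (h : ∀ w, ∃ u, u.length = w.length ∧ P u ∧ T'.cell w = T.cell u) : T'.Sub T := by
  intro w
  obtain ⟨u, h1, -, h2⟩ := h w
  exact ⟨u, h1.ge, h2.le⟩

/-- In the block tree of a gap tree, a tree all of whose nodes have more than one child
contains a gap tree. -/
theorem IsGap.exists_subtree {T : NTree Bool} (hT : T.IsGap) {h : ℕ} (hh : 1 ≤ h)
    (alive : List (Fin h → Bool) → Prop) (h0 : alive [])
    (hpair : ∀ w, alive w → 2 * csum (ind fun u => ¬ alive u) 1 w < Fintype.card (Fin h → Bool)) :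
    ∃ T' : NTree Bool, T'.IsGap ∧ T'.len = T.len ∧ T'.q = T.q ^ h ∧
      ∀ w, ∃ u, u.length = w.length ∧ alive u ∧ T'.cell w = (T.block h hh).cell u := by
  refine exists_gap_subtree (T.block h hh) alive h0 fun w hw => ?_
  have h1 := hpair w hw
  have hex : ∃ b b', b ≠ b' ∧ alive (b :: w) ∧ alive (b' :: w) := by
    by_contra hcon
    push Not at hcon
    have hR : (2 : ℝ) ≤ (Fintype.card (Fin h → Bool) : ℝ) := by
      simp only [Fintype.card_pi, Fintype.card_bool, Finset.prod_const, Finset.card_univ,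
        Fintype.card_fin, Nat.cast_pow, Nat.cast_ofNat]
      exact le_self_pow₀ (by norm_num) (by omega)
    have hsum : (Fintype.card (Fin h → Bool) : ℝ) =
        csum (ind fun u => ¬ alive u) 1 w + csum (ind alive) 1 w := by
      rw [← csum_add]
      have : (fun u => ind (fun u => ¬ alive u) u + ind alive u) =
          fun _ : List (Fin h → Bool) => (1 : ℝ) := by
        ext u; by_cases hu : alive u <;> simp [ind, hu]
      rw [this, csum_const]; simp
    have : csum (ind alive) 1 w ≤ 1 := by
      simp only [csum]
      by_cases hb : ∃ b, alive (b :: w)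
      · obtain ⟨b, hb⟩ := hb
        rw [Finset.sum_eq_single b]
        · exact ind_le_one _ _
        · intro b' _ hne
          exact ind_of_not (hcon b b' hne.symm hb)
        · simp
      · push Not at hb
        rw [Finset.sum_eq_zero]
        · norm_num
        · intro b _; exact ind_of_not (hb b)
    linarith
  obtain ⟨b, b', hne, hb, hb'⟩ := hex
  rcases hT.block_separated hh w hne with h2 | h2
  · exact ⟨b, b', hb, hb', h2⟩
  · exact ⟨b', b, hb', hb, h2⟩

end NTree

/-! ### Counting intervals on which a function is small -/

/-- If `|f| ≤ ε` at `k + 1` points of an interval that are `d`-separated, then `f` is small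
on the whole interval, with a polynomial loss. -/
def SepGood (C : ℝ) (k : ℕ) (f : ℝ → ℝ) (s : Set ℝ) : Prop :=
  ∀ a b, a < b → Icc a b ⊆ s → ∀ ε d, 0 < ε → 0 < d → ∀ y : Fin (k + 1) → ℝ,
    (∀ i, y i ∈ Icc a b ∧ |f (y i)| ≤ ε) → (∀ i j, i ≠ j → d ≤ |y i - y j|) →
    ∀ x ∈ Icc a b, |f x| ≤ C * ε * ((b - a) / d) ^ (2 * k)

namespace NTree

theorem IsGap.exists_separated {T : NTree Bool} (hT : T.IsGap) (P : ℝ → Prop) (i : ℕ)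
    (w : List Bool) : ∃ S : Finset ℝ, (∀ x ∈ S, x ∈ T.cell w ∧ P x) ∧
      (∀ x ∈ S, ∀ y ∈ S, x ≠ y → T.size (w.length + i) ≤ |x - y|) ∧
      csum (ind fun u => ∃ x ∈ T.cell u, P x) i w = S.card := by
  classical
  induction i generalizing w with
  | zero =>
    by_cases h : ∃ x ∈ T.cell w, P x
    · obtain ⟨x, hx, hP⟩ := h
      refine ⟨{x}, by simp [hx, hP], ?_, ?_⟩
      · intro a ha b hb hab
        simp only [Finset.mem_singleton] at ha hb
        exact absurd (ha.trans hb.symm) hab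
      · simp only [csum, Finset.card_singleton, Nat.cast_one]
        exact ind_of (P := fun u => ∃ x ∈ T.cell u, P x) ⟨x, hx, hP⟩
    · refine ⟨∅, by simp, by simp, ?_⟩
      simp only [csum, Finset.card_empty, Nat.cast_zero]
      exact ind_of_not (P := fun u => ∃ x ∈ T.cell u, P x) h
  | succ i ih =>
    obtain ⟨S, hS1, hS2, hS3⟩ := ih (false :: w)
    obtain ⟨S', hS1', hS2', hS3'⟩ := ih (true :: w)
    have hsep : ∀ x ∈ S, ∀ y ∈ S', T.size (w.length + (i + 1)) ≤ y - x := by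
      intro x hx y hy
      have h1 := (hS1 x hx).1.2
      have h2 := (hS1' y hy).1.1
      have h3 := hT w
      have h4 := T.size_anti (show w.length + 1 ≤ w.length + (i + 1) by omega)
      simp only [List.length_cons] at h1
      linarith
    have hpos := T.size_pos (w.length + (i + 1))
    refine ⟨S ∪ S', ?_, ?_, ?_⟩
    · intro x hx
      rcases Finset.mem_union.mp hx with hx | hx
      · exact ⟨T.cell_cons_subset _ _ (hS1 x hx).1, (hS1 x hx).2⟩
      · exact ⟨T.cell_cons_subset _ _ (hS1' x hx).1, (hS1' x hx).2⟩
    · intro x hx y hy hxy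
      simp only [List.length_cons, add_right_comm _ 1 i] at hS2 hS2'
      rcases Finset.mem_union.mp hx with hx | hx <;> rcases Finset.mem_union.mp hy with hy | hy
      · exact hS2 x hx y hy hxy
      · rw [abs_sub_comm]; exact (hsep x hx y hy).trans (le_abs_self _)
      · exact (hsep y hy x hx).trans (le_abs_self _)
      · exact hS2' x hx y hy hxy
    · rw [Finset.card_union_of_disjoint, Nat.cast_add, ← hS3, ← hS3']
      · simp [csum, add_comm]
      · rw [Finset.disjoint_left]
        intro x hx hx'
        have := hsep x hx x hx'
        linarith

theorem IsGap.sepGood_count {T : NTree Bool} (hT : T.IsGap) {C : ℝ} {k : ℕ} (hk : 1 ≤ k)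
    (hC : 1 ≤ C) {ι : Type*} (f : ι → ℝ → ℝ) {s : Set ℝ} (hf : ∀ i, SepGood C k (f i) s)
    {w : List Bool} (hw : T.cell w ⊆ s) {ρ ε : ℝ} (hρ : 0 < ρ) (hε : 0 < ε)
    (h : ¬ ∀ x ∈ T.cell w, ∀ i, |f i x| ≤ ρ) (n : ℕ) :
    csum (ind fun u => ∀ x ∈ T.cell u, ∀ i, |f i x| ≤ ε) n w ≤
      2 * k * C ^ (Real.log 2 / Real.log T.q / (2 * k)) *
        (ε / ρ) ^ (Real.log 2 / Real.log T.q / (2 * k)) * 2 ^ n := by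
  push Not at h
  obtain ⟨x₀, hx₀, i₀, hi₀⟩ := h
  set β := Real.log 2 / Real.log T.q with hβ
  have hq := T.two_le
  have hlogq : 0 < Real.log T.q := Real.log_pos (by linarith)
  have hβ0 : 0 < β := div_pos (Real.log_pos (by norm_num)) hlogq
  have hqβ : T.q ^ β = 2 := by
    rw [Real.rpow_def_of_pos (by linarith), hβ, mul_div_cancel₀ _ hlogq.ne',
      Real.exp_log (by norm_num)]
  have hk' : (1 : ℝ) ≤ k := by exact_mod_cast hk
  set α := β / (2 * k) with hα
  have hα0 : 0 < α := by positivity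
  have hC0 : 0 < C := by linarith
  rw [mul_assoc (2 * (k : ℝ)), ← Real.mul_rpow (by positivity) (by positivity)]
  have hle2n := csum_le_of_forall
    (f := ind fun u => ∀ x ∈ T.cell u, ∀ i, |f i x| ≤ ε) (ind_le_one _) n w
  simp only [Fintype.card_bool, one_mul, Nat.cast_ofNat] at hle2n
  rcases lt_or_ge 1 (C * (ε / ρ)) with hbig | hsmall
  · refine hle2n.trans ?_
    have := Real.one_le_rpow hbig.le hα0.le
    have h2 : (0 : ℝ) < 2 ^ n := by positivity
    have h3 : 1 ≤ 2 * (k : ℝ) * (C * (ε / ρ)) ^ α := by nlinarith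
    nlinarith
  set X := (C * (ε / ρ))⁻¹ ^ (1 / (2 * k : ℝ)) with hX
  have hX1 : 1 ≤ X := Real.one_le_rpow ((one_le_inv₀ (by positivity)).mpr hsmall) (by positivity)
  obtain ⟨i, hi1, hi2⟩ := exists_nat_pow_near hX1 (show 1 < T.q by linarith)
  have hXk : X ^ (2 * k) = (C * (ε / ρ))⁻¹ := by
    rw [hX, ← Real.rpow_natCast, ← Real.rpow_mul (by positivity)]
    push_cast
    rw [one_div_mul_cancel (by positivity), Real.rpow_one]
  -- at level `i` at most `k` intervals meet the set where `f i₀` is small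
  obtain ⟨S, hS1, hS2, hS3⟩ := hT.exists_separated (fun x => |f i₀ x| ≤ ε) i w
  have hcard : S.card ≤ k := by
    by_contra hcon
    push Not at hcon
    obtain ⟨S', hS', hS'c⟩ := Finset.exists_subset_card_eq (show k + 1 ≤ S.card by omega)
    let e := S'.equivFinOfCardEq hS'c
    have := hf i₀ (T.c w) (T.c w + T.size w.length) (by linarith [T.size_pos w.length]) hw ε
      (T.size (w.length + i)) hε (T.size_pos _) (fun j => (e.symm j : ℝ))
      (fun j => hS1 _ (hS' (e.symm j).2))
      (fun a b hab => hS2 _ (hS' (e.symm a).2) _ (hS' (e.symm b).2)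
        fun hh => hab (e.symm.injective (Subtype.ext hh))) x₀ hx₀
    rw [add_sub_cancel_left, size_add, div_div_cancel₀ (T.size_pos _).ne'] at this
    have h4 : (T.q ^ i) ^ (2 * k) ≤ (C * (ε / ρ))⁻¹ := by
      rw [← hXk]; exact pow_le_pow_left₀ (by positivity) hi1 _
    have h5 : C * ε * (T.q ^ i) ^ (2 * k) ≤ ρ := by
      calc _ ≤ C * ε * (C * (ε / ρ))⁻¹ := by gcongr
        _ = ρ := by field_simp
    linarith
  have hmeet : csum (ind fun u => ∃ x ∈ T.cell u, |f i₀ x| ≤ ε) i w ≤ k := by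
    rw [hS3]; exact_mod_cast hcard
  have h2i : (2 ^ i : ℝ)⁻¹ ≤ 2 * (C * (ε / ρ)) ^ α := by
    have h6 : (X : ℝ) ^ β ≤ 2 ^ (i + 1) := by
      calc X ^ β ≤ (T.q ^ (i + 1)) ^ β := Real.rpow_le_rpow (by positivity) hi2.le hβ0.le
        _ = 2 ^ (i + 1) := by
          rw [← Real.rpow_natCast, ← Real.rpow_mul (by linarith), mul_comm,
            Real.rpow_mul (by linarith), hqβ, Real.rpow_natCast]
    have h7 : X ^ β = ((C * (ε / ρ)) ^ α)⁻¹ := by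
      rw [hX, ← Real.rpow_mul (by positivity), Real.inv_rpow (by positivity), hα]
      congr 2; ring
    rw [h7, pow_succ] at h6
    have h8 : 0 < (C * (ε / ρ)) ^ α := by positivity
    rw [inv_le_iff_one_le_mul₀ h8] at h6
    rw [inv_le_iff_one_le_mul₀ (by positivity)]
    linarith
  have hcnt : csum (ind fun u => ∀ x ∈ T.cell u, ∀ i, |f i x| ≤ ε) n w * 2 ^ i ≤ k * 2 ^ n := by
    rcases le_total i n with hin | hni
    · obtain ⟨m, rfl⟩ := Nat.exists_eq_add_of_le hin
      have : csum (ind fun u => ∀ x ∈ T.cell u, ∀ i, |f i x| ≤ ε) (i + m) w ≤ 2 ^ m * k := by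
        rw [← csum_csum]
        refine le_trans ?_ (mul_le_mul_of_nonneg_left hmeet (by positivity))
        rw [← csum_const_mul]
        refine csum_mono _ _ fun u _ _ => ?_
        by_cases hu : ∃ x ∈ T.cell u, |f i₀ x| ≤ ε
        · rw [ind_of (P := fun u => ∃ x ∈ T.cell u, |f i₀ x| ≤ ε) hu]
          have := csum_le_of_forall
            (f := ind fun u => ∀ x ∈ T.cell u, ∀ i, |f i x| ≤ ε) (ind_le_one _) m u
          simpa using this
        · rw [csum_eq_zero_of]
          · exact mul_nonneg (by positivity) (ind_nonneg _ _)
          · intro v huv _ hv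
            exact hu ⟨T.c v, T.cell_subset_of_suffix huv (T.c_mem v), hv _ (T.c_mem v) i₀⟩
      rw [pow_add]
      have h9 : (0 : ℝ) < 2 ^ i := by positivity
      nlinarith
    · obtain ⟨m, rfl⟩ := Nat.exists_eq_add_of_le hni
      have : 2 ^ m * csum (ind fun u => ∀ x ∈ T.cell u, ∀ i, |f i x| ≤ ε) n w ≤ k := by
        refine le_trans ?_ hmeet
        rw [← csum_csum, ← csum_const_mul]
        refine csum_mono _ _ fun u _ _ => ?_
        by_cases hu : ∀ x ∈ T.cell u, ∀ i, |f i x| ≤ ε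
        · rw [ind_of (P := fun u => ∀ x ∈ T.cell u, ∀ i, |f i x| ≤ ε) hu]
          have h10 := csum_const (β := Bool) 1 m u
          simp only [Fintype.card_bool, one_mul, Nat.cast_ofNat] at h10
          rw [mul_one, ← h10]
          refine csum_mono _ _ fun v huv _ => (ind_of ?_).ge
          exact ⟨T.c v, T.c_mem v, hu _ (T.cell_subset_of_suffix huv (T.c_mem v)) i₀⟩
        · rw [ind_of_not (P := fun u => ∀ x ∈ T.cell u, ∀ i, |f i x| ≤ ε) hu, mul_zero]
          exact csum_nonneg (ind_nonneg _) _ _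
      rw [pow_add]
      have h9 : (0 : ℝ) < 2 ^ n := by positivity
      nlinarith
  have h11 : (0 : ℝ) < 2 ^ i := by positivity
  calc _ = csum (ind fun u => ∀ x ∈ T.cell u, ∀ i, |f i x| ≤ ε) n w * 2 ^ i * (2 ^ i)⁻¹ := by
        field_simp
    _ ≤ k * 2 ^ n * (2 * (C * (ε / ρ)) ^ α) := by gcongr
    _ = _ := by ring

end NTree

/-! ### Small values of analytic functions -/

theorem exists_iterate_deriv_eq_zero {k : ℕ} {f : ℝ → ℝ} {a b : ℝ}
    (hf : ∀ x ∈ Icc a b, AnalyticAt ℝ f x) {y : Fin (k + 1) → ℝ} (hy : StrictMono y)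
    (hab : ∀ i, y i ∈ Icc a b) (h0 : ∀ i, f (y i) = 0) :
    ∃ ξ ∈ Icc a b, deriv^[k] f ξ = 0 := by
  induction k generalizing f with
  | zero => exact ⟨y 0, hab 0, h0 0⟩
  | succ k ih =>
    have : ∀ i : Fin (k + 1), ∃ c ∈ Ioo (y i.castSucc) (y i.succ), deriv f c = 0 := by
      intro i
      refine exists_deriv_eq_zero (hy i.castSucc_lt_succ) ?_ (by rw [h0, h0])
      exact fun x hx => (hf x ⟨(hab _).1.trans hx.1, hx.2.trans (hab _).2⟩).continuousAt
        |>.continuousWithinAt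
    choose z hz hz0 using this
    refine ih (f := deriv f) (fun x hx => (hf x hx).deriv) (y := z) ?_ ?_ hz0
    · refine Fin.strictMono_iff_lt_succ.mpr fun i => ?_
      have h1 := (hz i.castSucc).2
      have h2 := (hz i.succ).1
      rw [Fin.succ_castSucc] at h1
      exact h1.trans h2
    · exact fun i => ⟨(hab _).1.trans (hz i).1.le, (hz i).2.le.trans (hab _).2⟩

theorem iterate_deriv_sub {f g : ℝ → ℝ} {s : Set ℝ} (hf : ∀ x ∈ s, AnalyticAt ℝ f x)
    (hg : ∀ x ∈ s, AnalyticAt ℝ g x) (k : ℕ) {x : ℝ} (hx : x ∈ s) :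
    deriv^[k] (fun y => f y - g y) x = deriv^[k] f x - deriv^[k] g x := by
  rw [← iteratedDeriv_eq_iterate, ← iteratedDeriv_eq_iterate, ← iteratedDeriv_eq_iterate]
  exact iteratedDeriv_fun_sub (hf x hx).contDiffAt (hg x hx).contDiffAt

theorem Polynomial.iterate_deriv_eval (P : Polynomial ℝ) (k : ℕ) :
    deriv^[k] (fun x => P.eval x) = fun x => (Polynomial.derivative^[k] P).eval x := by
  induction k with
  | zero => rfl
  | succ k ih =>
    rw [Function.iterate_succ_apply', ih, Function.iterate_succ_apply']
    ext x
    simp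

theorem exists_iterate_deriv_eq_sum {k : ℕ} {f : ℝ → ℝ} {a b : ℝ}
    (hf : ∀ x ∈ Icc a b, AnalyticAt ℝ f x) {y : Fin (k + 1) → ℝ}
    (hy : Function.Injective y) (hab : ∀ i, y i ∈ Icc a b) :
    ∃ ξ ∈ Icc a b, deriv^[k] f ξ =
      k.factorial * ∑ i, f (y i) / ∏ j ∈ Finset.univ.erase i, (y i - y j) := by
  classical
  set P := Lagrange.interpolate Finset.univ y (fun i => f (y i)) with hP
  have hPe : ∀ i, P.eval (y i) = f (y i) := fun i =>
    Lagrange.eval_interpolate_at_node _ hy.injOn (Finset.mem_univ i)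
  have hPa : ∀ x ∈ Icc a b, AnalyticAt ℝ (fun x => P.eval x) x := fun x _ =>
    (AnalyticOnNhd.eval_polynomial P) x trivial
  have hcard : (Finset.univ.image y).card = k + 1 := by
    rw [Finset.card_image_of_injective _ hy]; simp
  let e := (Finset.univ.image y).orderEmbOfFin hcard
  have he : ∀ i, ∃ j, y j = e i := by
    intro i
    obtain ⟨j, -, hj⟩ := Finset.mem_image.mp (Finset.orderEmbOfFin_mem _ hcard i)
    exact ⟨j, hj⟩
  obtain ⟨ξ, hξ, h⟩ := exists_iterate_deriv_eq_zero (k := k)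
    (f := fun x => f x - P.eval x) (a := a) (b := b)
    (fun x hx => (hf x hx).sub (hPa x hx)) (y := e) e.strictMono
    (fun i => by obtain ⟨j, hj⟩ := he i; rw [← hj]; exact hab j)
    (fun i => by obtain ⟨j, hj⟩ := he i; rw [← hj, hPe, sub_self])
  refine ⟨ξ, hξ, ?_⟩
  rw [iterate_deriv_sub hf hPa k hξ, sub_eq_zero, Polynomial.iterate_deriv_eval] at h
  rw [h]
  simp only
  rw [Lagrange.eval_iterate_derivative_eq_sum (s := Finset.univ) hy.injOn
    (Lagrange.degree_interpolate_lt _ hy.injOn) (by simp)]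
  congr 1
  refine Finset.sum_congr rfl fun i _ => ?_
  rw [hPe]
  simp

theorem abs_le_of_separated {k : ℕ} {f : ℝ → ℝ} {a b A B ε d : ℝ} (hB : 1 ≤ B)
    (hf : ∀ x ∈ Icc a b, AnalyticAt ℝ f x) (hlow : ∀ x ∈ Icc a b, A ≤ |deriv^[k] f x|)
    (hup : ∀ x ∈ Icc a b, |deriv^[k] f x| ≤ B * A) (hε : 0 < ε) (hd : 0 < d) (hdab : d ≤ b - a)
    {y : Fin (k + 1) → ℝ} (hy : ∀ i, y i ∈ Icc a b ∧ |f (y i)| ≤ ε)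
    (hsep : ∀ i j, i ≠ j → d ≤ |y i - y j|) {x : ℝ} (hx : x ∈ Icc a b) :
    |f x| ≤ ((k + 1) * B + k) * ε * ((b - a) / d) ^ k := by
  have hr : 1 ≤ (b - a) / d := (one_le_div hd).mpr hdab
  have hr' : 1 ≤ ((b - a) / d) ^ k := one_le_pow₀ hr
  have hk0 : (0 : ℝ) ≤ k := Nat.cast_nonneg k
  have hAle : A ≤ (k + 1) * k.factorial * ε / d ^ k := by
    obtain ⟨ξ, hξ, h⟩ := exists_iterate_deriv_eq_sum hf (y := y)
      (fun i j hij => by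
        by_contra hne
        have := hsep i j hne
        rw [hij, sub_self, abs_zero] at this
        linarith) (fun i => (hy i).1)
    have h1 := hlow ξ hξ
    rw [h, abs_mul, Nat.abs_cast] at h1
    refine h1.trans ?_
    have : |∑ i, f (y i) / ∏ j ∈ Finset.univ.erase i, (y i - y j)| ≤ (k + 1) * (ε / d ^ k) := by
      refine (Finset.abs_sum_le_sum_abs _ _).trans ?_
      calc _ ≤ ∑ i : Fin (k + 1), ε / d ^ k := by
            refine Finset.sum_le_sum fun i _ => ?_
            rw [abs_div, Finset.abs_prod]
            refine div_le_div₀ hε.le (hy i).2 (by positivity) ?_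
            calc d ^ k = ∏ j ∈ Finset.univ.erase i, d := by simp
              _ ≤ _ := Finset.prod_le_prod (fun _ _ => hd.le) fun j hj =>
                  hsep i j (Finset.ne_of_mem_erase hj).symm
        _ = _ := by simp
    calc _ ≤ (k.factorial : ℝ) * ((k + 1) * (ε / d ^ k)) := by gcongr
      _ = _ := by ring
  by_cases hmem : ∃ i, y i = x
  · obtain ⟨i, rfl⟩ := hmem
    refine (hy i).2.trans ?_
    have : 1 ≤ (k + 1) * B + k := by nlinarith
    have : ε ≤ ((k + 1) * B + k) * ε := by nlinarith
    nlinarith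
  push Not at hmem
  let z : Fin (k + 1) → ℝ := Fin.cons x (fun i => y i.succ)
  have hz : Function.Injective z := by
    refine Fin.cons_injective_iff.mpr ⟨?_, ?_⟩
    · rintro ⟨i, hi⟩; exact hmem _ hi
    · intro i j hij
      by_contra hne
      have := hsep i.succ j.succ (by simpa using hne)
      simp only at hij
      rw [hij, sub_self, abs_zero] at this
      linarith
  have hzab : ∀ i, z i ∈ Icc a b := by
    intro i
    refine Fin.cases ?_ (fun i => ?_) i
    · exact hx
    · exact (hy _).1
  obtain ⟨ξ, hξ, h⟩ := exists_iterate_deriv_eq_sum hf hz hzab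
  have hL : ∀ i j, |z i - z j| ≤ b - a := fun i j => by
    have := hzab i; have := hzab j
    rw [abs_le]; constructor <;> linarith [(hzab i).1, (hzab i).2, (hzab j).1, (hzab j).2]
  set D : Fin (k + 1) → ℝ := fun i => ∏ j ∈ Finset.univ.erase i, (z i - z j) with hD
  have hD0 : ∀ i, D i ≠ 0 := fun i => Finset.prod_ne_zero_iff.mpr fun j hj =>
    sub_ne_zero.mpr fun hij => (Finset.ne_of_mem_erase hj) (hz hij).symm
  have hDL : |D 0| ≤ (b - a) ^ k := by
    rw [hD]; simp only [Finset.abs_prod]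
    calc _ ≤ ∏ j ∈ Finset.univ.erase (0 : Fin (k + 1)), (b - a) :=
          Finset.prod_le_prod (fun _ _ => abs_nonneg _) fun j _ => hL _ _
      _ = _ := by simp
  have hquot : ∀ i : Fin k, |D 0| / |D i.succ| ≤ ((b - a) / d) ^ k := by
    intro i
    have e0 : D 0 = (z 0 - z i.succ) * ∏ j ∈ (Finset.univ.erase 0).erase i.succ, (z 0 - z j) :=
      (Finset.mul_prod_erase _ (fun j => z 0 - z j)
        (Finset.mem_erase.mpr ⟨Fin.succ_ne_zero i, Finset.mem_univ _⟩)).symm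
    have e1 : D i.succ = (z i.succ - z 0) *
        ∏ j ∈ (Finset.univ.erase 0).erase i.succ, (z i.succ - z j) := by
      rw [Finset.erase_right_comm]
      exact (Finset.mul_prod_erase _ (fun j => z i.succ - z j)
        (Finset.mem_erase.mpr ⟨(Fin.succ_ne_zero i).symm, Finset.mem_univ _⟩)).symm
    have hne : |z 0 - z i.succ| ≠ 0 := abs_ne_zero.mpr (sub_ne_zero.mpr fun hh => Fin.succ_ne_zero i (hz hh).symm)
    rw [e0, e1, abs_mul, abs_mul, abs_sub_comm (z i.succ) (z 0), mul_div_mul_left _ _ hne,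
      Finset.abs_prod, Finset.abs_prod, ← Finset.prod_div_distrib]
    calc _ ≤ ∏ j ∈ (Finset.univ.erase 0).erase i.succ, ((b - a) / d) := by
          refine Finset.prod_le_prod (fun _ _ => by positivity) fun j hj => ?_
          have hj1 := Finset.ne_of_mem_erase hj
          have hj2 := Finset.ne_of_mem_erase (Finset.mem_of_mem_erase hj)
          refine div_le_div₀ (by linarith) (hL _ _) hd ?_
          obtain ⟨j, rfl⟩ := Fin.exists_succ_eq.mpr hj2
          exact hsep _ _ fun hh => hj1 hh.symm
      _ = ((b - a) / d) ^ (k - 1) := by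
          rw [Finset.prod_const, Finset.card_erase_of_mem
            (Finset.mem_erase.mpr ⟨Fin.succ_ne_zero i, Finset.mem_univ _⟩),
            Finset.card_erase_of_mem (Finset.mem_univ _)]
          simp
      _ ≤ _ := pow_le_pow_right₀ hr (by omega)
  have hfx : f x = D 0 * (deriv^[k] f ξ / k.factorial) -
      ∑ i : Fin k, f (z i.succ) * (D 0 / D i.succ) := by
    have hfac : (k.factorial : ℝ) ≠ 0 := by exact_mod_cast k.factorial_ne_zero
    rw [h, mul_div_cancel_left₀ _ hfac, Fin.sum_univ_succ, mul_add, Finset.mul_sum]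
    have : D 0 * (f (z 0) / D 0) = f x := by
      rw [mul_div_cancel₀ _ (hD0 0)]; rfl
    change f x = D 0 * (f (z 0) / D 0) + ∑ i : Fin k, D 0 * (f (z i.succ) / D i.succ) - _
    rw [this, add_sub_assoc, left_eq_add, sub_eq_zero]
    refine Finset.sum_congr rfl fun i _ => by ring
  have hfac : (0 : ℝ) < k.factorial := by exact_mod_cast k.factorial_pos
  calc |f x| ≤ |D 0 * (deriv^[k] f ξ / k.factorial)| +
        |∑ i : Fin k, f (z i.succ) * (D 0 / D i.succ)| := by rw [hfx]; exact abs_sub _ _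
    _ ≤ (b - a) ^ k * (B * ((k + 1) * k.factorial * ε / d ^ k) / k.factorial) +
        ∑ i : Fin k, ε * ((b - a) / d) ^ k := by
        gcongr
        · rw [abs_mul, abs_div, Nat.abs_cast]
          have : |deriv^[k] f ξ| ≤ B * ((k + 1) * k.factorial * ε / d ^ k) :=
            (hup ξ hξ).trans (by gcongr)
          have hba : 0 ≤ b - a := by linarith
          gcongr
        · refine (Finset.abs_sum_le_sum_abs _ _).trans (Finset.sum_le_sum fun i _ => ?_)
          rw [abs_mul, abs_div]
          exact mul_le_mul (hy _).2 (hquot i) (by positivity) hε.le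
    _ = _ := by
        rw [Finset.sum_const, Finset.card_univ, Fintype.card_fin, nsmul_eq_mul, div_pow]
        field_simp

theorem iterate_deriv_sum {ι : Type*} [Fintype ι] {g : ι → ℝ → ℝ} (a : ι → ℝ) {x : ℝ}
    (hg : ∀ i, AnalyticAt ℝ (g i) x) (k : ℕ) :
    deriv^[k] (fun y => ∑ i, a i * g i y) x = ∑ i, a i * deriv^[k] (g i) x := by
  simp only [← iteratedDeriv_eq_iterate]
  have h : ∀ i ∈ Finset.univ, ContDiffAt ℝ k (fun y => a i * g i y) x := fun i _ =>
    contDiffAt_const.mul (hg i).contDiffAt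
  rw [iteratedDeriv_fun_sum h]
  exact Finset.sum_congr rfl fun i _ => iteratedDeriv_const_mul_field _ _

theorem AnalyticAt.sum_const_mul {ι : Type*} [Fintype ι] {g : ι → ℝ → ℝ} (a : ι → ℝ) {x : ℝ}
    (hg : ∀ i, AnalyticAt ℝ (g i) x) : AnalyticAt ℝ (fun y => ∑ i, a i * g i y) x :=
  Finset.analyticAt_fun_sum _ fun i _ => analyticAt_const.mul (hg i)

theorem AnalyticAt.eventually_eq_zero_of_iterate_deriv {f : ℝ → ℝ} {x : ℝ}
    (hf : AnalyticAt ℝ f x) (h : ∀ k, deriv^[k] f x = 0) : ∀ᶠ y in nhds x, f y = 0 := by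
  have h1 := hf.hasFPowerSeriesAt
  have : (FormalMultilinearSeries.ofScalars ℝ fun n => iteratedDeriv n f x / n.factorial) = 0 := by
    ext n : 1
    rw [FormalMultilinearSeries.zero_apply, FormalMultilinearSeries.ofScalars_eq_zero,
      iteratedDeriv_eq_iterate, h, zero_div]
  rw [this] at h1
  exact h1.eventually_eq_zero

/-- The combinations of finitely many analytic functions are uniformly `SepGood` near a point. -/
theorem exists_sepGood {ι : Type*} [Fintype ι] {g : ι → ℝ → ℝ} {x₀ : ℝ}
    (hg : ∀ i, AnalyticAt ℝ (g i) x₀) :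
    ∃ δ > 0, ∃ k : ℕ, 1 ≤ k ∧ ∃ C : ℝ, 1 ≤ C ∧ ∀ a : ι → ℝ,
      SepGood C k (fun x => ∑ i, a i * g i x) (Icc (x₀ - δ) (x₀ + δ)) := by
  have hev : ∀ᶠ x in nhds x₀, ∀ i, AnalyticAt ℝ (g i) x :=
    eventually_all.mpr fun i => (hg i).eventually_analyticAt
  obtain ⟨r, hr, hball⟩ := Metric.eventually_nhds_iff_ball.mp hev
  let D : ℕ → (ι → ℝ) →ₗ[ℝ] ℝ := fun k =>
    ∑ i, (deriv^[k] (g i) x₀) • (LinearMap.proj i : (ι → ℝ) →ₗ[ℝ] ℝ)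
  have hD : ∀ k a, D k a = deriv^[k] (fun y => ∑ i, a i * g i y) x₀ := by
    intro k a
    rw [iterate_deriv_sum a hg]
    simp [D, mul_comm]
  let F : ℕ →o (Submodule ℝ (ι → ℝ))ᵒᵈ :=
    ⟨fun k => OrderDual.toDual (⨅ j ∈ Finset.range k, LinearMap.ker (D j)), fun m n hmn =>
      OrderDual.toDual_le_toDual.mpr (biInf_mono fun j hj => by
        simp only [Finset.mem_range] at hj ⊢; omega)⟩
  obtain ⟨K, hK⟩ := IsArtinian.monotone_stabilizes F
  have hFmem : ∀ k a, a ∈ OrderDual.ofDual (F k) ↔ ∀ j < k, D j a = 0 := by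
    intro k a; simp [F]
  set N : Submodule ℝ (ι → ℝ) := OrderDual.ofDual (F K) with hN
  have hNall : ∀ a ∈ N, ∀ j, D j a = 0 := by
    intro a ha j
    rcases le_total K (j + 1) with h | h
    · rw [hN, hK (j + 1) h, hFmem] at ha
      exact ha j (by omega)
    · rw [hN, hFmem] at ha; exact ha j (by omega)
  have hNzero : ∀ a ∈ N, ∀ x ∈ Metric.ball x₀ r, ∑ i, a i * g i x = 0 := by
    intro a ha
    have han : AnalyticOnNhd ℝ (fun x => ∑ i, a i * g i x) (Metric.ball x₀ r) :=
      fun x hx => AnalyticAt.sum_const_mul a (hball x hx)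
    exact han.eqOn_zero_of_preconnected_of_eventuallyEq_zero
      (convex_ball x₀ r).isPreconnected (Metric.mem_ball_self hr)
      ((AnalyticAt.sum_const_mul a hg).eventually_eq_zero_of_iterate_deriv
        fun k => by rw [← hD]; exact hNall a ha k)
  obtain ⟨N', hN'⟩ := N.exists_isCompl
  let L : N' →ₗ[ℝ] (Fin K → ℝ) := LinearMap.pi fun j => (D j).comp N'.subtype
  have hL : LinearMap.ker L = ⊥ := by
    rw [LinearMap.ker_eq_bot']
    intro a ha
    have : (a : ι → ℝ) ∈ N := by
      rw [hN, hFmem]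
      intro j hj
      exact congrFun ha ⟨j, hj⟩
    have h2 : (a : ι → ℝ) ∈ N ⊓ N' := ⟨this, a.2⟩
    rw [hN'.inf_eq_bot, Submodule.mem_bot] at h2
    exact Subtype.ext h2
  obtain ⟨C₁, hC₁, hanti⟩ := L.exists_antilipschitzWith hL
  have hbound : ∀ a : N', ‖(a : ι → ℝ)‖ ≤ C₁ * ‖L a‖ := by
    intro a
    have := hanti.le_mul_dist a 0
    simpa using this
  set η : ℝ := 1 / (2 * C₁ * (Fintype.card ι + 1)) with hη
  have hη0 : 0 < η := by positivity
  have hcont : ∀ᶠ x in nhds x₀, ∀ (j : Fin K) (i : ι),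
      |deriv^[j] (g i) x - deriv^[j] (g i) x₀| < η := by
    refine eventually_all.mpr fun j => eventually_all.mpr fun i => ?_
    have := ((hg i).iterated_deriv j).continuousAt
    exact Metric.continuousAt_iff'.mp this η hη0
  obtain ⟨δ', hδ', hδ'c⟩ := Metric.eventually_nhds_iff_ball.mp hcont
  refine ⟨min r δ' / 2, by positivity, K + 1, by omega, 4 * (K + 1), ?_, ?_⟩
  · have : (0 : ℝ) ≤ K := Nat.cast_nonneg K
    linarith
  intro a u v huv hsub ε d hε hd y hy hsep x hx
  have hK0 : (0 : ℝ) ≤ K := Nat.cast_nonneg K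
  have hmemball : ∀ z ∈ Icc u v, z ∈ Metric.ball x₀ r ∧ z ∈ Metric.ball x₀ δ' := by
    intro z hz
    have hz' := hsub hz
    have h1 := min_le_left r δ'
    have h2 := min_le_right r δ'
    have h0 : 0 < min r δ' := lt_min hr hδ'
    rw [Metric.mem_ball, Metric.mem_ball, Real.dist_eq]
    have : |z - x₀| < min r δ' := by
      rw [abs_lt]; constructor <;> linarith [hz'.1, hz'.2]
    exact ⟨by linarith, by linarith⟩
  have hr0 : 0 ≤ (v - u) / d := by have := huv.le; exact div_nonneg (by linarith) hd.le
  have hatop : a ∈ N ⊔ N' := by rw [hN'.sup_eq_top]; trivial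
  obtain ⟨n, hn, b, hb, rfl⟩ := Submodule.mem_sup.mp hatop
  have hfe : ∀ z ∈ Icc u v, ∑ i, (n + b) i * g i z = ∑ i, b i * g i z := by
    intro z hz
    simp only [Pi.add_apply, add_mul, Finset.sum_add_distrib,
      hNzero n hn z (hmemball z hz).1, zero_add]
  simp only at hy ⊢
  rw [hfe x hx]
  have hy' : ∀ i, y i ∈ Icc u v ∧ |∑ j, b j * g j (y i)| ≤ ε := fun i =>
    ⟨(hy i).1, by rw [← hfe _ (hy i).1]; exact (hy i).2⟩
  by_cases hL0 : ‖L ⟨b, hb⟩‖ = 0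
  · have hb0 : ‖b‖ ≤ 0 := by
      have := hbound ⟨b, hb⟩
      rwa [hL0, mul_zero] at this
    rw [norm_le_zero_iff] at hb0
    subst hb0
    simp only [Pi.zero_apply, zero_mul, Finset.sum_const_zero, abs_zero]
    positivity
  set A := ‖L ⟨b, hb⟩‖ with hA
  have hApos : 0 < A := lt_of_le_of_ne (norm_nonneg _) (Ne.symm hL0)
  have hKne : Nonempty (Fin K) := by
    by_contra hcon
    rw [not_nonempty_iff] at hcon
    exact hL0 (by rw [hA, Subsingleton.elim (L ⟨b, hb⟩) 0, norm_zero])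
  obtain ⟨k, hk⟩ := Finite.exists_max (fun j => ‖L ⟨b, hb⟩ j‖)
  have hAk : A = |deriv^[k] (fun y => ∑ i, b i * g i y) x₀| := by
    rw [← hD]
    change A = ‖L ⟨b, hb⟩ k‖
    exact le_antisymm ((pi_norm_le_iff_of_nonneg (norm_nonneg _)).mpr hk) (norm_le_pi_norm _ k)
  have hvar : ∀ z ∈ Icc u v, |deriv^[k] (fun y => ∑ i, b i * g i y) z -
      deriv^[k] (fun y => ∑ i, b i * g i y) x₀| ≤ A / 2 := by
    intro z hz
    rw [iterate_deriv_sum b (hball z (hmemball z hz).1), iterate_deriv_sum b hg,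
      ← Finset.sum_sub_distrib]
    refine (Finset.abs_sum_le_sum_abs _ _).trans ?_
    calc _ ≤ ∑ i : ι, (C₁ * A) * η := by
          refine Finset.sum_le_sum fun i _ => ?_
          rw [← mul_sub, abs_mul]
          refine mul_le_mul ?_ (hδ'c z (hmemball z hz).2 k i).le (abs_nonneg _) (by positivity)
          exact (norm_le_pi_norm b i).trans (hbound ⟨b, hb⟩)
      _ ≤ (Fintype.card ι + 1) * ((C₁ * A) * η) := by
          rw [Finset.sum_const, Finset.card_univ, nsmul_eq_mul]
          gcongr
          linarith
      _ = A / 2 := by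
          rw [hη]
          have : (C₁ : ℝ) ≠ 0 := by exact_mod_cast hC₁.ne'
          field_simp
  have hle : d ≤ v - u := by
    have h1 := hsep 0 1 (by simp)
    refine h1.trans ?_
    have h2 := (hy 0).1
    have h3 := (hy 1).1
    rw [abs_le]; constructor <;> linarith [h2.1, h2.2, h3.1, h3.2]
  have hkK : (k : ℕ) + 1 ≤ K + 1 + 1 := by omega
  have key := abs_le_of_separated (k := k) (A := A / 2) (B := 3) (f := fun y => ∑ i, b i * g i y)
    (by norm_num)
    (fun z hz => AnalyticAt.sum_const_mul b (hball z (hmemball z hz).1))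
    (fun z hz => by
      have h1 := hvar z hz
      have h2 := abs_sub_abs_le_abs_sub (deriv^[k] (fun y => ∑ i, b i * g i y) x₀)
        (deriv^[k] (fun y => ∑ i, b i * g i y) z)
      rw [abs_sub_comm, ← hAk] at h2
      linarith)
    (fun z hz => by
      have h1 := hvar z hz
      have h2 := abs_sub_abs_le_abs_sub (deriv^[k] (fun y => ∑ i, b i * g i y) z)
        (deriv^[k] (fun y => ∑ i, b i * g i y) x₀)
      rw [← hAk] at h2
      linarith)
    hε hd hle (y := fun i => y (Fin.castLE hkK i)) (fun i => hy' _)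
    (fun i j hij => hsep _ _ (fun h => hij (Fin.castLE_injective hkK h))) hx
  refine key.trans ?_
  have hr1 : 1 ≤ (v - u) / d := (one_le_div hd).mpr hle
  have hkr : ((k : ℕ) : ℝ) + 1 ≤ K := by exact_mod_cast k.2
  have hp : ((v - u) / d) ^ (k : ℕ) ≤ ((v - u) / d) ^ (2 * (K + 1)) :=
    pow_le_pow_right₀ hr1 (by omega)
  calc _ ≤ 4 * (K + 1) * ε * ((v - u) / d) ^ (k : ℕ) := by
        gcongr
        linarith
    _ ≤ _ := by gcongr

/-- The maximal minor of `Y` with rows listed by `S`. -/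
def minor {I R : Type*} [CommRing R] {k : ℕ} (Y : Matrix I (Fin k) R) (S : Fin k → I) : R :=
  (Y.submatrix S id).det

section
variable {I R : Type*} [CommRing R] {k : ℕ}

theorem minor_of_not_injective (Y : Matrix I (Fin k) R) {S : Fin k → I}
    (hS : ¬ Function.Injective S) : minor Y S = 0 := by
  obtain ⟨a, b, hab, hne⟩ := Function.not_injective_iff.mp hS
  exact Matrix.det_zero_of_row_eq hne (by ext j; simp [hab])

theorem det_mul_eq_sum_minor [Fintype I] (c : Matrix (Fin k) I R) (Y : Matrix I (Fin k) R) :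
    (c * Y).det = ∑ T : Fin k → I, (∏ a, c a (T a)) * minor Y T := by
  classical
  have h : (c * Y : Matrix (Fin k) (Fin k) R) = fun a => ∑ l, c a l • Y l := by
    ext a j
    simp [Matrix.mul_apply]
  have h2 := (Matrix.detRowAlternating (n := Fin k) (R := R)).toMultilinearMap.map_sum
    (fun a l => c a l • Y l)
  rw [h]
  refine h2.trans (Finset.sum_congr rfl fun T _ => ?_)
  exact (Matrix.detRowAlternating (n := Fin k) (R := R)).toMultilinearMap.map_smul_univ
    (fun a => c a (T a)) (fun a => Y (T a))

theorem minor_mul [Fintype I] (M : Matrix I I R) (Y : Matrix I (Fin k) R) (S : Fin k → I) :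
    minor (M * Y) S = ∑ T : Fin k → I, (∏ a, M (S a) (T a)) * minor Y T :=
  det_mul_eq_sum_minor (M.submatrix S id) Y

theorem minor_mul_right (Y : Matrix I (Fin k) R) (T : Matrix (Fin k) (Fin k) R)
    (S : Fin k → I) : minor (Y * T) S = minor Y S * T.det := by
  unfold minor
  rw [← Matrix.det_mul]
  rfl

theorem minor_scale (d : I → R) (Y : Matrix I (Fin k) R) (S : Fin k → I) :
    minor (Matrix.of fun i b => d i * Y i b) S = (∏ a, d (S a)) * minor Y S :=
  Matrix.det_mul_column (fun a => d (S a)) (Y.submatrix S id)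

theorem minor_map {R' : Type*} [CommRing R'] (f : R →+* R') (Y : Matrix I (Fin k) R)
    (S : Fin k → I) : minor (Y.map f) S = f (minor Y S) := by
  unfold minor
  rw [RingHom.map_det]
  rfl

theorem abs_det_le_prod (A : Matrix (Fin k) (Fin k) ℝ) (β : Fin k → ℝ)
    (h : ∀ a b, |A a b| ≤ β a) : |A.det| ≤ k.factorial * ∏ a, β a := by
  rw [Matrix.det_apply]
  refine (Finset.abs_sum_le_sum_abs _ _).trans ?_
  have : ∀ σ ∈ (Finset.univ : Finset (Equiv.Perm (Fin k))),
      |Equiv.Perm.sign σ • ∏ i, A (σ i) i| ≤ ∏ a, β a := by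
    intro σ _
    have h1 : |Equiv.Perm.sign σ • ∏ i, A (σ i) i| = ∏ i, |A (σ i) i| := by
      rw [← Finset.abs_prod]
      rcases Int.units_eq_one_or (Equiv.Perm.sign σ) with h | h <;> simp [h]
    rw [h1, ← Equiv.prod_comp σ β]
    exact Finset.prod_le_prod (fun _ _ => abs_nonneg _) fun i _ => h _ _
  refine (Finset.sum_le_card_nsmul _ _ _ this).trans ?_
  rw [Finset.card_univ, Fintype.card_perm, Fintype.card_fin, nsmul_eq_mul]

/-- Laplace expansion of a minor along a column. -/
theorem abs_minor_cons_le (Y : Matrix I (Fin (k + 1)) ℝ) (S : Fin (k + 1) → I) :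
    |minor Y S| ≤ ∑ a, |Y (S a) 0| *
      |minor (Y.submatrix id Fin.succ) (S ∘ a.succAbove)| := by
  unfold minor
  rw [Matrix.det_succ_column_zero]
  refine (Finset.abs_sum_le_sum_abs _ _).trans (Finset.sum_le_sum fun a _ => ?_)
  rw [abs_mul, abs_mul, abs_pow, abs_neg, abs_one, one_pow, one_mul]
  rfl

theorem exists_minor_ne_zero {F : Type*} [Field F] [Fintype I] {Y : Matrix I (Fin k) F}
    (h : LinearIndependent F Y.col) : ∃ S, minor Y S ≠ 0 := by
  classical
  by_contra! hcon
  have hinj : Function.Injective Y.mulVecLin := by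
    have := Matrix.mulVec_injective_iff.mpr h
    exact this
  obtain ⟨L, hL⟩ := Y.mulVecLin.exists_leftInverse_of_injective (LinearMap.ker_eq_bot.mpr hinj)
  have h1 : LinearMap.toMatrix' L * Y = 1 := by
    have := congrArg LinearMap.toMatrix' hL
    rw [LinearMap.toMatrix'_comp, ← Matrix.toLin'_apply', LinearMap.toMatrix'_toLin',
      LinearMap.toMatrix'_id] at this
    exact this
  have h2 := det_mul_eq_sum_minor (LinearMap.toMatrix' L) Y
  rw [h1, Matrix.det_one, Finset.sum_eq_zero fun T _ => by rw [hcon, mul_zero]] at h2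
  exact one_ne_zero h2

/-- Cramer's rule: the coefficients of `Y` on a nonsingular set of rows are quotients of
minors. -/
theorem exists_cramer [DecidableEq I] {F : Type*} [Field F] {Y : Matrix I (Fin k) F}
    {S : Fin k → I} (h : minor Y S ≠ 0) :
    ∃ K : Matrix I (Fin k) F, Y = K * Y.submatrix S id ∧
      ∀ i a, K i a = minor Y (Function.update S a i) / minor Y S := by
  have hu : IsUnit (Y.submatrix S id).det := isUnit_iff_ne_zero.mpr h
  refine ⟨Y * (Y.submatrix S id)⁻¹, ?_, fun i a => ?_⟩
  · rw [Matrix.mul_assoc, Matrix.nonsing_inv_mul _ hu, Matrix.mul_one]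
  · have h1 := Matrix.det_smul_inv_vecMul_eq_cramer_transpose (Y.submatrix S id) (Y i) hu
    have h2 := congrFun h1 a
    rw [Matrix.cramer_transpose_apply] at h2
    rw [eq_div_iff h]
    have h3 : (Y.submatrix S id).updateRow a (Y i) =
        Y.submatrix (Function.update S a i) id := by
      ext c j
      by_cases hc : c = a
      · subst hc; simp
      · simp [hc]
    rw [h3] at h2
    rw [mul_comm]
    exact h2

theorem exists_int_mulVec_le [NeZero k] (A : Matrix (Fin k) (Fin k) ℝ) (hA : A.det ≠ 0) {r : ℝ}
    (hr : 0 < r) (h : |A.det| < r ^ k) :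
    ∃ a : Fin k → ℤ, a ≠ 0 ∧ ∀ i, |∑ j, A i j * (a j : ℝ)| ≤ r := by
  classical
  let b := Pi.basisFun ℝ (Fin k)
  let s : Set (Fin k → ℝ) := Matrix.toLin' A ⁻¹' Metric.closedBall 0 r
  have hdet : LinearMap.det (Matrix.toLin' A) ≠ 0 := by rwa [LinearMap.det_toLin']
  have hvol : MeasureTheory.volume s = ENNReal.ofReal (|A.det|⁻¹ * (2 * r) ^ k) := by
    rw [MeasureTheory.Measure.addHaar_preimage_linearMap _ hdet, LinearMap.det_toLin',
      Real.volume_pi_closedBall _ hr.le, abs_inv, Fintype.card_fin,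
      ← ENNReal.ofReal_mul (by positivity)]
  have hF : MeasureTheory.volume (ZSpan.fundamentalDomain b) = 1 := by
    rw [ZSpan.volume_fundamentalDomain]
    have : (Matrix.of ⇑b) = 1 := by
      ext i j; simp [b, Matrix.one_apply, Pi.single_apply, eq_comm]
    rw [this]; simp
  have hfund := ZSpan.isAddFundamentalDomain b MeasureTheory.volume
  have : Countable (Submodule.span ℤ (Set.range b)).toAddSubgroup :=
    inferInstanceAs (Countable (Submodule.span ℤ (Set.range b)))
  have hsymm : ∀ x ∈ s, -x ∈ s := by
    intro x hx
    simp only [s, mem_preimage, mem_closedBall_zero_iff, map_neg, norm_neg] at hx ⊢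
    exact hx
  have hconv : Convex ℝ s := (convex_closedBall 0 r).linear_preimage _
  have hlt : MeasureTheory.volume (ZSpan.fundamentalDomain b) * 2 ^ Module.finrank ℝ (Fin k → ℝ) <
      MeasureTheory.volume s := by
    rw [hF, hvol, one_mul, Module.finrank_fin_fun]
    have h2 : (2 : ℝ≥0∞) ^ k = ENNReal.ofReal (2 ^ k) := by
      rw [ENNReal.ofReal_pow (by norm_num)]; simp
    rw [h2]
    have hA0 : 0 < |A.det| := abs_pos.mpr hA
    refine (ENNReal.ofReal_lt_ofReal_iff (by positivity)).mpr ?_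
    rw [mul_pow, inv_mul_eq_div, lt_div_iff₀ hA0]
    have : (0 : ℝ) < 2 ^ k := by positivity
    nlinarith
  obtain ⟨⟨x, hx⟩, hne, hxs⟩ :=
    MeasureTheory.exists_ne_zero_mem_lattice_of_measure_mul_two_pow_lt_measure
    (L := (Submodule.span ℤ (Set.range b)).toAddSubgroup) hfund hsymm hconv hlt
  have hx' : x ∈ Submodule.span ℤ (Set.range b) := hx
  rw [b.mem_span_iff_repr_mem ℤ] at hx'
  choose a ha using hx'
  have hax : x = fun i => (a i : ℝ) := by
    ext i
    have := ha i
    simp only [b, Pi.basisFun_repr] at this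
    rw [← this]; simp
  refine ⟨a, ?_, ?_⟩
  · rintro rfl
    apply hne
    apply Subtype.ext
    simp only [hax]
    ext i; simp
  · intro i
    have h1 : ‖Matrix.toLin' A x‖ ≤ r := by simpa [s] using hxs
    have h2 := (norm_le_pi_norm (Matrix.toLin' A x) i).trans h1
    rw [Matrix.toLin'_apply, hax] at h2
    exact h2

/-- Minkowski's theorem for a system of `I` linear forms in `k` variables, in terms of minors. -/
theorem exists_int_mulVec_le_of_minor [Fintype I] [NeZero k] {Y : Matrix I (Fin k) ℝ} {r : ℝ}
    (hr : 0 < r) (hne : ∃ S, minor Y S ≠ 0) (h : ∀ S, |minor Y S| < r ^ k) :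
    ∃ a : Fin k → ℤ, a ≠ 0 ∧ ∀ i, |∑ j, Y i j * (a j : ℝ)| ≤ k * r := by
  classical
  obtain ⟨S₀, hS₀⟩ := hne
  have : Nonempty (Fin k → I) := ⟨S₀⟩
  obtain ⟨S, hS⟩ := Finite.exists_max fun S => |minor Y S|
  have hS0 : 0 < |minor Y S| := (abs_pos.mpr hS₀).trans_le (hS S₀)
  obtain ⟨K, hK, hKe⟩ := exists_cramer (abs_pos.mp hS0)
  obtain ⟨a, ha, hle⟩ := exists_int_mulVec_le (Y.submatrix S id) (abs_pos.mp hS0) hr (h S)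
  refine ⟨a, ha, fun i => ?_⟩
  have h1 : ∑ j, Y i j * (a j : ℝ) = ∑ c, K i c * ∑ j, Y (S c) j * (a j : ℝ) := by
    conv_lhs => rw [hK]
    simp only [Matrix.mul_apply, Finset.sum_mul, Finset.mul_sum]
    rw [Finset.sum_comm]
    simp [mul_assoc]
  rw [h1]
  refine (Finset.abs_sum_le_sum_abs _ _).trans ?_
  refine (Finset.sum_le_card_nsmul _ _ r fun c _ => ?_).trans ?_
  · rw [abs_mul]
    have : |K i c| ≤ 1 := by
      rw [hKe, abs_div, div_le_one hS0]; exact hS _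
    have h2 := hle c
    calc _ ≤ 1 * r := mul_le_mul this h2 (abs_nonneg _) zero_le_one
      _ = r := one_mul r
  · simp
end

/-- The columns of `Z` form a basis of the rational subspace `V`. -/
def IsIntBasis {I : Type*} (V : Submodule ℚ (I → ℚ)) {k : ℕ} (Z : Matrix I (Fin k) ℤ) : Prop :=
  LinearIndependent ℚ (Z.map (Int.cast : ℤ → ℚ)).col ∧
    Submodule.span ℚ (range (Z.map (Int.cast : ℤ → ℚ)).col) = V

section
variable {I : Type*} [Fintype I] {V : Submodule ℚ (I → ℚ)} {k : ℕ}

omit [Fintype I] in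
theorem IsIntBasis.finrank_eq {Z : Matrix I (Fin k) ℤ} (h : IsIntBasis V Z) :
    Module.finrank ℚ V = k := by
  rw [← h.2, finrank_span_eq_card h.1, Fintype.card_fin]

theorem exists_int_multiple (v : I → ℚ) : ∃ d : ℕ, d ≠ 0 ∧ ∃ z : I → ℤ, ∀ i, (z i : ℚ) = d * v i := by
  refine ⟨∏ i, (v i).den, Finset.prod_ne_zero_iff.mpr fun i _ => (v i).den_nz, ?_⟩
  have : ∀ i, ∃ z : ℤ, (z : ℚ) = ((∏ i, (v i).den : ℕ) : ℚ) * v i := by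
    intro i
    obtain ⟨c, hc⟩ := Finset.dvd_prod_of_mem (fun i => (v i).den) (Finset.mem_univ i)
    refine ⟨c * (v i).num, ?_⟩
    rw [hc]
    push_cast
    rw [mul_comm ((v i).den : ℚ), mul_assoc, Rat.den_mul_eq_num]
  choose z hz using this
  exact ⟨z, hz⟩

theorem exists_isIntBasis (V : Submodule ℚ (I → ℚ)) :
    ∃ Z : Matrix I (Fin (Module.finrank ℚ V)) ℤ, IsIntBasis V Z := by
  let b := Module.finBasis ℚ V
  choose d hd z hz using fun j => exists_int_multiple (b j : I → ℚ)
  have hcol : (Matrix.map (Matrix.of fun i j => z j i) (Int.cast : ℤ → ℚ)).col =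
      fun j => (d j : ℚ) • (b j : I → ℚ) := by
    ext j i
    simp [Matrix.col, hz]
  have hli : LinearIndependent ℚ fun j => (d j : ℚ) • (b j : I → ℚ) := by
    have h1 : LinearIndependent ℚ fun j => (b j : I → ℚ) :=
      b.linearIndependent.map' V.subtype V.ker_subtype
    exact h1.units_smul fun j => Units.mk0 (d j : ℚ) (by exact_mod_cast hd j)
  refine ⟨Matrix.of fun i j => z j i, ?_, ?_⟩
  · rw [hcol]; exact hli
  · rw [hcol]
    apply Submodule.eq_of_le_of_finrank_eq
    · rw [Submodule.span_le]
      rintro _ ⟨j, rfl⟩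
      exact V.smul_mem _ (b j).2
    · rw [finrank_span_eq_card hli, Fintype.card_fin]

theorem IsIntBasis.exists_minor_ne_zero {Z : Matrix I (Fin k) ℤ} (h : IsIntBasis V Z) :
    ∃ S, minor Z S ≠ 0 := by
  obtain ⟨S, hS⟩ := _root_.exists_minor_ne_zero h.1
  refine ⟨S, fun h0 => hS ?_⟩
  have := minor_map (Int.castRingHom ℚ) Z S
  rw [h0, map_zero] at this
  exact this

theorem IsIntBasis.exists_minor_mul {Z Z' : Matrix I (Fin k) ℤ}
    (h : IsIntBasis V Z) (h' : IsIntBasis V Z') :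
    ∃ t : ℚ, ∀ (M : Matrix I I ℝ) S, minor (M * Z'.map (Int.cast : ℤ → ℝ)) S =
      minor (M * Z.map (Int.cast : ℤ → ℝ)) S * (t : ℝ) := by
  have hmem : ∀ j, ∃ c : Fin k → ℚ, ∑ a, c a • (Z.map (Int.cast : ℤ → ℚ)).col a =
      (Z'.map (Int.cast : ℤ → ℚ)).col j := by
    intro j
    rw [← Submodule.mem_span_range_iff_exists_fun, h.2, ← h'.2]
    exact Submodule.subset_span ⟨j, rfl⟩
  choose c hc using hmem
  let T : Matrix (Fin k) (Fin k) ℚ := Matrix.of fun a j => c j a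
  have hT : Z'.map (Int.cast : ℤ → ℝ) = Z.map (Int.cast : ℤ → ℝ) * T.map (Rat.cast : ℚ → ℝ) := by
    ext i j
    have := congrFun (hc j) i
    simp only [Finset.sum_apply, Pi.smul_apply, smul_eq_mul, Matrix.col_apply,
      Matrix.map_apply] at this
    rw [Matrix.mul_apply]
    simp only [Matrix.map_apply, T, Matrix.of_apply]
    rw [← Rat.cast_intCast, ← this]
    push_cast
    exact Finset.sum_congr rfl fun a _ => mul_comm _ _
  refine ⟨T.det, fun M S => ?_⟩
  rw [hT, ← Matrix.mul_assoc, minor_mul_right]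
  congr 1
  exact (RingHom.map_det (Rat.castHom ℝ) T).symm

/-- A basis of integer vectors minimising all generalised minors simultaneously. -/
theorem exists_isIntBasis_minimal (V : Submodule ℚ (I → ℚ)) :
    ∃ Z : Matrix I (Fin (Module.finrank ℚ V)) ℤ, IsIntBasis V Z ∧
      ∀ Z' : Matrix I (Fin (Module.finrank ℚ V)) ℤ, IsIntBasis V Z' →
        ∀ (M : Matrix I I ℝ) S, |minor (M * Z.map (Int.cast : ℤ → ℝ)) S| ≤
          |minor (M * Z'.map (Int.cast : ℤ → ℝ)) S| := by
  classical
  let ht : Matrix I (Fin (Module.finrank ℚ V)) ℤ → ℕ := fun Z => ∑ S, (minor Z S).natAbs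
  obtain ⟨Z₀, hZ₀⟩ := exists_isIntBasis V
  obtain ⟨Z, hZ, hmin⟩ : ∃ Z ∈ {Z | IsIntBasis V Z}, ∀ Z' ∈ {Z | IsIntBasis V Z}, ht Z ≤ ht Z' := by
    obtain ⟨Z, hZ, h⟩ := (InvImage.wf ht Nat.lt_wfRel.wf).has_min {Z | IsIntBasis V Z} ⟨Z₀, hZ₀⟩
    exact ⟨Z, hZ, fun Z' hZ' => not_lt.mp (h Z' hZ')⟩
  refine ⟨Z, hZ, fun Z' hZ' M S => ?_⟩
  obtain ⟨t, ht'⟩ := hZ.exists_minor_mul hZ'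
  have hcast : ∀ Y : Matrix I (Fin (Module.finrank ℚ V)) ℤ,
      ((ht Y : ℕ) : ℝ) = ∑ S, |minor ((1 : Matrix I I ℝ) * Y.map (Int.cast : ℤ → ℝ)) S| := by
    intro Y
    simp only [ht, Nat.cast_sum, Matrix.one_mul]
    refine Finset.sum_congr rfl fun S _ => ?_
    have := minor_map (Int.castRingHom ℝ) Y S
    rw [show Y.map (Int.cast : ℤ → ℝ) = Y.map (Int.castRingHom ℝ) from rfl, this]
    simp [Nat.cast_natAbs]
  have h1 : ((ht Z' : ℕ) : ℝ) = ht Z * |(t : ℝ)| := by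
    rw [hcast, hcast, Finset.sum_mul]
    exact Finset.sum_congr rfl fun S _ => by rw [ht', abs_mul]
  have hpos : 0 < ht Z := by
    obtain ⟨S, hS⟩ := hZ.exists_minor_ne_zero
    refine lt_of_lt_of_le (Int.natAbs_pos.mpr hS) ?_
    exact Finset.single_le_sum (f := fun S => (minor Z S).natAbs) (fun _ _ => Nat.zero_le _)
      (Finset.mem_univ S)
  have h2 : (ht Z : ℝ) ≤ ht Z' := by exact_mod_cast hmin Z' hZ'
  have h3 : (1 : ℝ) ≤ |(t : ℝ)| := by
    rw [h1] at h2
    have : (0 : ℝ) < ht Z := by exact_mod_cast hpos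
    by_contra hcon
    push Not at hcon
    nlinarith
  rw [ht', abs_mul]
  exact le_mul_of_one_le_right (abs_nonneg _) h3

omit [Fintype I] in
theorem IsIntBasis.cons {Z : Matrix I (Fin k) ℤ} (h : IsIntBasis V Z) {v : I → ℤ}
    (hv : (fun i => (v i : ℚ)) ∉ V) :
    IsIntBasis (V ⊔ Submodule.span ℚ {fun i => (v i : ℚ)})
      (Matrix.of fun i => (Fin.cons (v i) (Z i) : Fin (k + 1) → ℤ)) := by
  have hcol : (Matrix.map (Matrix.of fun i => (Fin.cons (v i) (Z i) : Fin (k + 1) → ℤ))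
      (Int.cast : ℤ → ℚ)).col = Fin.cons (fun i => (v i : ℚ)) (Z.map (Int.cast : ℤ → ℚ)).col := by
    ext j i
    refine Fin.cases ?_ (fun j => ?_) j <;> rfl
  constructor
  · rw [hcol, linearIndependent_finCons]
    exact ⟨h.1, by rwa [h.2]⟩
  · rw [hcol, Fin.range_cons, Submodule.span_insert, h.2, sup_comm]

omit [Fintype I] in
/-- The vector `∑ a_b Z_b` is nonzero when `a` is. -/
theorem IsIntBasis.mulVec_ne_zero {Z : Matrix I (Fin k) ℤ} (h : IsIntBasis V Z) {a : Fin k → ℤ}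
    (ha : a ≠ 0) : Z.mulVec a ≠ 0 := by
  intro h0
  have hli := Fintype.linearIndependent_iff.mp h.1 (fun j => (a j : ℚ)) (by
    ext i
    have := congrFun h0 i
    simp only [Matrix.mulVec, dotProduct, Pi.zero_apply] at this
    simp only [Finset.sum_apply, Pi.smul_apply, smul_eq_mul, Matrix.col_apply, Matrix.map_apply,
      Pi.zero_apply]
    have h2 : ((∑ j, Z i j * a j : ℤ) : ℚ) = 0 := by rw [this]; simp
    push_cast at h2
    rw [← h2]
    exact Finset.sum_congr rfl fun j _ => mul_comm _ _)
  exact ha (funext fun j => by exact_mod_cast hli j)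
end

/-- The generalised minors of a basis of `V` are small on `s`. -/
def SmallOn {I : Type*} [Fintype I] (P : ℝ → Matrix I I ℝ) (σ : ℝ) (s : Set ℝ)
    (V : Submodule ℚ (I → ℚ)) (ε : ℝ) : Prop :=
  ∃ Z : Matrix I (Fin (Module.finrank ℚ V)) ℤ, IsIntBasis V Z ∧ ∀ x ∈ s, ∀ S,
    |σ ^ Module.finrank ℚ V * minor (P x * Z.map (Int.cast : ℤ → ℝ)) S| ≤ ε

theorem smallOn_of_isIntBasis {I : Type*} [Fintype I] {P : ℝ → Matrix I I ℝ} {σ : ℝ} {s : Set ℝ}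
    {V : Submodule ℚ (I → ℚ)} {ε : ℝ} {k : ℕ} {Z : Matrix I (Fin k) ℤ} (hZ : IsIntBasis V Z)
    (h : ∀ x ∈ s, ∀ S, |σ ^ k * minor (P x * Z.map (Int.cast : ℤ → ℝ)) S| ≤ ε) :
    SmallOn P σ s V ε := by
  obtain rfl := hZ.finrank_eq
  exact ⟨Z, hZ, h⟩

theorem mul_of_cons_zero {I : Type*} [Fintype I] {k : ℕ} (P : Matrix I I ℝ) (v : I → ℤ)
    (Z : Matrix I (Fin k) ℤ) (i : I) :
    (P * (Matrix.of fun i => (Fin.cons (v i) (Z i) : Fin (k + 1) → ℤ)).map (Int.cast : ℤ → ℝ)) i 0 =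
      P.mulVec (fun i => (v i : ℝ)) i := by
  simp [Matrix.mul_apply, Matrix.mulVec, dotProduct]

theorem mul_of_cons_succ {I : Type*} [Fintype I] {k : ℕ} (P : Matrix I I ℝ) (v : I → ℤ)
    (Z : Matrix I (Fin k) ℤ) :
    (P * (Matrix.of fun i => (Fin.cons (v i) (Z i) : Fin (k + 1) → ℤ)).map
      (Int.cast : ℤ → ℝ)).submatrix id Fin.succ = P * Z.map (Int.cast : ℤ → ℝ) := by
  ext i j
  simp [Matrix.mul_apply]

/-- Quantitative nondivergence: the proportion of cells on which some nonzero integer vector is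
contracted by `P`. -/
theorem NTree.IsGap.contracted_count {I : Type*} [Fintype I] {T : NTree Bool} (hT : T.IsGap)
    {C c₁ : ℝ} {κ : ℕ} (hκ : 1 ≤ κ) (hC : 1 ≤ C) (hc₁ : 0 < c₁) :
    ∃ K : ℝ, 1 ≤ K ∧ ∀ (P : ℝ → Matrix I I ℝ) (σ : ℝ), 0 < σ →
      (∀ k ≤ Fintype.card I, ∀ (Z : Matrix I (Fin k) ℤ) S (a : ℝ),
        SepGood C κ (fun x => a * minor (P x * Z.map (Int.cast : ℤ → ℝ)) S) (T.cell [])) →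
      (∀ x ∈ T.cell [], ∀ k (Z : Matrix I (Fin k) ℤ), IsIntBasis ⊤ Z →
        ∃ S, c₁ ≤ |σ ^ k * minor (P x * Z.map (Int.cast : ℤ → ℝ)) S|) →
      ∀ (ρ X : ℝ) (w : List Bool) (n : ℕ), 0 < ρ → ρ ≤ 1 → 0 < X →
      (∀ V, ⊥ < V → V < ⊤ → ¬ SmallOn P σ (T.cell w) V ρ) →
      csum (ind fun u => ∃ v : I → ℤ, v ≠ 0 ∧ ∀ x ∈ T.cell u, ∀ i,
        |(P x).mulVec (fun i => (v i : ℝ)) i| ≤ X) n w ≤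
        K * (σ * X / ρ) ^ (Real.log 2 / Real.log T.q / (2 * κ)) * 2 ^ n := by
  set α := Real.log 2 / Real.log T.q / (2 * κ) with hα
  have hq := T.two_le
  have hκ' : (1 : ℝ) ≤ κ := by exact_mod_cast hκ
  have hα0 : 0 < α := by
    have h1 : 0 < Real.log 2 := Real.log_pos (by norm_num)
    have h2 : 0 < Real.log T.q := Real.log_pos (by linarith)
    positivity
  have hC' : 1 ≤ 2 * κ * C ^ α := by
    have := Real.one_le_rpow hC hα0.le
    nlinarith
  set m : ℝ := Fintype.card I + 1 with hm
  have hm0 : 1 ≤ m := by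
    have : (0 : ℝ) ≤ Fintype.card I := Nat.cast_nonneg _
    linarith
  obtain ⟨K, hK, hcount⟩ := flagProtected_count (E := I → ℚ) (2 * κ * C ^ α) α hC' hα0
    (Module.finrank ℚ (⊤ : Submodule ℚ (I → ℚ)))
  set K' := K + (1 / c₁) ^ α with hK'
  have hK'0 : K ≤ K' := by have : 0 ≤ (1 / c₁) ^ α := by positivity
                           linarith
  have hmα : 1 ≤ m ^ α := Real.one_le_rpow hm0 hα0.le
  refine ⟨K' * m ^ α, by nlinarith, ?_⟩
  intro P σ hσ hsep hbig ρ X w n hρ hρ1 hX hlow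
  have hρX : 0 ≤ m * (σ * X) := by positivity
  have hmul : K' * m ^ α * (σ * X / ρ) ^ α = K' * (m * (σ * X) / ρ) ^ α := by
    rw [mul_assoc, ← Real.mul_rpow (by positivity) (by positivity)]
    congr 2
    ring
  rw [hmul]
  set ε := m * (σ * X) with hε
  have hε0 : 0 < ε := by positivity
  by_cases hεc : c₁ ≤ ε
  · refine (csum_le_of_forall (fun u => ind_le_one _ u) n w).trans ?_
    have h1 : (1 : ℝ) ≤ (1 / c₁) ^ α * (ε / ρ) ^ α := by
      rw [← Real.mul_rpow (by positivity) (by positivity)]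
      refine Real.one_le_rpow ?_ hα0.le
      rw [div_mul_div_comm, one_mul, le_div_iff₀ (by positivity)]
      nlinarith
    have h2 : (1 : ℝ) ≤ K' * (ε / ρ) ^ α := by
      have : 0 ≤ (ε / ρ) ^ α := by positivity
      nlinarith
    rw [Fintype.card_bool]
    push_cast
    have : (0 : ℝ) < 2 ^ n := by positivity
    nlinarith
  push Not at hεc
  have hsub : ∀ u : List Bool, T.cell u ⊆ T.cell [] := fun u =>
    T.cell_subset_of_suffix (List.nil_suffix)
  set sm : Submodule ℚ (I → ℚ) → ℝ → List Bool → Prop :=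
    fun V ε w => SmallOn P σ (T.cell w) V ε with hsm
  have key := hcount sm ?_ ?_ ?_ ⊥ ⊤ ρ ε n w bot_le (by omega) hρ hρ1 hε0 hlow
  · refine (csum_ind_mono n w fun u _ _ => ?_).trans (key.trans ?_)
    · rintro ⟨v, hv, hvX⟩ hflag
      have hvq : (fun i => (v i : ℚ)) ≠ 0 := fun h => hv (funext fun i => by
        have := congrFun h i
        simpa using this)
      obtain ⟨V, -, -, hvV, hV1, hV2⟩ := hflag (fun i => (v i : ℚ)) trivial
        (by rwa [Submodule.mem_bot])
      have hZ : ∃ k, ∃ Z : Matrix I (Fin k) ℤ, IsIntBasis V Z ∧ ∀ x ∈ T.cell u, ∀ S,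
          |σ ^ k * minor (P x * Z.map (Int.cast : ℤ → ℝ)) S| ≤ 1 := by
        rcases hV1 with rfl | ⟨Z, hZ, h⟩
        · refine ⟨0, Matrix.of fun _ => Fin.elim0, ⟨linearIndependent_empty_type, ?_⟩, ?_⟩
          · rw [range_eq_empty, Submodule.span_empty]
          · intro x _ S
            simp [minor]
        · exact ⟨_, Z, hZ, h⟩
      obtain ⟨k, Z, hZ, hZ1⟩ := hZ
      have hcons := hZ.cons hvV
      have hkm : k + 1 ≤ Fintype.card I := by
        rw [← hcons.finrank_eq]
        exact (Submodule.finrank_le _).trans (by simp)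
      have hup : ∀ x ∈ T.cell u, ∀ S, |σ ^ (k + 1) * minor (P x *
          (Matrix.of fun i => (Fin.cons (v i) (Z i) : Fin (k + 1) → ℤ)).map
            (Int.cast : ℤ → ℝ)) S| ≤ ε := by
        intro x hx S
        rw [abs_mul, abs_of_pos (pow_pos hσ _)]
        have h1 := abs_minor_cons_le (P x *
          (Matrix.of fun i => (Fin.cons (v i) (Z i) : Fin (k + 1) → ℤ)).map
            (Int.cast : ℤ → ℝ)) S
        rw [mul_of_cons_succ] at h1
        simp only [mul_of_cons_zero] at h1
        refine (mul_le_mul_of_nonneg_left h1 (pow_pos hσ (k + 1)).le).trans ?_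
        calc
          _ = ∑ a : Fin (k + 1), (σ * |(P x).mulVec (fun i => (v i : ℝ)) (S a)|) *
              |σ ^ k * minor (P x * Z.map (Int.cast : ℤ → ℝ)) (S ∘ a.succAbove)| := by
            rw [Finset.mul_sum]
            refine Finset.sum_congr rfl fun a _ => ?_
            rw [abs_mul, abs_of_pos (pow_pos hσ _)]
            ring
          _ ≤ ∑ a : Fin (k + 1), σ * X := by
            refine Finset.sum_le_sum fun a _ => ?_
            have h2 := hZ1 x hx (S ∘ a.succAbove)
            have h3 := hvX x hx (S a)
            have h4 : σ * |(P x).mulVec (fun i => (v i : ℝ)) (S a)| ≤ σ * X := by gcongr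
            calc _ ≤ (σ * X) * 1 := mul_le_mul h4 h2 (abs_nonneg _) (by positivity)
              _ = _ := mul_one _
          _ = (k + 1 : ℕ) * (σ * X) := by simp
          _ ≤ ε := by
            rw [hε]
            have : ((k + 1 : ℕ) : ℝ) ≤ Fintype.card I := by exact_mod_cast hkm
            gcongr
            linarith
      rcases hV2 with htop | hns
      · rw [htop] at hcons
        obtain ⟨x, hx⟩ := T.exists_mem_lim u
        obtain ⟨S, hS⟩ := hbig x (hsub u hx.1) _ _ hcons
        linarith [hup x hx.1 S]
      · exact hns (smallOn_of_isIntBasis hcons hup)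
    · gcongr
  · rintro V ε ε' w h ⟨Z, hZ, hle⟩
    exact ⟨Z, hZ, fun x hx S => (hle x hx S).trans h⟩
  · rintro V ε b w ⟨Z, hZ, hle⟩
    exact ⟨Z, hZ, fun x hx S => hle x (T.cell_cons_subset b w hx) S⟩
  · intro V ρ ε w n hρ hε hns
    obtain ⟨Z, hZ, hmin⟩ := exists_isIntBasis_minimal V
    have hn : ¬ ∀ x ∈ T.cell w, ∀ S,
        |σ ^ Module.finrank ℚ V * minor (P x * Z.map (Int.cast : ℤ → ℝ)) S| ≤ ρ :=
      fun h => hns ⟨Z, hZ, h⟩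
    have := hT.sepGood_count hκ hC
      (fun S x => σ ^ Module.finrank ℚ V * minor (P x * Z.map (Int.cast : ℤ → ℝ)) S)
      (fun S => hsep _ ((Submodule.finrank_le _).trans (by simp)) Z S _) (hsub w) hρ hε hn n
    refine (csum_ind_mono n w fun u _ _ => ?_).trans this
    rintro ⟨Z', hZ', h⟩ x hx S
    refine le_trans ?_ (h x hx S)
    rw [abs_mul, abs_mul]
    exact mul_le_mul_of_nonneg_left (hmin Z' hZ' _ _) (abs_nonneg _)

theorem sum_le_sum_of_subset_of_nonpos {ι : Type*} {s t : Finset ι} {f : ι → ℝ} (h : s ⊆ t)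
    (hf : ∀ i ∈ t, i ∉ s → f i ≤ 0) : ∑ i ∈ t, f i ≤ ∑ i ∈ s, f i := by
  have := Finset.sum_le_sum_of_subset_of_nonneg (f := fun i => -f i) h fun i hi hs => by
    linarith [hf i hi hs]
  simp only [Finset.sum_neg_distrib] at this
  linarith

theorem exists_minor_ge {I : Type*} [Fintype I] [Nonempty I] {k : ℕ} {c : Matrix (Fin k) I ℝ}
    {Y : Matrix I (Fin k) ℝ} {b μ : ℝ} (hc : ∀ a l, |c a l| ≤ b) (hμ : 0 < μ)
    (h : μ ≤ |(c * Y).det|) :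
    ∃ T : Fin k → I, (∀ a, c a (T a) ≠ 0) ∧ μ ≤ (Fintype.card I * b) ^ k * |minor Y T| := by
  have hm : (0 : ℝ) < (Fintype.card I : ℝ) ^ k := by
    have : (0 : ℝ) < Fintype.card I := by exact_mod_cast Fintype.card_pos
    positivity
  rw [det_mul_eq_sum_minor] at h
  have h1 : ∑ _T : Fin k → I, μ / (Fintype.card I : ℝ) ^ k ≤
      ∑ T : Fin k → I, |(∏ a, c a (T a)) * minor Y T| := by
    refine le_trans (le_of_eq ?_) (h.trans (Finset.abs_sum_le_sum_abs _ _))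
    rw [Finset.sum_const, Finset.card_univ, nsmul_eq_mul, Fintype.card_fun, Fintype.card_fin]
    push_cast
    field_simp
  obtain ⟨T, -, hT⟩ := Finset.exists_le_of_sum_le Finset.univ_nonempty h1
  have hpos : 0 < |(∏ a, c a (T a)) * minor Y T| := lt_of_lt_of_le (by positivity) hT
  refine ⟨T, fun a h0 => ?_, ?_⟩
  · rw [Finset.prod_eq_zero (Finset.mem_univ a) h0] at hpos
    simp at hpos
  · rw [abs_mul, Finset.abs_prod] at hT
    rw [div_le_iff₀ hm] at hT
    refine hT.trans ?_
    have h2 : ∏ a, |c a (T a)| ≤ b ^ k := by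
      calc _ ≤ ∏ _a : Fin k, b := Finset.prod_le_prod (fun _ _ => abs_nonneg _) fun a _ => hc a _
        _ = b ^ k := by simp
    rw [mul_pow]
    have h3 := mul_le_mul_of_nonneg_right h2 (mul_nonneg (abs_nonneg (minor Y T)) hm.le)
    nlinarith

/-- A curve `g` in normal form on `s`, with its first two derivatives, a weight and uniform
bounds; `o` is the index of the constant coordinate and `e` that of the heaviest one. -/
structure CurveData (I : Type*) [Fintype I] [DecidableEq I] (s : Set ℝ) where
  o : I
  e : I
  hoe : o ≠ e
  ω : I → ℝ
  ω_o : ω o = 1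
  ω_sum : ∑ i, ω i = 0
  r₀ : ℝ
  r₀_pos : 0 < r₀
  ω_le : ∀ i, i ≠ o → ω i ≤ -r₀
  ω_e : ∀ i, ω e ≤ ω i
  g : I → ℝ → ℝ
  g1 : I → ℝ → ℝ
  g2 : I → ℝ → ℝ
  hg : ∀ i, ∀ x ∈ s, HasDerivAt (g i) (g1 i x) x
  hg1 : ∀ i, ∀ x ∈ s, HasDerivAt (g1 i) (g2 i x) x
  g_o : ∀ x ∈ s, g o x = 1
  g1_o : ∀ x ∈ s, g1 o x = 0
  g2_o : ∀ x ∈ s, g2 o x = 0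
  B : ℝ
  one_le_B : 1 ≤ B
  g_le : ∀ i, ∀ x ∈ s, |g i x| ≤ B
  g1_le : ∀ i, ∀ x ∈ s, |g1 i x| ≤ B
  g2_le : ∀ i, ∀ x ∈ s, |g2 i x| ≤ B
  le_g1 : ∀ x ∈ s, 1 ≤ B * |g1 e x|
  c₃ : ℝ
  c₃_pos : 0 < c₃
  nondeg : ∀ c : I → ℤ, c ≠ 0 → ∃ x ∈ s, c₃ ≤ |∑ i, (c i : ℝ) * g i x|

namespace CurveData
variable {I : Type*} [Fintype I] [DecidableEq I] {s : Set ℝ} (D : CurveData I s)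

/-- The frame along the curve. -/
def M (x : ℝ) : Matrix I I ℝ :=
  Matrix.of fun i l => if i = D.o then D.g l x else if i = D.e then D.g1 l x else if i = l then 1 else 0

/-- The exponents of the flow. -/
noncomputable def d (t lam : ℝ) (i : I) : ℝ := Real.exp (t * D.ω i + lam * if i = D.e then 1 else 0)

/-- The frame moved by the flow. -/
noncomputable def P (t lam x : ℝ) : Matrix I I ℝ := Matrix.of fun i l => D.d t lam i * D.M x i l

theorem M_o (x : ℝ) : D.M x D.o = fun l => D.g l x := by ext l; simp [M]

theorem M_e (x : ℝ) : D.M x D.e = fun l => D.g1 l x := by ext l; simp [M, D.hoe.symm]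

theorem M_of_ne (x : ℝ) {i : I} (ho : i ≠ D.o) (he : i ≠ D.e) : D.M x i = Pi.single i 1 := by
  ext l
  simp [M, ho, he, Pi.single_apply, eq_comm]

theorem card_pos (_D : CurveData I s) : (1 : ℝ) ≤ Fintype.card I := by
  have : Nonempty I := ⟨_D.o⟩
  exact_mod_cast Fintype.card_pos

theorem ω_e_le : D.ω D.e ≤ -D.r₀ := D.ω_le _ D.hoe.symm

theorem neg_one_le_ω_e : -1 ≤ D.ω D.e := by
  have h1 := D.ω_sum
  rw [← Finset.add_sum_erase _ _ (Finset.mem_univ D.o), D.ω_o] at h1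
  have h2 : D.e ∈ Finset.univ.erase D.o := by simp [D.hoe.symm]
  rw [← Finset.add_sum_erase _ _ h2] at h1
  have h3 : ∑ i ∈ (Finset.univ.erase D.o).erase D.e, D.ω i ≤ 0 :=
    Finset.sum_nonpos fun i hi => by
      have := D.ω_le i (by simp at hi; exact hi.2)
      linarith [D.r₀_pos]
  linarith

/-- Vectors orthogonal to the constant coordinate are combinations of the rows of the frame
other than the curve itself. -/
theorem exists_coeff {x : ℝ} (hx : x ∈ s) {u : I → ℝ} (hu : u D.o = 0) (hB : ∀ i, |u i| ≤ D.B) :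
    ∃ κ : I → ℝ, κ D.o = 0 ∧ (∀ i, |κ i| ≤ 2 * D.B ^ 3) ∧ ∀ l, u l = ∑ i, κ i * D.M x i l := by
  have hB1 := D.one_le_B
  have hge : 0 < |D.g1 D.e x| := by
    by_contra h
    have := D.le_g1 x hx
    nlinarith [abs_nonneg (D.g1 D.e x)]
  have hge0 := abs_pos.mp hge
  have hq : |u D.e / D.g1 D.e x| ≤ D.B ^ 2 := by
    rw [abs_div, div_le_iff₀ hge]
    have h1 := D.le_g1 x hx
    have h2 := hB D.e
    nlinarith
  set c := u D.e / D.g1 D.e x with hc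
  refine ⟨fun i => if i = D.o then 0 else if i = D.e then c else u i - c * D.g1 i x, by simp,
    fun i => ?_, fun l => ?_⟩
  · have h3 : D.B ^ 2 ≤ D.B ^ 3 := pow_le_pow_right₀ hB1 (by norm_num)
    have h4 : D.B ≤ D.B ^ 3 := by simpa using pow_le_pow_right₀ hB1 (show 1 ≤ 3 by norm_num)
    have h5 : 0 < D.B ^ 3 := by positivity
    dsimp only
    split_ifs
    · simp; positivity
    · linarith
    · refine (abs_sub _ _).trans ?_
      rw [abs_mul]
      have h6 : |c| * |D.g1 i x| ≤ D.B ^ 2 * D.B :=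
        mul_le_mul hq (D.g1_le i x hx) (abs_nonneg _) (by positivity)
      have := hB i
      nlinarith
  · have : ∀ i, (if i = D.o then 0 else if i = D.e then c else u i - c * D.g1 i x) * D.M x i l =
        (if i = D.e then c * D.g1 l x else 0) +
          (if i = l then (if l = D.o ∨ l = D.e then 0 else u l - c * D.g1 l x) else 0) := by
      intro i
      have hoe := D.hoe
      by_cases h1 : i = D.o
      · subst h1
        by_cases h2 : D.o = l
        · subst h2; simp [hoe]
        · simp [hoe, h2]
      · by_cases h2 : i = D.e
        · subst h2
          rw [D.M_e]
          by_cases h3 : D.e = l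
          · subst h3; simp [hoe.symm]
          · simp [h1, h3]
        · rw [D.M_of_ne x h1 h2]
          by_cases h3 : i = l
          · subst h3; simp [h1, h2]
          · simp [h1, h2, h3, Ne.symm h3]
    rw [Finset.sum_congr rfl fun i _ => this i, Finset.sum_add_distrib, Finset.sum_ite_eq',
      Finset.sum_ite_eq']
    simp only [Finset.mem_univ, if_true]
    by_cases h1 : l = D.o
    · subst h1; simp [hu, D.g1_o x hx]
    · by_cases h2 : l = D.e
      · subst h2; simp [hc]; field_simp
      · simp [h1, h2]

theorem exists_row_coeff {x : ℝ} (hx : x ∈ s) (i : I) :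
    ∃ c : I → ℝ, (∀ l, |c l| ≤ 3 * D.B ^ 3) ∧
      ∀ j, (Pi.single i 1 : I → ℝ) j = ∑ l, c l * D.M x l j := by
  have hB3 : 1 ≤ D.B ^ 3 := one_le_pow₀ D.one_le_B
  by_cases hi : i = D.o
  · subst hi
    obtain ⟨κ, -, hκ, hκs⟩ := D.exists_coeff hx (u := fun l => if l = D.o then 0 else D.g l x)
      (by simp) (fun l => by
        split_ifs
        · simpa using zero_le_one.trans D.one_le_B
        · exact D.g_le l x hx)
    refine ⟨fun l => (if l = D.o then 1 else 0) - κ l, fun l => ?_, fun j => ?_⟩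
    · refine (abs_sub _ _).trans ?_
      have : |(if l = D.o then 1 else 0 : ℝ)| ≤ 1 := by split_ifs <;> simp
      linarith [hκ l]
    · simp only [sub_mul, Finset.sum_sub_distrib, ← hκs, ite_mul, one_mul, zero_mul,
        Finset.sum_ite_eq', Finset.mem_univ, if_true, D.M_o, Pi.single_apply]
      by_cases hj : j = D.o
      · subst hj; simp [D.g_o x hx]
      · simp [hj]
  · obtain ⟨κ, -, hκ, hκs⟩ := D.exists_coeff hx (u := Pi.single i 1)
      (by simp [Ne.symm hi]) (fun l => by
        have := D.one_le_B
        rw [Pi.single_apply]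
        split_ifs <;> simp <;> linarith)
    exact ⟨κ, fun l => (hκ l).trans (by linarith), hκs⟩

/-- The weight of a row set. -/
def wt {k : ℕ} (S : Fin k → I) : ℝ := ∑ a, D.ω (S a)

/-- The multiplicity of the index `e` in a row set. -/
def cnt {k : ℕ} (S : Fin k → I) : ℝ := ∑ a, if S a = D.e then 1 else 0

theorem minor_P {k : ℕ} (t lam x : ℝ) (Z : Matrix I (Fin k) ℝ) (S : Fin k → I) :
    minor (D.P t lam x * Z) S =
      Real.exp (t * D.wt S + lam * D.cnt S) * minor (D.M x * Z) S := by
  have h : D.P t lam x * Z = Matrix.of fun i b => D.d t lam i * (D.M x * Z) i b := by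
    ext i b
    simp [P, Matrix.mul_apply, Finset.mul_sum, mul_assoc]
  rw [h, minor_scale]
  congr 1
  simp only [d]
  rw [← Real.exp_sum, Finset.sum_add_distrib, wt, cnt, Finset.mul_sum, Finset.mul_sum]

theorem wt_eq {k : ℕ} {S : Fin k → I} (hS : Function.Injective S) :
    D.wt S = ∑ i ∈ Finset.univ.image S, D.ω i := by
  rw [wt, Finset.sum_image fun a _ b _ h => hS h]

theorem wt_eq_neg {k : ℕ} {S : Fin k → I} (hS : Function.Injective S) :
    D.wt S = ∑ i ∈ (Finset.univ.image S)ᶜ, -D.ω i := by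
  rw [D.wt_eq hS, Finset.sum_neg_distrib]
  have := Finset.sum_add_sum_compl (Finset.univ.image S) D.ω
  rw [D.ω_sum] at this
  linarith

theorem cnt_of_mem {k : ℕ} {S : Fin k → I} (hS : Function.Injective S) {a : Fin k}
    (h : S a = D.e) : D.cnt S = 1 := by
  rw [cnt, Finset.sum_eq_single a]
  · simp [h]
  · intro b _ hb
    rw [if_neg fun hb' => hb (hS (hb'.trans h.symm))]
  · simp

theorem cnt_of_not_mem {k : ℕ} {S : Fin k → I} (h : ∀ a, S a ≠ D.e) : D.cnt S = 0 :=
  Finset.sum_eq_zero fun a _ => if_neg (h a)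

theorem cnt_nonneg {k : ℕ} (S : Fin k → I) : 0 ≤ D.cnt S :=
  Finset.sum_nonneg fun a _ => by split_ifs <;> norm_num

theorem neg_ω_nonneg {i : I} (h : i ≠ D.o) : 0 ≤ -D.ω i := by
  linarith [D.ω_le i h, D.r₀_pos]

theorem r₀_le_wt {k : ℕ} {S : Fin k → I} (hS : Function.Injective S) (hk : k < Fintype.card I)
    {a : Fin k} (ha : S a = D.o) : D.r₀ ≤ D.wt S := by
  have hmem : D.o ∈ Finset.univ.image S := Finset.mem_image.mpr ⟨a, Finset.mem_univ _, ha⟩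
  have hne : ((Finset.univ.image S)ᶜ).Nonempty := by
    rw [← Finset.card_pos, Finset.card_compl, Finset.card_image_of_injective _ hS]
    simp; omega
  obtain ⟨i, hi⟩ := hne
  have hio : ∀ j ∈ (Finset.univ.image S)ᶜ, j ≠ D.o := fun j hj h => by
    subst h; exact (Finset.mem_compl.mp hj) hmem
  rw [D.wt_eq_neg hS]
  have := Finset.single_le_sum (f := fun i => -D.ω i) (fun j hj => D.neg_ω_nonneg (hio j hj)) hi
  linarith [D.ω_le i (hio i hi)]

theorem neg_ω_e_le_wt {k : ℕ} {S : Fin k → I} (hS : Function.Injective S)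
    {a : Fin k} (ha : S a = D.o) (he : ∀ a, S a ≠ D.e) : -D.ω D.e ≤ D.wt S := by
  have hmem : D.o ∈ Finset.univ.image S := Finset.mem_image.mpr ⟨a, Finset.mem_univ _, ha⟩
  have hi : D.e ∈ (Finset.univ.image S)ᶜ := by simp [he]
  have hio : ∀ j ∈ (Finset.univ.image S)ᶜ, j ≠ D.o := fun j hj h => by
    subst h; exact (Finset.mem_compl.mp hj) hmem
  rw [D.wt_eq_neg hS]
  exact Finset.single_le_sum (f := fun i => -D.ω i) (fun j hj => D.neg_ω_nonneg (hio j hj)) hi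

theorem neg_one_le_wt {k : ℕ} {S : Fin k → I} (hS : Function.Injective S)
    (ho : ∀ a, S a ≠ D.o) : -1 ≤ D.wt S := by
  rw [D.wt_eq hS]
  have h1 : ∑ i ∈ Finset.univ.erase D.o, D.ω i = -1 := by
    have := Finset.add_sum_erase Finset.univ D.ω (Finset.mem_univ D.o)
    rw [D.ω_sum, D.ω_o] at this
    linarith
  rw [← h1]
  refine sum_le_sum_of_subset_of_nonpos ?_ ?_
  · intro i hi
    obtain ⟨a, -, rfl⟩ := Finset.mem_image.mp hi
    simp [ho a]
  · intro i hi _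
    have := D.neg_ω_nonneg (Finset.ne_of_mem_erase hi)
    linarith

theorem neg_one_sub_le_wt {k : ℕ} {S : Fin k → I} (hS : Function.Injective S)
    (ho : ∀ a, S a ≠ D.o) (he : ∀ a, S a ≠ D.e) : -1 - D.ω D.e ≤ D.wt S := by
  rw [D.wt_eq hS]
  have h1 : ∑ i ∈ (Finset.univ.erase D.o).erase D.e, D.ω i = -1 - D.ω D.e := by
    have := Finset.add_sum_erase Finset.univ D.ω (Finset.mem_univ D.o)
    have h2 := Finset.add_sum_erase (Finset.univ.erase D.o) D.ω
      (Finset.mem_erase.mpr ⟨D.hoe.symm, Finset.mem_univ D.e⟩)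
    rw [D.ω_sum, D.ω_o] at this
    linarith
  rw [← h1]
  refine sum_le_sum_of_subset_of_nonpos ?_ ?_
  · intro i hi
    obtain ⟨a, -, rfl⟩ := Finset.mem_image.mp hi
    simp [ho a, he a]
  · intro i hi _
    have := D.neg_ω_nonneg (Finset.ne_of_mem_erase (Finset.mem_of_mem_erase hi))
    linarith
theorem linear_eq_sum (L : (I → ℝ) →ₗ[ℝ] ℝ) (v : I → ℝ) : L v = ∑ i, v i * L (Pi.single i 1) := by
  conv_lhs => rw [pi_eq_sum_univ' v]
  simp [map_sum]

theorem hasDerivAt_linear {f f' : I → ℝ → ℝ} {x : ℝ} (L : (I → ℝ) →ₗ[ℝ] ℝ)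
    (h : ∀ i, HasDerivAt (f i) (f' i x) x) :
    HasDerivAt (fun y => L fun l => f l y) (L fun l => f' l x) x := by
  have : (fun y => L fun l => f l y) = fun y => ∑ i, f i y * L (Pi.single i 1) := by
    ext y; rw [linear_eq_sum]
  rw [this, linear_eq_sum]
  exact HasDerivAt.fun_sum fun i _ => (h i).mul_const _

/-- If every row of the frame at `x` other than the curve has small image under `L`, so has every
bounded vector orthogonal to the constant coordinate. -/
theorem abs_linear_le {x δ : ℝ} (hx : x ∈ s) {L : (I → ℝ) →ₗ[ℝ] ℝ}
    (hL : ∀ i, i ≠ D.o → |L (D.M x i)| ≤ δ) {u : I → ℝ} (hu : u D.o = 0)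
    (hB : ∀ i, |u i| ≤ D.B) : |L u| ≤ 2 * D.B ^ 3 * Fintype.card I * δ := by
  have hB1 := D.one_le_B
  obtain ⟨κ, hκo, hκ, hu⟩ := D.exists_coeff hx hu hB
  have h1 : L u = ∑ i, κ i * L (D.M x i) := by
    have : u = ∑ i, κ i • D.M x i := by
      ext l; simp [hu l, Finset.sum_apply]
    rw [this, map_sum]; simp
  rw [h1]
  refine (Finset.abs_sum_le_sum_abs _ _).trans ?_
  have hδ : 0 ≤ δ := (abs_nonneg _).trans (hL D.e D.hoe.symm)
  calc _ ≤ ∑ _i : I, 2 * D.B ^ 3 * δ := by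
        refine Finset.sum_le_sum fun i _ => ?_
        rw [abs_mul]
        by_cases hi : i = D.o
        · rw [hi, hκo]; simp; positivity
        · exact mul_le_mul (hκ i) (hL i hi) (abs_nonneg _) (by positivity)
    _ = _ := by simp; ring

theorem linear_deriv_bound {L : (I → ℝ) →ₗ[ℝ] ℝ} {a b β δ x : ℝ} (hab : a < b) (hs : Icc a b ⊆ s)
    (ho : ∀ y ∈ Icc a b, |L (D.M y D.o)| ≤ β)
    (hL : ∀ y ∈ Icc a b, ∀ i, i ≠ D.o → |L (D.M y i)| ≤ δ) (hx : x ∈ Icc a b) :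
    |L (D.M x D.e)| ≤ 2 * β / (b - a) + 2 * D.B ^ 3 * Fintype.card I * δ * (b - a) := by
  simp only [M_o] at ho
  have hF : ∀ y ∈ Icc a b, HasDerivAt (fun y => L fun l => D.g l y) (L fun l => D.g1 l y) y :=
    fun y hy => hasDerivAt_linear L fun i => D.hg i y (hs hy)
  have hF1 : ∀ y ∈ Icc a b, HasDerivAt (fun y => L fun l => D.g1 l y) (L fun l => D.g2 l y) y :=
    fun y hy => hasDerivAt_linear L fun i => D.hg1 i y (hs hy)
  obtain ⟨ξ, hξ, hξe⟩ := exists_hasDerivAt_eq_slope _ _ hab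
    (fun y hy => (hF y hy).continuousAt.continuousWithinAt)
    fun y hy => hF y (Ioo_subset_Icc_self hy)
  have h1 : |L fun l => D.g1 l ξ| ≤ 2 * β / (b - a) := by
    rw [hξe, abs_div, abs_of_pos (sub_pos.mpr hab)]
    gcongr
    refine (abs_sub _ _).trans ?_
    linarith [ho b (right_mem_Icc.mpr hab.le), ho a (left_mem_Icc.mpr hab.le)]
  have h2 := Convex.norm_image_sub_le_of_norm_hasDerivWithin_le (s := Icc a b)
    (f := fun y => L fun l => D.g1 l y) (C := 2 * D.B ^ 3 * Fintype.card I * δ)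
    (fun y hy => (hF1 y hy).hasDerivWithinAt)
    (fun y hy => D.abs_linear_le (hs hy) (hL y hy) (D.g2_o y (hs hy))
      fun i => D.g2_le i y (hs hy)) (convex_Icc a b) (Ioo_subset_Icc_self hξ) hx
  have hC : 0 ≤ 2 * D.B ^ 3 * Fintype.card I * δ :=
    (abs_nonneg _).trans (D.abs_linear_le (hs hx) (hL x hx) (D.g2_o x (hs hx))
      fun i => D.g2_le i x (hs hx))
  simp only [Real.norm_eq_abs] at h2
  have h3 : |x - ξ| ≤ b - a := by
    rw [abs_le]; constructor <;> linarith [hx.1, hx.2, hξ.1, hξ.2]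
  rw [D.M_e]
  have h4 := mul_le_mul_of_nonneg_left h3 hC
  have h5 := abs_sub_abs_le_abs_sub (L fun l => D.g1 l x) (L fun l => D.g1 l ξ)
  linarith

theorem P_mulVec (t lam x : ℝ) (v : I → ℝ) (i : I) :
    (D.P t lam x).mulVec v i = D.d t lam i * ∑ l, D.M x i l * v l := by
  simp [P, Matrix.mulVec, dotProduct, Finset.mul_sum, mul_assoc]

theorem P_mulVec_stable (hconv : Convex ℝ s) {x y t lam ℓ N : ℝ} {v : I → ℝ} (hx : x ∈ s)
    (hy : y ∈ s) (ht : lam ≤ t) (hlam : 0 ≤ lam) (hℓ : 0 ≤ ℓ) (hℓ1 : ℓ ≤ 1)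
    (hℓB : ℓ * (2 * D.B ^ 3 * Fintype.card I) ≤ 1)
    (hxy : |y - x| ≤ ℓ * Real.exp (t * (D.ω D.e - 1)))
    (hN : ∀ i, |(D.P t lam x).mulVec v i| ≤ N) : ∀ i, |(D.P t lam y).mulVec v i| ≤ 3 * N := by
  have hN0 : 0 ≤ N := (abs_nonneg _).trans (hN D.o)
  let L : (I → ℝ) →ₗ[ℝ] ℝ :=
    { toFun := fun u => ∑ l, u l * v l
      map_add' := fun u w => by simp [add_mul, Finset.sum_add_distrib]
      map_smul' := fun c u => by simp [Finset.mul_sum, mul_assoc] }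
  have hP : ∀ z i, (D.P t lam z).mulVec v i = D.d t lam i * L (D.M z i) := fun z i => D.P_mulVec ..
  have hd : ∀ i, 0 < D.d t lam i := fun i => Real.exp_pos _
  simp only [hP, abs_mul, abs_of_pos (hd _)] at hN ⊢
  have hK : 0 ≤ 2 * D.B ^ 3 * Fintype.card I := by have := D.one_le_B; positivity
  set K := 2 * D.B ^ 3 * (Fintype.card I : ℝ) with hKdef
  set E := Real.exp (-(t * D.ω D.e)) with hE
  have hrow : ∀ i, i ≠ D.o → |L (D.M x i)| ≤ N * E := fun i hi => by
    have h1 : E⁻¹ ≤ D.d t lam i := by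
      rw [hE, ← Real.exp_neg, d]
      refine Real.exp_le_exp.mpr ?_
      have h2 : 0 ≤ lam * (if i = D.e then 1 else 0 : ℝ) :=
        mul_nonneg hlam (by split_ifs <;> norm_num)
      have := mul_le_mul_of_nonneg_left (D.ω_e i) (hlam.trans ht)
      linarith
    have h2 := (mul_le_mul_of_nonneg_right h1 (abs_nonneg (L (D.M x i)))).trans (hN i)
    rwa [inv_mul_le_iff₀ (Real.exp_pos _), mul_comm] at h2
  have hseg : segment ℝ x y ⊆ s := hconv.segment_subset hx hy
  have hconv' : Convex ℝ (segment ℝ x y) := convex_segment x y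
  have hsegd : ∀ z ∈ segment ℝ x y, |z - x| ≤ |y - x| := fun z hz => by
    rw [segment_eq_uIcc] at hz
    exact Set.abs_sub_left_of_mem_uIcc hz
  have hG1 : ∀ z ∈ segment ℝ x y, |L fun l => D.g1 l z| ≤
      |L fun l => D.g1 l x| + K * (N * E) * |y - x| := fun z hz => by
    have h2 := Convex.norm_image_sub_le_of_norm_hasDerivWithin_le (s := segment ℝ x y)
      (f := fun y => L fun l => D.g1 l y) (C := K * (N * E))
      (fun y hy => (hasDerivAt_linear L fun i => D.hg1 i y (hseg hy)).hasDerivWithinAt)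
      (fun y hy => D.abs_linear_le hx hrow (D.g2_o y (hseg hy))
        fun i => D.g2_le i y (hseg hy)) hconv' (left_mem_segment ℝ x y) hz
    simp only [Real.norm_eq_abs] at h2
    have h3 := mul_le_mul_of_nonneg_left (hsegd z hz) (show 0 ≤ K * (N * E) by positivity)
    have h5 := abs_sub_abs_le_abs_sub (L fun l => D.g1 l z) (L fun l => D.g1 l x)
    linarith
  have hNe := hN D.e
  rw [D.M_e] at hNe
  have hNo := hN D.o
  rw [D.M_o] at hNo
  have hde : D.d t lam D.e = Real.exp lam * E⁻¹ := by
    rw [hE, ← Real.exp_neg, ← Real.exp_add, d]; simp; ring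
  have hdo : D.d t lam D.o = Real.exp t := by
    rw [d]; simp [D.hoe, D.ω_o]
  have hE0 : 0 < E := Real.exp_pos _
  have hxy' : |y - x| ≤ ℓ * (E⁻¹ * (Real.exp t)⁻¹) := by
    rw [hE, ← Real.exp_neg, ← Real.exp_neg, ← Real.exp_add]
    convert hxy using 3; ring
  have hlt : Real.exp lam ≤ Real.exp t := Real.exp_le_exp.mpr ht
  have hE1 : E⁻¹ ≤ 1 := by
    rw [hE, ← Real.exp_neg]
    refine Real.exp_le_one_iff.mpr ?_
    nlinarith [D.ω_e_le, D.r₀_pos]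
  have ht0 : 0 < Real.exp t := Real.exp_pos _
  have hone : 1 ≤ Real.exp lam := Real.one_le_exp hlam
  have hG1' : ∀ z ∈ segment ℝ x y, D.d t lam D.e * |L fun l => D.g1 l z| ≤ 2 * N := fun z hz => by
    have h1 := mul_le_mul_of_nonneg_left (hG1 z hz) (hd D.e).le
    have h2 : D.d t lam D.e * (K * (N * E) * |y - x|) ≤ N := by
      calc _ ≤ D.d t lam D.e * (K * (N * E) * (ℓ * (E⁻¹ * (Real.exp t)⁻¹))) :=
          mul_le_mul_of_nonneg_left (mul_le_mul_of_nonneg_left hxy' (by positivity)) (hd _).le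
        _ = (ℓ * K) * N * E⁻¹ * (Real.exp lam / Real.exp t) := by rw [hde]; field_simp
        _ ≤ 1 * N * 1 * 1 := by
          gcongr
          exact (div_le_one ht0).mpr hlt
        _ = N := by ring
    linarith
  intro i
  by_cases hio : i = D.o
  · subst hio
    rw [D.M_o]
    have h2 := Convex.norm_image_sub_le_of_norm_hasDerivWithin_le (s := segment ℝ x y)
      (f := fun y => L fun l => D.g l y) (C := 2 * N / D.d t lam D.e)
      (fun y hy => (hasDerivAt_linear L fun i => D.hg i y (hseg hy)).hasDerivWithinAt)
      (fun y hy => by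
        rw [Real.norm_eq_abs, le_div_iff₀ (hd _), mul_comm]; exact hG1' y hy) hconv'
      (left_mem_segment ℝ x y) (right_mem_segment ℝ x y)
    simp only [Real.norm_eq_abs] at h2
    have h5 := abs_sub_abs_le_abs_sub (L fun l => D.g l y) (L fun l => D.g l x)
    have h6 : D.d t lam D.o * (2 * N / D.d t lam D.e * |y - x|) ≤ 2 * N := by
      calc _ ≤ D.d t lam D.o * (2 * N / D.d t lam D.e * (ℓ * (E⁻¹ * (Real.exp t)⁻¹))) := by
            gcongr
            · exact (hd _).le
            · exact div_nonneg (by linarith) (hd _).le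
        _ = 2 * N * ℓ / Real.exp lam := by rw [hde, hdo]; field_simp
        _ ≤ 2 * N * 1 / 1 := by gcongr
        _ = 2 * N := by ring
    have h7 := mul_le_mul_of_nonneg_left (show |L fun l => D.g l y| ≤ |L fun l => D.g l x| +
      2 * N / D.d t lam D.e * |y - x| by linarith) (hd D.o).le
    linarith
  · by_cases hie : i = D.e
    · subst hie
      rw [D.M_e]
      linarith [hG1' y (right_mem_segment ℝ x y)]
    · have := hN i
      rw [D.M_of_ne _ hio hie] at this ⊢
      linarith
/-- The linear form extending a minor of `Y` with a free row. -/
noncomputable def rowForm {k : ℕ} (A : Matrix (Fin k) (Fin k) ℝ) (Z : Matrix I (Fin k) ℝ)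
    (a : Fin k) : (I → ℝ) →ₗ[ℝ] ℝ where
  toFun v := (A.updateRow a fun b => ∑ l, v l * Z l b).det
  map_add' v w := by
    rw [← Matrix.det_updateRow_add]
    congr 2; ext b; simp [add_mul, Finset.sum_add_distrib]
  map_smul' c v := by
    rw [RingHom.id_apply, smul_eq_mul, ← Matrix.det_updateRow_smul]
    congr 2; ext b; simp [Finset.mul_sum, mul_assoc]

theorem wt_update {k : ℕ} (S : Fin k → I) (a : Fin k) (i : I) :
    D.wt (Function.update S a i) = D.wt S - D.ω (S a) + D.ω i := by
  rw [wt, wt, ← Finset.add_sum_erase _ _ (Finset.mem_univ a),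
    ← Finset.add_sum_erase Finset.univ (fun b => D.ω (S b)) (Finset.mem_univ a)]
  rw [Finset.sum_congr rfl fun b hb => by
    rw [Function.update_of_ne (Finset.ne_of_mem_erase hb)]]
  simp; ring

theorem rowForm_eq {k : ℕ} {S : Fin k → I} (hS : Function.Injective S) {a : Fin k}
    (ha : S a = D.e) (ho : ∀ b, S b ≠ D.o) (Z : Matrix I (Fin k) ℝ) (x y : ℝ) (i : I) :
    rowForm ((D.M x * Z).submatrix S id) Z a (D.M y i) =
      minor (D.M y * Z) (Function.update S a i) := by
  change Matrix.det _ = Matrix.det _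
  congr 1
  ext b c
  by_cases hb : b = a
  · subst hb; simp [Matrix.mul_apply]
  · have h1 : S b ≠ D.e := fun h => hb (hS (h.trans ha.symm))
    simp [hb, Matrix.mul_apply, D.M_of_ne _ (ho b) h1]

/-- A minor through the derivative row is much smaller than the trivial bound, because the
corresponding minors through the curve are small on a long interval. -/
theorem abs_minor_e_le {k : ℕ} {Z : Matrix I (Fin k) ℝ} {a b t T lam ρ ℓ x : ℝ}
    (hab : b - a = ℓ * Real.exp ((D.ω D.e - 1) * (t - T))) (hℓ : 0 < ℓ) (hs : Icc a b ⊆ s)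
    (hT : 0 ≤ T) (hTt : T ≤ t / 2) (hlam : 0 ≤ lam) (hρ : 0 ≤ ρ)
    (h1 : ∀ y ∈ Icc a b, ∀ S, |minor (D.P t lam y * Z) S| ≤ ρ) (hx : x ∈ Icc a b)
    {S : Fin k → I} (hS : Function.Injective S) {a₀ : Fin k} (ha : S a₀ = D.e)
    (ho : ∀ b, S b ≠ D.o) :
    Real.exp (t * D.wt S) * |minor (D.M x * Z) S| ≤
      (2 / ℓ + 2 * D.B ^ 3 * Fintype.card I * ℓ) * ρ * Real.exp ((D.ω D.e - 1) * T) := by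
  have hB := D.one_le_B
  have hωe : D.ω D.e < 0 := by linarith [D.ω_e_le, D.r₀_pos]
  have hrow : ∀ y ∈ Icc a b, ∀ i,
      |rowForm ((D.M x * Z).submatrix S id) Z a₀ (D.M y i)| ≤
        ρ * Real.exp (-(t * (D.wt S - D.ω D.e + D.ω i))) := fun y hy i => by
    rw [D.rowForm_eq hS ha ho]
    have h2 := h1 y hy (Function.update S a₀ i)
    rw [minor_P, abs_mul, abs_of_pos (Real.exp_pos _), wt_update, ha] at h2
    rw [Real.exp_neg, ← div_eq_mul_inv, le_div_iff₀ (Real.exp_pos _), mul_comm]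
    refine le_trans ?_ h2
    gcongr
    have := mul_nonneg hlam (D.cnt_nonneg (Function.update S a₀ i))
    linarith
  have hlt : a < b := by
    have : 0 < b - a := by rw [hab]; positivity
    linarith
  have key := D.linear_deriv_bound (L := rowForm ((D.M x * Z).submatrix S id) Z a₀)
    (β := ρ * Real.exp (-(t * (D.wt S - D.ω D.e + 1)))) (δ := ρ * Real.exp (-(t * D.wt S)))
    hlt hs (fun y hy => by have := hrow y hy D.o; rwa [D.ω_o] at this)
    (fun y hy i _ => (hrow y hy i).trans (by
      have ht : 0 ≤ t := by linarith
      have := D.ω_e i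
      gcongr
      linarith)) hx
  rw [D.rowForm_eq hS ha ho, ← ha, Function.update_eq_self, ha, hab] at key
  have h3 := mul_le_mul_of_nonneg_left key (Real.exp_pos (t * D.wt S)).le
  refine h3.trans ?_
  set K := 2 * D.B ^ 3 * (Fintype.card I : ℝ)
  have hK : 0 ≤ K := by positivity
  have e1 : Real.exp (t * D.wt S) * (2 * (ρ * Real.exp (-(t * (D.wt S - D.ω D.e + 1)))) /
      (ℓ * Real.exp ((D.ω D.e - 1) * (t - T)))) = 2 / ℓ * ρ * Real.exp ((D.ω D.e - 1) * T) := by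
    have : Real.exp (t * D.wt S) * Real.exp (-(t * (D.wt S - D.ω D.e + 1))) =
        Real.exp ((D.ω D.e - 1) * T) * Real.exp ((D.ω D.e - 1) * (t - T)) := by
      rw [← Real.exp_add, ← Real.exp_add]; ring_nf
    rw [show ∀ A B C D : ℝ, A * (2 * (ρ * B) / (C * D)) = 2 * ρ * (A * B) / (C * D) by
      intros; ring, this]
    field_simp
  have e2 : Real.exp (t * D.wt S) * (K * (ρ * Real.exp (-(t * D.wt S))) *
      (ℓ * Real.exp ((D.ω D.e - 1) * (t - T)))) = K * ℓ * ρ * Real.exp ((D.ω D.e - 1) * (t - T)) := by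
    rw [Real.exp_neg]
    field_simp
  rw [mul_add, e1, e2, add_mul, add_mul]
  refine add_le_add le_rfl (mul_le_mul_of_nonneg_left (Real.exp_le_exp.mpr ?_) (by positivity))
  nlinarith

set_option maxHeartbeats 1000000 in
theorem abs_minor_le_of_window {k : ℕ} [NeZero k] (hk : k < Fintype.card I)
    {Z : Matrix I (Fin k) ℝ} {a b t T lam₀ lam lam' ρ ℓ ε x : ℝ}
    (hab : b - a = ℓ * Real.exp ((D.ω D.e - 1) * (t - T))) (hℓ : 0 < ℓ) (hs : Icc a b ⊆ s)
    (hT : 0 ≤ T) (hTt : T ≤ t / 2) (hlam₀ : 0 ≤ lam₀) (hlam : lam₀ ≤ lam) (hlam' : lam ≤ lam')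
    (hρ : 1 ≤ ρ) (hε : 0 < ε) (hε1 : ε ≤ 1)
    (hC2 : 1 ≤ 2 / ℓ + 2 * D.B ^ 3 * Fintype.card I * ℓ)
    (hcond : (Fintype.card I).factorial * (2 / ℓ + 2 * D.B ^ 3 * Fintype.card I * ℓ) * ρ *
      Real.exp (lam' - D.r₀ * T) < ε ^ Fintype.card I)
    (h1 : ∀ y ∈ Icc a b, ∀ S, |minor (D.P t lam y * Z) S| ≤ ρ) (hx : x ∈ Icc a b)
    (hne : ∃ S, minor (D.P (t - T) lam₀ x * Z) S ≠ 0)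
    (h2 : ∀ c : Fin k → ℤ, c ≠ 0 → ∃ i,
      k * ε < |∑ j, (D.P (t - T) lam₀ x * Z) i j * (c j : ℝ)|) (S : Fin k → I) :
    |minor (D.P t lam' x * Z) S| ≤ ρ := by
  set C2 := 2 / ℓ + 2 * D.B ^ 3 * Fintype.card I * ℓ with hC2def
  set m := Fintype.card I
  have hr := D.r₀_pos
  have hωe := D.ω_e_le
  have hrT := mul_le_mul_of_nonneg_right hωe hT
  have hrT0 := mul_nonneg hr.le hT
  have hfac : (1 : ℝ) ≤ m.factorial := by exact_mod_cast Nat.one_le_iff_ne_zero.mpr m.factorial_ne_zero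
  have hεm : ε ^ m ≤ 1 := pow_le_one₀ hε.le hε1
  have hεk : ε ^ m ≤ ε ^ k := pow_le_pow_of_le_one hε.le hε1 hk.le
  have hF := Real.exp_pos (lam' - D.r₀ * T)
  have hcond' : C2 * ρ * Real.exp (lam' - D.r₀ * T) < ε ^ m := by
    refine lt_of_le_of_lt ?_ hcond
    have : 0 ≤ C2 * ρ * Real.exp (lam' - D.r₀ * T) := by positivity
    simpa only [mul_assoc] using le_mul_of_one_le_left this hfac
  have hexp : ∀ S' : Fin k → I, |minor (D.P t lam x * Z) S'| =
      Real.exp (t * D.wt S' + lam * D.cnt S') * |minor (D.M x * Z) S'| := fun S' => by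
    rw [minor_P, abs_mul, abs_of_pos (Real.exp_pos _)]
  have hninj : ∀ {S' : Fin k → I} (t' lam'' : ℝ), ¬ Function.Injective S' →
      minor (D.P t' lam'' x * Z) S' = 0 := fun _ _ h => minor_of_not_injective _ h
  have hnoe : ∀ S' : Fin k → I, (∀ a, S' a ≠ D.e) → |minor (D.P t lam' x * Z) S'| ≤ ρ :=
    fun S' h => by
      have := h1 x hx S'
      rw [minor_P, D.cnt_of_not_mem h] at this ⊢
      simpa using this
  set γ := C2 * ρ * Real.exp (lam' + (D.ω D.e - 1) * T) with hγ
  have hγ0 : 0 ≤ γ := by positivity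
  have hγρ : γ ≤ 1 := by
    refine le_trans ?_ (hcond'.le.trans hεm)
    rw [hγ]
    gcongr
    linarith
  have hey : ∀ S' : Fin k → I, (∃ a, S' a = D.e) → (∀ a, S' a ≠ D.o) →
      |minor (D.P t lam' x * Z) S'| ≤ γ := fun S' ⟨a₀, ha₀⟩ ho => by
    by_cases hinj : Function.Injective S'
    · have := D.abs_minor_e_le hab hℓ hs hT hTt (hlam₀.trans hlam) (by linarith) h1 hx hinj ha₀ ho
      rw [minor_P, abs_mul, abs_of_pos (Real.exp_pos _), D.cnt_of_mem hinj ha₀, mul_one, Real.exp_add,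
        mul_right_comm, hγ, Real.exp_add, mul_comm (Real.exp lam'), ← mul_assoc]
      exact mul_le_mul_of_nonneg_right this (Real.exp_pos _).le
    · rw [hninj _ _ hinj, abs_zero]; exact hγ0
  obtain ⟨S₀, hS₀⟩ : ∃ S₀, ε ^ k ≤ |minor (D.P (t - T) lam₀ x * Z) S₀| := by
    by_contra! hcon
    obtain ⟨c, hc, hcs⟩ := exists_int_mulVec_le_of_minor hε hne hcon
    obtain ⟨i, hi⟩ := h2 c hc
    exact absurd (hcs i) (not_le.mpr hi)
  have hS₀pos : 0 < |minor (D.P (t - T) lam₀ x * Z) S₀| := lt_of_lt_of_le (by positivity) hS₀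
  have hS₀inj : Function.Injective S₀ := by
    by_contra h
    rw [hninj _ _ h, abs_zero] at hS₀pos
    exact lt_irrefl _ hS₀pos
  rw [minor_P, abs_mul, abs_of_pos (Real.exp_pos _)] at hS₀
  have hS₀o : ∀ a, S₀ a ≠ D.o := fun a ha => by
    have hw := D.r₀_le_wt hS₀inj hk ha
    have h3 := h1 x hx S₀
    rw [hexp] at h3
    have h4 : Real.exp ((t - T) * D.wt S₀ + lam₀ * D.cnt S₀) * |minor (D.M x * Z) S₀| ≤
        Real.exp (lam' - D.r₀ * T) * ρ := by
      refine le_trans ?_ (mul_le_mul_of_nonneg_left h3 (Real.exp_pos _).le)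
      rw [← mul_assoc, ← Real.exp_add]
      refine mul_le_mul_of_nonneg_right (Real.exp_le_exp.mpr ?_) (abs_nonneg _)
      have h6 := mul_le_mul_of_nonneg_right hlam (D.cnt_nonneg S₀)
      have h7 := mul_le_mul_of_nonneg_left hw hT
      linarith
    have h5 : Real.exp (lam' - D.r₀ * T) * ρ ≤ C2 * ρ * Real.exp (lam' - D.r₀ * T) := by
      rw [mul_assoc, mul_comm ρ]
      exact le_mul_of_one_le_left (by positivity) hC2
    linarith
  have hS₀e : ∀ a, S₀ a ≠ D.e := fun a ha => by
    have hw := D.neg_one_le_wt hS₀inj hS₀o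
    have h3 := D.abs_minor_e_le hab hℓ hs hT hTt (hlam₀.trans hlam) (by linarith) h1 hx hS₀inj ha hS₀o
    rw [D.cnt_of_mem hS₀inj ha, mul_one] at hS₀
    have h4 : Real.exp ((t - T) * D.wt S₀ + lam₀) * |minor (D.M x * Z) S₀| ≤
        C2 * ρ * Real.exp (lam' - D.r₀ * T) := by
      have h5 : Real.exp ((t - T) * D.wt S₀ + lam₀) * |minor (D.M x * Z) S₀| =
          Real.exp (lam₀ - T * D.wt S₀) * (Real.exp (t * D.wt S₀) * |minor (D.M x * Z) S₀|) := by
        rw [← mul_assoc, ← Real.exp_add]; ring_nf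
      rw [h5]
      refine (mul_le_mul_of_nonneg_left h3 (Real.exp_pos _).le).trans ?_
      rw [mul_comm, mul_assoc, ← Real.exp_add]
      gcongr
      have h8 := mul_le_mul_of_nonneg_left hw hT
      linarith
    linarith
  rw [D.cnt_of_not_mem hS₀e, mul_zero, add_zero] at hS₀
  have hW₀ := D.neg_one_sub_le_wt hS₀inj hS₀o hS₀e
  have hneE : (Finset.univ.filter fun S' : Fin k → I =>
      (∀ a, S' a ≠ D.o) ∧ ∀ a, S' a ≠ D.e).Nonempty := ⟨S₀, by simp [hS₀o, hS₀e]⟩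
  obtain ⟨S₁, hS₁, hmax⟩ := Finset.exists_max_image _
    (fun S' => |minor (D.P t lam' x * Z) S'|) hneE
  simp only [Finset.mem_filter, Finset.mem_univ, true_and] at hS₁ hmax
  set E := |minor (D.P t lam' x * Z) S₁| with hE
  have hEge : ε ^ m * Real.exp (-(T * (1 + D.ω D.e))) ≤ E := by
    refine le_trans ?_ (hmax S₀ ⟨hS₀o, hS₀e⟩)
    rw [minor_P, abs_mul, abs_of_pos (Real.exp_pos _), D.cnt_of_not_mem hS₀e, mul_zero, add_zero]
    have h5 : Real.exp (t * D.wt S₀) = Real.exp (T * D.wt S₀) * Real.exp ((t - T) * D.wt S₀) := by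
      rw [← Real.exp_add]; ring_nf
    rw [h5, mul_assoc, mul_comm]
    have h8 := mul_le_mul_of_nonneg_left hW₀ hT
    gcongr
    · linarith
    · exact hεk.trans hS₀
  have hEpos : 0 < E := lt_of_lt_of_le (by positivity) hEge
  by_cases hSe : ∀ a, S a ≠ D.e
  · exact hnoe S hSe
  by_cases hSo : ∀ a, S a ≠ D.o
  · push Not at hSe
    exact (hey S hSe hSo).trans (by linarith)
  by_cases hinj : Function.Injective S
  swap
  · rw [hninj _ _ hinj, abs_zero]; linarith
  push Not at hSe hSo
  obtain ⟨ae, hae⟩ := hSe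
  obtain ⟨ao, hao⟩ := hSo
  have hne' : ao ≠ ae := fun h => D.hoe (by rw [← hao, ← hae, h])
  obtain ⟨K, hK1, hK2⟩ := exists_cramer (Y := D.P t lam' x * Z) (S := S₁) (abs_pos.mp hEpos)
  have hdet : minor (D.P t lam' x * Z) S = (K.submatrix S id).det * minor (D.P t lam' x * Z) S₁ := by
    rw [minor, minor, ← Matrix.det_mul]
    congr 1
    conv_lhs => rw [hK1]
    rfl
  have hup : ∀ b i c, i ≠ c → (∀ a, S₁ a ≠ c) → ∀ a, Function.update S₁ b i a ≠ c := by
    intro b i c hic hc a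
    by_cases h : a = b
    · subst h; simpa using hic
    · simpa [h] using hc a
  have hKb : ∀ a b, |K.submatrix S id a b| ≤
      if a = ao then ρ / E else if a = ae then γ / E else 1 := by
    intro a b
    simp only [Matrix.submatrix_apply, id]
    rw [hK2, abs_div, ← hE]
    split_ifs with h3 h4
    · subst h3
      gcongr
      exact hnoe _ (hup b _ _ (by rw [hao]; exact D.hoe) hS₁.2)
    · subst h4
      gcongr
      exact hey _ ⟨b, by simp [hae]⟩ (hup b _ _ (by rw [hae]; exact D.hoe.symm) hS₁.1)
    · rw [div_le_one hEpos]
      exact hmax _ ⟨hup b _ _ (fun h => h3 (hinj (h.trans hao.symm))) hS₁.1,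
        hup b _ _ (fun h => h4 (hinj (h.trans hae.symm))) hS₁.2⟩
  have hprod : ∏ a, (if a = ao then ρ / E else if a = ae then γ / E else 1) = ρ / E * (γ / E) := by
    rw [Finset.prod_eq_mul ao ae hne' (fun c _ hc => by simp [hc.1, hc.2]) (by simp) (by simp)]
    simp [hne'.symm]
  have hfin := abs_det_le_prod _ _ hKb
  rw [hprod] at hfin
  rw [hdet, abs_mul, ← hE]
  have hkm : (k.factorial : ℝ) ≤ m.factorial := by exact_mod_cast Nat.factorial_le hk.le
  have hγE : m.factorial * γ ≤ E := by
    refine le_trans ?_ hEge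
    have h6 : m.factorial * γ = (m.factorial * C2 * ρ * Real.exp (lam' - D.r₀ * T)) *
        Real.exp ((D.ω D.e - 1) * T + D.r₀ * T) := by
      rw [mul_assoc (_ * ρ), ← Real.exp_add, hγ]; ring_nf
    rw [h6]
    gcongr
    linarith
  calc _ ≤ k.factorial * (ρ / E * (γ / E)) * E := by gcongr
    _ = ρ * (k.factorial * γ / E) := by field_simp
    _ ≤ ρ * 1 := by
      gcongr
      rw [div_le_one hEpos]
      refine le_trans ?_ hγE
      gcongr
    _ = ρ := mul_one _
theorem exists_row_matrix {x : ℝ} (hx : x ∈ s) :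
    ∃ C : Matrix I I ℝ, (∀ i l, |C i l| ≤ 3 * D.B ^ 3) ∧ C * D.M x = 1 := by
  choose C hC hC1 using fun i => D.exists_row_coeff hx i
  refine ⟨Matrix.of C, hC, ?_⟩
  ext i j
  rw [Matrix.mul_apply]
  simp only [Matrix.of_apply]
  rw [← hC1, Pi.single_apply, Matrix.one_apply]
  simp [eq_comm]

theorem exists_minor_M_ge {k : ℕ} {V : Submodule ℚ (I → ℚ)} {Z : Matrix I (Fin k) ℤ}
    (hZ : IsIntBasis V Z) {x : ℝ} (hx : x ∈ s) : ∃ T, 1 ≤ (Fintype.card I * (3 * D.B ^ 3)) ^ k *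
      |minor (D.M x * Z.map (Int.cast : ℤ → ℝ)) T| := by
  have : Nonempty I := ⟨D.o⟩
  obtain ⟨S, hS⟩ := hZ.exists_minor_ne_zero
  obtain ⟨C, hC, hC1⟩ := D.exists_row_matrix hx
  have h1 : minor (Z.map (Int.cast : ℤ → ℝ)) S = (minor Z S : ℤ) := minor_map (Int.castRingHom ℝ) Z S
  have h2 : (1 : ℝ) ≤ |(C.submatrix S id * (D.M x * Z.map (Int.cast : ℤ → ℝ))).det| := by
    have h3 : C.submatrix S id * (D.M x * Z.map (Int.cast : ℤ → ℝ)) =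
        (Z.map (Int.cast : ℤ → ℝ)).submatrix S id := by
      rw [← Matrix.mul_assoc]
      have : C.submatrix S id * D.M x = (1 : Matrix I I ℝ).submatrix S id := by rw [← hC1]; rfl
      rw [this]
      ext a b; simp [Matrix.mul_apply, Matrix.one_apply]
    rw [h3]
    change 1 ≤ |minor (Z.map (Int.cast : ℤ → ℝ)) S|
    rw [h1]
    exact_mod_cast Int.one_le_abs hS
  obtain ⟨T, -, hT⟩ := exists_minor_ge (fun a l => hC (S a) l) one_pos h2
  exact ⟨T, hT⟩

theorem exists_minor_P_ne_zero {k : ℕ} {V : Submodule ℚ (I → ℚ)} {Z : Matrix I (Fin k) ℤ}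
    (hZ : IsIntBasis V Z) {x : ℝ} (hx : x ∈ s) (t lam : ℝ) :
    ∃ T, minor (D.P t lam x * Z.map (Int.cast : ℤ → ℝ)) T ≠ 0 := by
  obtain ⟨T, hT⟩ := D.exists_minor_M_ge hZ hx
  refine ⟨T, ?_⟩
  rw [minor_P]
  refine mul_ne_zero (Real.exp_pos _).ne' fun h => ?_
  rw [h, abs_zero, mul_zero] at hT
  linarith

/-- The top minor of the full lattice. -/
theorem exists_minor_top_ge {k : ℕ} {Z : Matrix I (Fin k) ℤ} (hZ : IsIntBasis ⊤ Z) {x : ℝ}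
    (hx : x ∈ s) (t lam : ℝ) : ∃ S, Real.exp lam ≤ (Fintype.card I * (3 * D.B ^ 3)) ^ Fintype.card I *
      |minor (D.P t lam x * Z.map (Int.cast : ℤ → ℝ)) S| := by
  have hk : k = Fintype.card I := by
    rw [← hZ.finrank_eq, finrank_top, Module.finrank_fintype_fun_eq_card]
  obtain ⟨T, hT⟩ := D.exists_minor_M_ge hZ hx
  refine ⟨T, ?_⟩
  have hinj : Function.Injective T := by
    by_contra h
    rw [minor_of_not_injective _ h, abs_zero, mul_zero] at hT
    linarith
  have hsurj : Function.Surjective T :=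
    ((Fintype.bijective_iff_injective_and_card T).mpr ⟨hinj, by simpa using hk⟩).2
  obtain ⟨a, ha⟩ := hsurj D.e
  have hw : D.wt T = 0 := by
    rw [D.wt_eq hinj, Finset.image_univ_of_surjective hsurj, D.ω_sum]
  rw [minor_P, hw, D.cnt_of_mem hinj ha, abs_mul, abs_of_pos (Real.exp_pos _)]
  have hpow : ((Fintype.card I : ℝ) * (3 * D.B ^ 3)) ^ Fintype.card I =
    (Fintype.card I * (3 * D.B ^ 3)) ^ k := congrArg _ hk.symm
  rw [hpow]
  have := mul_le_mul_of_nonneg_left hT (Real.exp_pos lam).le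
  rw [mul_zero, zero_add, mul_one]
  linarith

/-- Proper subspaces are not small on the whole interval. -/
theorem exists_minor_proper_ge {k : ℕ} [NeZero k] (hk : k < Fintype.card I)
    {V : Submodule ℚ (I → ℚ)} {Z : Matrix I (Fin k) ℤ} (hZ : IsIntBasis V Z) {t lam : ℝ}
    (ht : 0 ≤ t) (hlam : lam ≤ D.r₀ * t) : ∃ x ∈ s, ∃ S, D.c₃ * Real.exp lam ≤
      (Fintype.card I * (3 * D.B ^ 3)) ^ Fintype.card I *
        |minor (D.P t lam x * Z.map (Int.cast : ℤ → ℝ)) S| := by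
  have : Nonempty I := ⟨D.o⟩
  obtain ⟨S, hS⟩ := hZ.exists_minor_ne_zero
  let b : Fin k := 0
  obtain ⟨x, hx, hxc⟩ := D.nondeg (fun i => minor Z (Function.update S b i)) (fun h => hS (by
    have := congrFun h (S b)
    simpa using this))
  obtain ⟨C, hC, hC1⟩ := D.exists_row_matrix hx
  let C' : Matrix (Fin k) I ℝ := (C.submatrix S id).updateRow b (Pi.single D.o 1)
  have hC' : ∀ a l, |C' a l| ≤ 3 * D.B ^ 3 := fun a l => by
    by_cases h : a = b
    · subst h
      have : 1 ≤ D.B ^ 3 := one_le_pow₀ D.one_le_B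
      simp only [C', Matrix.updateRow_self, Pi.single_apply]
      split_ifs <;> simp <;> linarith
    · simpa [C', h] using hC (S a) l
  have hdet : (C' * (D.M x * Z.map (Int.cast : ℤ → ℝ))).det =
      ∑ i, ((minor Z (Function.update S b i) : ℤ) : ℝ) * D.g i x := by
    have h1 : (C' * (D.M x * Z.map (Int.cast : ℤ → ℝ))).det =
        rowForm ((Z.map (Int.cast : ℤ → ℝ)).submatrix S id) (Z.map (Int.cast : ℤ → ℝ)) b
          (fun l => D.g l x) := by
      change _ = Matrix.det _
      rw [← Matrix.mul_assoc]
      congr 1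
      ext a j
      by_cases h : a = b
      · subst h
        rw [Matrix.updateRow_self, Matrix.mul_apply]
        simp [C', Matrix.mul_apply, Pi.single_apply, D.M_o]
      · have h2 : ∀ l, (C' * D.M x) a l = (1 : Matrix I I ℝ) (S a) l := fun l => by
          rw [← hC1, Matrix.mul_apply, Matrix.mul_apply]
          simp [C', h]
        rw [Matrix.updateRow_ne h, Matrix.mul_apply]
        simp [h2, Matrix.one_apply]
    rw [h1, linear_eq_sum]
    refine Finset.sum_congr rfl fun i _ => ?_
    rw [mul_comm]
    congr 1
    have h3 : minor (Z.map (Int.cast : ℤ → ℝ)) (Function.update S b i) =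
      (minor Z (Function.update S b i) : ℤ) := minor_map (Int.castRingHom ℝ) Z _
    rw [← h3]
    change Matrix.det _ = Matrix.det _
    congr 1
    ext a j
    by_cases h : a = b
    · subst h; simp [Pi.single_apply]
    · simp [h]
  rw [← hdet] at hxc
  obtain ⟨T, hT0, hT⟩ := exists_minor_ge hC' D.c₃_pos hxc
  have hTb : T b = D.o := by
    by_contra h
    exact hT0 b (by simp [C', h])
  have hinj : Function.Injective T := by
    by_contra h
    rw [minor_of_not_injective _ h, abs_zero, mul_zero] at hT
    linarith [D.c₃_pos]
  refine ⟨x, hx, T, ?_⟩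
  have hexp : lam ≤ t * D.wt T + lam * D.cnt T := by
    by_cases he : ∀ a, T a ≠ D.e
    · rw [D.cnt_of_not_mem he]
      have h1 := D.neg_ω_e_le_wt hinj hTb he
      have h2 := D.ω_e_le
      nlinarith
    · push Not at he
      obtain ⟨a, ha⟩ := he
      rw [D.cnt_of_mem hinj ha]
      have h1 := D.r₀_le_wt hinj hk hTb
      have := D.r₀_pos
      nlinarith
  rw [minor_P, abs_mul, abs_of_pos (Real.exp_pos _)]
  have hb : (1 : ℝ) ≤ Fintype.card I * (3 * D.B ^ 3) := by
    have := D.card_pos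
    have : 1 ≤ D.B ^ 3 := one_le_pow₀ D.one_le_B
    nlinarith
  calc D.c₃ * Real.exp lam ≤ ((Fintype.card I * (3 * D.B ^ 3)) ^ k *
        |minor (D.M x * Z.map (Int.cast : ℤ → ℝ)) T|) *
          Real.exp (t * D.wt T + lam * D.cnt T) := by gcongr
    _ ≤ ((Fintype.card I * (3 * D.B ^ 3)) ^ Fintype.card I *
        |minor (D.M x * Z.map (Int.cast : ℤ → ℝ)) T|) *
          Real.exp (t * D.wt T + lam * D.cnt T) := by
      gcongr
    _ = _ := by ring
/-- Some nonzero integer vector is contracted below `X` on `S`. -/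
def Contracted (t lam X : ℝ) (S : Set ℝ) : Prop :=
  ∃ v : I → ℤ, v ≠ 0 ∧ ∀ x ∈ S, ∀ i, |(D.P t lam x).mulVec (fun i => (v i : ℝ)) i| ≤ X

/-- Distortion constant of the frame. -/
noncomputable def bd : ℝ := (Fintype.card I * (3 * D.B ^ 3)) ^ Fintype.card I

theorem one_le_bd : 1 ≤ D.bd := by
  refine one_le_pow₀ ?_
  have := D.card_pos
  have : 1 ≤ D.B ^ 3 := one_le_pow₀ D.one_le_B
  nlinarith

/-- Distortion constant of an interval of length `ℓ`. -/
noncomputable def wd (ℓ : ℝ) : ℝ := 2 / ℓ + 2 * D.B ^ 3 * Fintype.card I * ℓ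

theorem one_le_wd {ℓ : ℝ} (hℓ : 0 < ℓ) (hℓ1 : ℓ ≤ 1) : 1 ≤ D.wd ℓ := by
  have h0 := D.one_le_B
  have h1 : 1 ≤ 2 / ℓ := by rw [le_div_iff₀ hℓ]; linarith
  have h2 : 0 ≤ 2 * D.B ^ 3 * Fintype.card I * ℓ := by positivity
  rw [wd]; linarith

omit [DecidableEq I] in
theorem finrank_bounds {V : Submodule ℚ (I → ℚ)} (h0 : ⊥ < V) (h1 : V < ⊤) :
    Module.finrank ℚ V ≠ 0 ∧ Module.finrank ℚ V < Fintype.card I := by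
  refine ⟨fun h => h0.ne' (Submodule.finrank_eq_zero.mp h), ?_⟩
  have := Submodule.finrank_lt h1.ne
  rwa [Module.finrank_fintype_fun_eq_card] at this

omit [DecidableEq I] in
theorem mul_map_apply {k : ℕ} (A : Matrix I I ℝ) (Z : Matrix I (Fin k) ℤ) (c : Fin k → ℤ) (i : I) :
    ∑ j, (A * Z.map (Int.cast : ℤ → ℝ)) i j * (c j : ℝ) =
      A.mulVec (fun l => ((Z.mulVec c l : ℤ) : ℝ)) i := by
  have h1 : (fun l => ((Z.mulVec c l : ℤ) : ℝ)) =
      (Z.map (Int.cast : ℤ → ℝ)).mulVec (fun j => (c j : ℝ)) := by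
    ext l; simp [Matrix.mulVec, dotProduct]
  rw [h1, Matrix.mulVec_mulVec]
  rfl

theorem contracted_of_smallOn (hconv : Convex ℝ s) {V : Submodule ℚ (I → ℚ)} (h0 : ⊥ < V)
    (h1 : V < ⊤) {a b t T lam₀ lam lam' σ ℓ X₀ : ℝ} {S : Set ℝ}
    (hab : b - a = ℓ * Real.exp ((t - T) * (D.ω D.e - 1))) (hs : Icc a b ⊆ s)
    (hℓ : 0 < ℓ) (hℓ1 : ℓ ≤ 1) (hℓB : ℓ * (2 * D.B ^ 3 * Fintype.card I) ≤ 1)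
    (hT : 0 ≤ T) (hTt : T ≤ t / 2) (hlam₀ : 0 ≤ lam₀) (hlam : lam₀ ≤ lam) (hlam' : lam ≤ lam')
    (hlt₀ : lam₀ ≤ t - T) (hlt : lam' ≤ t) (hσ : 0 < σ) (hσ1 : σ ≤ 1)
    (hcond : (Fintype.card I).factorial * D.wd ℓ * (σ⁻¹) ^ Fintype.card I *
      Real.exp (lam' - D.r₀ * T) < (1 / (3 * Fintype.card I : ℝ)) ^ Fintype.card I)
    (hX₀ : 1 ≤ X₀) (hnot : ¬ D.Contracted (t - T) lam₀ X₀ (Icc a b))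
    (hsmall : SmallOn (D.P t lam) σ (Icc a b) V 1) (hSs : S ⊆ Icc a b)
    (hSd : ∀ x ∈ S, ∀ y ∈ S, |y - x| ≤ ℓ * Real.exp (t * (D.ω D.e - 1))) :
    D.Contracted t lam' (6 * Fintype.card I / σ) S := by
  obtain ⟨Z, hZ, hZs⟩ := hsmall
  obtain ⟨hk0, hkm⟩ := finrank_bounds h0 h1
  generalize Module.finrank ℚ V = k at Z hZ hZs hk0 hkm
  have : NeZero k := ⟨hk0⟩
  set m := Fintype.card I with hm
  have hm0 : (1 : ℝ) ≤ m := D.card_pos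
  have hkm' : (k : ℝ) ≤ m := by exact_mod_cast hkm.le
  rcases S.eq_empty_or_nonempty with rfl | ⟨x, hxS⟩
  · exact ⟨Pi.single D.o 1, by simp, by simp⟩
  have hx := hSs hxS
  have hρ : 1 ≤ (σ⁻¹) ^ k := one_le_pow₀ ((one_le_inv₀ hσ).mpr hσ1)
  have hρm : (σ⁻¹) ^ k ≤ (σ⁻¹) ^ m := pow_le_pow_right₀ ((one_le_inv₀ hσ).mpr hσ1) hkm.le
  have hwd := D.one_le_wd hℓ hℓ1
  have hminor := D.abs_minor_le_of_window (lam' := lam') (ε := 1 / (3 * m)) (Z := Z.map (Int.cast : ℤ → ℝ)) hkm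
    (by rw [hab, mul_comm (t - T)]) hℓ hs hT hTt hlam₀ hlam hlam' hρ (by positivity)
    (by rw [div_le_one (by positivity)]; linarith) hwd
    (lt_of_le_of_lt (by
      change _ * D.wd ℓ * _ * _ ≤ _ * D.wd ℓ * _ * _
      gcongr) hcond)
    (fun y hy S' => by
      have := hZs y hy S'
      rw [abs_mul, abs_of_pos (pow_pos hσ k)] at this
      rwa [inv_pow, ← one_div, le_div_iff₀ (pow_pos hσ k), mul_comm]) hx
    (D.exists_minor_P_ne_zero hZ (hs hx) _ _)
    (fun c hc => by
      by_contra! hcon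
      refine hnot ⟨Z.mulVec c, hZ.mulVec_ne_zero hc, fun y hy i => ?_⟩
      have hN : ∀ i, |(D.P (t - T) lam₀ x).mulVec (fun l => ((Z.mulVec c l : ℤ) : ℝ)) i| ≤ 1 / 3 :=
        fun i => by
          rw [← mul_map_apply]
          refine (hcon i).trans ?_
          rw [mul_one_div, div_le_div_iff₀ (by positivity) (by norm_num)]
          linarith
      have h3 := D.P_mulVec_stable hconv (hs hx) (hs hy) hlt₀ hlam₀ hℓ.le hℓ1 hℓB (by
        rw [← hab, abs_le]; constructor <;> linarith [hx.1, hx.2, hy.1, hy.2]) hN i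
      linarith)
  obtain ⟨c, hc, hcs⟩ := exists_int_mulVec_le_of_minor (r := 2 / σ) (by positivity)
    (D.exists_minor_P_ne_zero hZ (hs hx) t lam') (fun S' => by
      refine lt_of_le_of_lt (hminor S') ?_
      rw [inv_pow, div_pow, ← one_div]
      gcongr
      exact one_lt_pow₀ (by norm_num) hk0)
  refine ⟨Z.mulVec c, hZ.mulVec_ne_zero hc, fun y hy i => ?_⟩
  have h3 := D.P_mulVec_stable hconv (hs hx) (hs (hSs hy)) hlt (by linarith) hℓ.le hℓ1 hℓB
    (hSd x hxS y hy) (N := k * (2 / σ)) (v := fun l => ((Z.mulVec c l : ℤ) : ℝ))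
    (fun i => by rw [← mul_map_apply]; exact hcs i) i
  refine h3.trans ?_
  rw [show 3 * (k * (2 / σ)) = 6 * k / σ by ring]
  gcongr

theorem not_smallOn_root {V : Submodule ℚ (I → ℚ)} (h0 : ⊥ < V) (h1 : V < ⊤) {t lam σ c : ℝ}
    (ht : 0 ≤ t) (hlam : lam ≤ D.r₀ * t) (hσ : 0 < σ) (hσ1 : σ ≤ 1)
    (hσl : 1 ≤ σ ^ Fintype.card I * Real.exp lam) (hc : c < D.c₃ / D.bd) :
    ¬ SmallOn (D.P t lam) σ s V c := by
  rintro ⟨Z, hZ, hZs⟩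
  obtain ⟨hk0, hkm⟩ := finrank_bounds h0 h1
  generalize Module.finrank ℚ V = k at Z hZ hZs hk0 hkm
  have : NeZero k := ⟨hk0⟩
  obtain ⟨x, hx, S, hS⟩ := D.exists_minor_proper_ge hkm hZ ht hlam
  have h2 := hZs x hx S
  rw [abs_mul, abs_of_pos (pow_pos hσ k)] at h2
  have h3 : σ ^ Fintype.card I ≤ σ ^ k := pow_le_pow_of_le_one hσ.le hσ1 hkm.le
  have hb : 0 < D.bd := by linarith [D.one_le_bd]
  have h4 : D.c₃ / D.bd ≤ c := by
    refine le_trans ?_ h2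
    rw [div_le_iff₀ hb]
    calc D.c₃ ≤ D.c₃ * (σ ^ Fintype.card I * Real.exp lam) :=
          le_mul_of_one_le_right D.c₃_pos.le hσl
      _ = σ ^ Fintype.card I * (D.c₃ * Real.exp lam) := by ring
      _ ≤ σ ^ k * (D.bd * |minor (D.P t lam x * Z.map (Int.cast : ℤ → ℝ)) S|) := by
        have := D.c₃_pos
        refine mul_le_mul h3 ?_ (by positivity) (by positivity)
        rw [bd]; exact hS
      _ = _ := by ring
  linarith

theorem exists_minor_top_ge' {k : ℕ} {Z : Matrix I (Fin k) ℤ} (hZ : IsIntBasis ⊤ Z) {x : ℝ}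
    (hx : x ∈ s) {t lam σ : ℝ} (hσ : 0 < σ)
    (hσl : 1 ≤ σ ^ Fintype.card I * Real.exp lam) :
    ∃ S, 1 / D.bd ≤ |σ ^ k * minor (D.P t lam x * Z.map (Int.cast : ℤ → ℝ)) S| := by
  have hk : k = Fintype.card I := by
    rw [← hZ.finrank_eq, finrank_top, Module.finrank_fintype_fun_eq_card]
  obtain ⟨S, hS⟩ := D.exists_minor_top_ge hZ hx t lam
  refine ⟨S, ?_⟩
  have hb : 0 < D.bd := by linarith [D.one_le_bd]
  have hk' : σ ^ k = σ ^ Fintype.card I := congrArg _ hk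
  rw [abs_mul, abs_of_pos (pow_pos hσ k), hk', div_le_iff₀ hb]
  have h1 := mul_le_mul_of_nonneg_left hS (pow_pos hσ (Fintype.card I)).le
  rw [← bd] at h1
  linarith
end CurveData

namespace CurveData
variable {I : Type*} [Fintype I] [DecidableEq I] {T : NTree Bool} (D : CurveData I (T.cell []))

theorem exists_count (hT : T.IsGap) {C : ℝ} {κ : ℕ} (hκ : 1 ≤ κ) (hC : 1 ≤ C)
    (hsg : ∀ k ≤ Fintype.card I, ∀ (Z : Matrix I (Fin k) ℤ) S (a : ℝ),
      SepGood C κ (fun x => a * minor (D.M x * Z.map (Int.cast : ℤ → ℝ)) S) (T.cell [])) :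
    ∃ K : ℝ, 1 ≤ K ∧ ∃ α : ℝ, 0 < α ∧ ∀ (t lam σ ρ X : ℝ) (w : List Bool) (n : ℕ), 0 < σ →
      1 ≤ σ ^ Fintype.card I * Real.exp lam → 0 < ρ → ρ ≤ 1 → 0 < X →
      (∀ V, ⊥ < V → V < ⊤ → ¬ SmallOn (D.P t lam) σ (T.cell w) V ρ) →
      csum (ind fun u => D.Contracted t lam X (T.cell u)) n w ≤
        K * (σ * X / ρ) ^ α * 2 ^ n := by
  have hb : 0 < D.bd := by linarith [D.one_le_bd]
  obtain ⟨K, hK, h⟩ := hT.contracted_count (I := I) hκ hC (one_div_pos.mpr hb)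
  have hq := T.two_le
  have hκ' : (1 : ℝ) ≤ κ := by exact_mod_cast hκ
  refine ⟨K, hK, _, ?_, fun t lam σ ρ X w n hσ hσl hρ hρ1 hX hV =>
    h (D.P t lam) σ hσ ?_ ?_ ρ X w n hρ hρ1 hX hV⟩
  · have h1 : 0 < Real.log 2 := Real.log_pos (by norm_num)
    have h2 : 0 < Real.log T.q := Real.log_pos (by linarith)
    positivity
  · intro k hk Z S a
    have := hsg k hk Z S (a * Real.exp (t * D.wt S + lam * D.cnt S))
    simp only [D.minor_P]
    simpa only [mul_assoc] using this
  · intro x hx k Z hZ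
    exact D.exists_minor_top_ge' hZ hx hσ hσl

/-- The expected event of the `j`-th window on words at block level `i`. -/
def InE (ω τ : ℝ) (i j : ℕ) (S : Set ℝ) : Prop :=
  D.Contracted (i * τ) (ω * 2 ^ j * τ) (Real.exp (ω * 2 ^ j * τ / (2 * Fintype.card I))) S

omit [DecidableEq I] in
theorem cell_len (T : NTree Bool) {h : ℕ} {e τ : ℝ} (hτ : τ * (1 - e) = h * Real.log T.q) {i n : ℕ}
    (hn : n = h * i) : T.size n = T.len * Real.exp (i * τ * (e - 1)) := by
  have hq := T.q_pos
  rw [show (i : ℝ) * τ * (e - 1) = -(↑(h * i) * Real.log T.q) by push_cast; linear_combination -i * hτ,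
    Real.exp_neg, ← Real.log_pow, Real.exp_log (by positivity), NTree.size, hn, div_eq_mul_inv]

theorem window_count {K α ω τ : ℝ} {h : ℕ} (hK : 1 ≤ K)
    (hcount : ∀ (t lam σ ρ X : ℝ) (w : List Bool) (n : ℕ), 0 < σ →
      1 ≤ σ ^ Fintype.card I * Real.exp lam → 0 < ρ → ρ ≤ 1 → 0 < X →
      (∀ V, ⊥ < V → V < ⊤ → ¬ SmallOn (D.P t lam) σ (T.cell w) V ρ) →
      csum (ind fun u => D.Contracted t lam X (T.cell u)) n w ≤
        K * (σ * X / ρ) ^ α * 2 ^ n)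
    (hlen1 : T.len ≤ 1) (hlenB : T.len * (2 * D.B ^ 3 * Fintype.card I) ≤ 1)
    (hω : ω = D.r₀ / 8) (hτ : 0 < τ) (hτh : τ * (1 - D.ω D.e) = h * Real.log T.q)
    (hR2 : 6 * Fintype.card I ≤ Real.exp (ω * τ / Fintype.card I))
    (hR3 : (Fintype.card I).factorial * D.wd T.len * Real.exp (-(D.r₀ * τ / 2)) <
      (1 / (3 * Fintype.card I : ℝ)) ^ Fintype.card I)
    {w : List Bool} {a j : ℕ} (hw : w.length = h * a) (hja : 2 ^ j ≤ a)
    (hrm : ¬ D.InE ω τ a 0 (T.cell w)) :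
    csum (ind fun u => D.InE ω τ (a + 2 ^ j) j (T.cell u) ∧ ¬ D.InE ω τ (a + 2 ^ j) (j + 1) (T.cell u))
      (h * 2 ^ j) w ≤
      K * (6 * Fintype.card I * Real.exp (-(ω * 2 ^ j * τ / (2 * Fintype.card I)))) ^ α *
        2 ^ (h * 2 ^ j) := by
  have hm := D.card_pos
  set m := (Fintype.card I : ℝ) with hmdef
  have hr₀ := D.r₀_pos
  have hω0 : 0 < ω := by linarith
  have hω8 : ω ≤ 1 / 8 := by linarith [D.ω_e_le, D.neg_one_le_ω_e]
  have h2j : (1 : ℝ) ≤ 2 ^ j := one_le_pow₀ (by norm_num)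
  have hja' : (2 : ℝ) ^ j ≤ a := by exact_mod_cast hja
  set Y := ω * 2 ^ j * τ with hY
  have hωτ : ω * τ ≤ Y := by rw [hY]; nlinarith [mul_pos hω0 hτ]
  have hY0 : 0 < Y := by rw [hY]; positivity
  set X := Real.exp (Y / (2 * m)) with hX
  set X' := Real.exp (Y / m) with hX'
  have hX1 : 6 * m ≤ X' := hR2.trans (by rw [hX']; gcongr)
  set σ := 6 * m / X' with hσ
  have hσ0 : 0 < σ := by rw [hσ]; positivity
  have hσX : 6 * m / σ = X' := by rw [hσ]; field_simp
  have hXm : X' ^ Fintype.card I = Real.exp Y := by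
    rw [hX', ← Real.exp_nat_mul, ← hmdef]; congr 1; field_simp
  by_cases hex : ∃ u, w <:+ u ∧ u.length = w.length + h * 2 ^ j ∧
      (D.InE ω τ (a + 2 ^ j) j (T.cell u) ∧ ¬ D.InE ω τ (a + 2 ^ j) (j + 1) (T.cell u))
  swap
  · push Not at hex
    rw [csum_eq_zero_of]
    · positivity
    · rintro u h1 h2 ⟨h3, h4⟩; exact h4 (hex u h1 h2 h3)
  obtain ⟨u₀, hs₀, hl₀, -, hno⟩ := hex
  have hfin := hcount (((a + 2 ^ j : ℕ) : ℝ) * τ) Y σ 1 X w (h * 2 ^ j) hσ0 ?_ one_pos le_rfl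
    (Real.exp_pos _) ?_
  · refine (csum_ind_mono _ _ fun u _ _ hu => hu.1).trans (hfin.trans (le_of_eq ?_))
    congr 3
    rw [hσ, hX, hX', div_one, div_mul_eq_mul_div, mul_div_assoc, ← Real.exp_sub]
    congr 2
    field_simp
    ring
  · rw [hσ, div_pow, hXm, div_mul_cancel₀ _ (Real.exp_pos Y).ne']
    exact one_le_pow₀ (by linarith)
  · intro V h0 h1 hsm
    refine hno ?_
    have key := D.contracted_of_smallOn (convex_Icc _ _) h0 h1
      (a := T.c w) (b := T.c w + T.size w.length) (t := ((a + 2 ^ j : ℕ) : ℝ) * τ) (T := 2 ^ j * τ)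
      (lam₀ := ω * τ) (lam := Y) (lam' := 2 * Y) (σ := σ) (ℓ := T.len)
      (X₀ := Real.exp (ω * τ / (2 * m))) (S := T.cell u₀)
      (by rw [cell_len T hτh hw]; push_cast; ring_nf) (T.cell_subset_of_suffix (List.nil_suffix))
      T.len_pos hlen1 hlenB (by positivity) (by push_cast; nlinarith) (by positivity) hωτ (by linarith)
      (by push_cast; nlinarith) (by push_cast; rw [hY]; nlinarith [mul_pos (show (0:ℝ) < 2 ^ j by positivity) hτ])
      hσ0 (by rw [hσ, div_le_one (Real.exp_pos _)]; exact hX1)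
      (by
        refine lt_of_le_of_lt ?_ hR3
        have hwd := D.one_le_wd T.len_pos hlen1
        rw [mul_assoc _ (σ⁻¹ ^ _)]
        gcongr
        have h1 : σ⁻¹ ^ Fintype.card I ≤ Real.exp Y := by
          rw [← hXm]
          refine pow_le_pow_left₀ (by positivity) ?_ _
          rw [hσ, inv_div]
          exact div_le_self (Real.exp_pos _).le (by linarith)
        calc _ ≤ Real.exp Y * Real.exp (2 * Y - D.r₀ * (2 ^ j * τ)) := by gcongr
          _ = Real.exp (Y + (2 * Y - D.r₀ * (2 ^ j * τ))) := (Real.exp_add _ _).symm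
          _ ≤ _ := by
            refine Real.exp_le_exp.mpr ?_
            rw [hY, hω]
            nlinarith [mul_pos hr₀ hτ])
      (Real.one_le_exp (by positivity))
      (by
        have h2 : ((a + 2 ^ j : ℕ) : ℝ) * τ - 2 ^ j * τ = a * τ := by push_cast; ring
        rw [h2]
        rw [InE, pow_zero, mul_one] at hrm
        exact hrm)
      hsm (T.cell_subset_of_suffix hs₀)
      (fun x hx y hy => by
        have := T.abs_sub_le hy hx
        rwa [cell_len T hτh (i := a + 2 ^ j) (by rw [hl₀, hw]; ring)] at this)
    rw [← hmdef, hσX] at key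
    rw [InE, pow_succ]
    convert key using 1
    · rw [hY]; ring
    · rw [hX', hY]; congr 1; rw [← hmdef]; field_simp

theorem top_count {K α ω τ c₀ : ℝ} {h : ℕ}
    (hcount : ∀ (t lam σ ρ X : ℝ) (w : List Bool) (n : ℕ), 0 < σ →
      1 ≤ σ ^ Fintype.card I * Real.exp lam → 0 < ρ → ρ ≤ 1 → 0 < X →
      (∀ V, ⊥ < V → V < ⊤ → ¬ SmallOn (D.P t lam) σ (T.cell w) V ρ) →
      csum (ind fun u => D.Contracted t lam X (T.cell u)) n w ≤
        K * (σ * X / ρ) ^ α * 2 ^ n)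
    (hc₀ : 0 < c₀) (hc₁ : c₀ ≤ 1) (hc : c₀ < D.c₃ / D.bd)
    (hω0 : 0 < ω) (hω : ω ≤ D.r₀) (hτ : 0 < τ) {i j : ℕ} (hji : 2 ^ j ≤ i) :
    csum (ind fun u => D.InE ω τ i j (T.cell u)) (h * i) [] ≤
      K * (1 / c₀ * Real.exp (-(ω * 2 ^ j * τ / (2 * Fintype.card I)))) ^ α * 2 ^ (h * i) := by
  have hm := D.card_pos
  set m := (Fintype.card I : ℝ) with hmdef
  have hji' : (2 : ℝ) ^ j ≤ i := by exact_mod_cast hji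
  set Y := ω * 2 ^ j * τ with hY
  have hY0 : 0 < Y := by rw [hY]; positivity
  have hσm : 1 ≤ Real.exp (-(Y / m)) ^ Fintype.card I * Real.exp Y := by
    rw [← Real.exp_nat_mul, ← Real.exp_add, ← hmdef]
    refine Real.one_le_exp (le_of_eq ?_)
    field_simp
    ring
  refine (hcount (i * τ) Y (Real.exp (-(Y / m))) c₀ (Real.exp (Y / (2 * m))) [] (h * i)
    (Real.exp_pos _) hσm hc₀ hc₁ (Real.exp_pos _) fun V h0 h1 =>
    D.not_smallOn_root h0 h1 (by positivity) ?_ (Real.exp_pos _) ?_ hσm hc).trans (le_of_eq ?_)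
  · rw [hY]
    have : ω * 2 ^ j ≤ D.r₀ * i := mul_le_mul hω hji' (by positivity) D.r₀_pos.le
    nlinarith
  · rw [Real.exp_le_one_iff]; have : 0 < Y / m := by positivity
    linarith
  · congr 3
    rw [← Real.exp_add, one_div_mul_eq_div]
    congr 2
    field_simp
    ring
end CurveData

theorem mul_sum_pow_le_one {A x : ℝ} (hx : 0 ≤ x) (h : x * (1 + A) ≤ 1) (i : ℕ) :
    ∑ p ∈ Finset.Icc 1 i, A * x ^ p ≤ 1 := by
  have key : ∑ p ∈ Finset.Icc 1 i, A * x ^ p ≤ 1 - x ^ i := by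
    induction i with
    | zero => simp
    | succ i ih =>
      rw [Finset.sum_Icc_succ_top (by omega), pow_succ]
      have : 0 ≤ x ^ i := by positivity
      nlinarith
  have : 0 ≤ x ^ i := by positivity
  linarith

theorem exists_nat_exp_neg_lt {c θ : ℝ} (hc : 0 < c) (hθ : 0 < θ) :
    ∃ N : ℕ, ∀ h : ℕ, N ≤ h → Real.exp (-(c * h)) < θ := by
  have h1 : Tendsto (fun h : ℕ => Real.exp (-(c * h))) atTop (nhds 0) := by
    refine Real.tendsto_exp_neg_atTop_nhds_zero.comp ?_
    exact tendsto_natCast_atTop_atTop.const_mul_atTop hc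
  exact eventually_atTop.mp (h1.eventually (gt_mem_nhds hθ))

namespace CurveData
variable {I : Type*} [Fintype I] [DecidableEq I] {T : NTree Bool} (D : CurveData I (T.cell []))

/-- The type of a word at which the `0`-th event holds: a pair of consecutive windows, or the
whole word. -/
def Ty (ω τ : ℝ) {h : ℕ} (p : ℕ) (u : List (Fin h → Bool)) : Prop :=
  (∃ j, p = 2 ^ j ∧ j < Nat.log 2 u.length ∧ D.InE ω τ u.length j (T.cell (NTree.flat u)) ∧
    ¬ D.InE ω τ u.length (j + 1) (T.cell (NTree.flat u))) ∨
  p = u.length ∧ D.InE ω τ u.length (Nat.log 2 u.length) (T.cell (NTree.flat u))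

theorem exists_ty {ω τ : ℝ} {h : ℕ} {w : List (Fin h → Bool)} (hw : w ≠ [])
    (h0 : D.InE ω τ w.length 0 (T.cell (NTree.flat w))) :
    ∃ p, 1 ≤ p ∧ p ≤ w.length ∧ D.Ty ω τ p w := by
  have hl : w.length ≠ 0 := by simpa using hw
  by_cases hJ : D.InE ω τ w.length (Nat.log 2 w.length) (T.cell (NTree.flat w))
  · exact ⟨w.length, by omega, le_rfl, Or.inr ⟨rfl, hJ⟩⟩
  have hex : ∃ j, j < Nat.log 2 w.length ∧ D.InE ω τ w.length j (T.cell (NTree.flat w)) ∧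
      ¬ D.InE ω τ w.length (j + 1) (T.cell (NTree.flat w)) := by
    by_contra! hcon
    refine hJ ?_
    have : ∀ j ≤ Nat.log 2 w.length, D.InE ω τ w.length j (T.cell (NTree.flat w)) := by
      intro j
      induction j with
      | zero => exact fun _ => h0
      | succ j ih => exact fun hj => hcon j (by omega) (ih (by omega))
    exact this _ le_rfl
  obtain ⟨j, hj, h1, h2⟩ := hex
  exact ⟨2 ^ j, Nat.one_le_two_pow, (Nat.pow_le_pow_right (by norm_num) hj.le).trans
    (Nat.pow_log_le_self 2 hl), Or.inl ⟨j, rfl, hj, h1, h2⟩⟩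

theorem ty_count {K α ω τ c₀ Q : ℝ} {h : ℕ} (hK : 1 ≤ K) (hα : 0 < α)
    (hcount : ∀ (t lam σ ρ X : ℝ) (w : List Bool) (n : ℕ), 0 < σ →
      1 ≤ σ ^ Fintype.card I * Real.exp lam → 0 < ρ → ρ ≤ 1 → 0 < X →
      (∀ V, ⊥ < V → V < ⊤ → ¬ SmallOn (D.P t lam) σ (T.cell w) V ρ) →
      csum (ind fun u => D.Contracted t lam X (T.cell u)) n w ≤
        K * (σ * X / ρ) ^ α * 2 ^ n)
    (hlen1 : T.len ≤ 1) (hlenB : T.len * (2 * D.B ^ 3 * Fintype.card I) ≤ 1)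
    (hω : ω = D.r₀ / 8) (hτ : 0 < τ) (hτh : τ * (1 - D.ω D.e) = h * Real.log T.q)
    (hR2 : 6 * Fintype.card I ≤ Real.exp (ω * τ / Fintype.card I))
    (hR3 : (Fintype.card I).factorial * D.wd T.len * Real.exp (-(D.r₀ * τ / 2)) <
      (1 / (3 * Fintype.card I : ℝ)) ^ Fintype.card I)
    (hc₀ : 0 < c₀) (hc₁ : c₀ ≤ 1) (hc : c₀ < D.c₃ / D.bd)
    (hQ : 6 * Fintype.card I ≤ Q) (hQ' : 1 / c₀ ≤ Q)
    {w : List (Fin h → Bool)} {p : ℕ} (hp : 1 ≤ p)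
    (hrm : w ≠ [] → ¬ D.InE ω τ w.length 0 (T.cell (NTree.flat w))) :
    csum (ind (D.Ty ω τ p)) p w ≤
      2 * (K * (Q * Real.exp (-(ω * p * τ / (4 * Fintype.card I)))) ^ α) * 2 ^ (h * p) := by
  have hm := D.card_pos
  have hr₀ := D.r₀_pos
  have hω0 : 0 < ω := by linarith
  have hp0 : (1 : ℝ) ≤ p := by exact_mod_cast hp
  set R := K * (Q * Real.exp (-(ω * p * τ / (4 * Fintype.card I)))) ^ α * 2 ^ (h * p) with hR
  have hQ0 : 0 < Q := by linarith
  have hR0 : 0 ≤ R := by positivity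
  rw [show 2 * (K * (Q * Real.exp (-(ω * p * τ / (4 * Fintype.card I)))) ^ α) * 2 ^ (h * p) =
    R + R by rw [hR]; ring]
  refine (csum_mono (g := fun u => ind (fun u => ∃ j, p = 2 ^ j ∧ j < Nat.log 2 u.length ∧
      D.InE ω τ u.length j (T.cell (NTree.flat u)) ∧
      ¬ D.InE ω τ u.length (j + 1) (T.cell (NTree.flat u))) u +
      ind (fun u => p = u.length ∧
        D.InE ω τ u.length (Nat.log 2 u.length) (T.cell (NTree.flat u))) u) p w
      fun u _ _ => ind_or_le _ _ u).trans ?_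
  rw [csum_add]
  refine add_le_add ?_ ?_
  · by_cases hex : ∃ u, w <:+ u ∧ u.length = w.length + p ∧
      ∃ j, p = 2 ^ j ∧ j < Nat.log 2 u.length ∧
      D.InE ω τ u.length j (T.cell (NTree.flat u)) ∧
      ¬ D.InE ω τ u.length (j + 1) (T.cell (NTree.flat u))
    swap
    · rw [csum_eq_zero_of]
      · exact hR0
      · intro u h1 h2 h3; exact hex ⟨u, h1, h2, h3⟩
    obtain ⟨u₀, -, hl, j, hj, hlog, -⟩ := hex
    have h2 : 2 ^ (j + 1) ≤ w.length + 2 ^ j := by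
      rw [hl, hj] at hlog
      refine (Nat.pow_le_pow_right (by norm_num) (Nat.succ_le_of_lt hlog)).trans
        (Nat.pow_log_le_self 2 ?_)
      have := Nat.one_le_two_pow (n := j)
      omega
    have h3 : 2 ^ j ≤ w.length := by rw [pow_succ] at h2; omega
    have hw : w ≠ [] := by
      rintro rfl
      have := Nat.one_le_two_pow (n := j)
      simp at h3
    have key := D.window_count hK hcount hlen1 hlenB hω hτ hτh hR2 hR3
      (NTree.flat_length w) h3 (hrm hw)
    rw [← hj, ← NTree.csum_flat] at key
    refine (csum_mono _ _ fun u hu hul => ?_).trans (key.trans ?_)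
    · by_cases hP : ∃ j, p = 2 ^ j ∧ j < Nat.log 2 u.length ∧
        D.InE ω τ u.length j (T.cell (NTree.flat u)) ∧
        ¬ D.InE ω τ u.length (j + 1) (T.cell (NTree.flat u))
      · rw [ind_of (P := fun u : List (Fin h → Bool) => ∃ j, p = 2 ^ j ∧ j < Nat.log 2 u.length ∧
          D.InE ω τ u.length j (T.cell (NTree.flat u)) ∧
          ¬ D.InE ω τ u.length (j + 1) (T.cell (NTree.flat u))) hP]
        obtain ⟨j', hj', -, h5, h6⟩ := hP
        obtain rfl : j' = j := Nat.pow_right_injective le_rfl (hj'.symm.trans hj)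
        rw [ind_of]
        rw [← hul]
        exact ⟨h5, h6⟩
      · exact (ind_of_not hP).le.trans (ind_nonneg _ _)
    · rw [hR]
      have hpj : (2 : ℝ) ^ j = p := by rw [hj]; push_cast; rfl
      rw [hpj]
      gcongr
      norm_num
  · by_cases hw : w = []
    swap
    · rw [csum_eq_zero_of]
      · exact hR0
      · rintro u - h2 ⟨h3, -⟩
        have : w.length ≠ 0 := by simpa using hw
        omega
    subst hw
    have h3 : 2 ^ Nat.log 2 p ≤ p := Nat.pow_log_le_self 2 (by omega)
    have h4 : p < 2 ^ (Nat.log 2 p + 1) := Nat.lt_pow_succ_log_self (by norm_num) p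
    have h4' : (p : ℝ) ≤ 2 * 2 ^ Nat.log 2 p := by
      have : (p : ℝ) ≤ 2 ^ (Nat.log 2 p + 1) := by exact_mod_cast h4.le
      rw [pow_succ] at this
      linarith
    have key := D.top_count (i := p) (j := Nat.log 2 p) (h := h) hcount hc₀ hc₁ hc hω0
      (by linarith) hτ h3
    change csum _ (h * p) (NTree.flat (h := h) []) ≤ _ at key
    rw [← NTree.csum_flat] at key
    refine (csum_mono _ _ fun u hu hul => ?_).trans (key.trans ?_)
    · have hul' : u.length = p := by simpa using hul
      by_cases hP : p = u.length ∧
        D.InE ω τ u.length (Nat.log 2 u.length) (T.cell (NTree.flat u))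
      · have h5 := hP.2
        rw [hul'] at h5
        exact (ind_le_one _ _).trans (ind_of (P := fun v => D.InE ω τ p (Nat.log 2 p) (T.cell v)) h5).ge
      · exact (ind_of_not hP).le.trans (ind_nonneg _ _)
    · rw [hR]
      gcongr ?_ * (?_ * Real.exp ?_) ^ _ * _
      rw [neg_le_neg_iff, div_le_div_iff₀ (by positivity) (by positivity)]
      have : ω * p * τ ≤ ω * (2 * 2 ^ Nat.log 2 p) * τ := by gcongr
      nlinarith
theorem lower_bound_of_levels (hlen1 : T.len ≤ 1)
    (hlenB : T.len * (2 * D.B ^ 3 * Fintype.card I) ≤ 1) {ω τ : ℝ} (hω0 : 0 < ω) (hω1 : ω ≤ 1)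
    (hτ : 0 < τ) {x : ℝ}
    (hx : ∀ i : ℕ, 1 ≤ i → ∃ a b, b - a = T.len * Real.exp (i * τ * (D.ω D.e - 1)) ∧
      Icc a b ⊆ T.cell [] ∧ x ∈ Icc a b ∧ ¬ D.InE ω τ i 0 (Icc a b)) {t : ℝ} (ht : 0 ≤ t)
    {v : I → ℤ} (hv : v ≠ 0) :
    ∃ i, Real.exp (-(τ + ω * τ)) / 3 < |(D.P t 0 x).mulVec (fun i => (v i : ℝ)) i| := by
  set i := ⌊t / τ⌋₊ + 1 with hi
  have hi1 : t ≤ i * τ := by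
    have := (Nat.lt_floor_add_one (t / τ)).le
    rw [div_le_iff₀ hτ] at this
    simpa [hi] using this
  have hi2 : i * τ ≤ t + τ := by
    have := Nat.floor_le (div_nonneg ht hτ.le)
    rw [le_div_iff₀ hτ] at this
    rw [hi]; push_cast; linarith
  have hi3 : (1 : ℝ) ≤ i := by rw [hi]; push_cast; linarith [Nat.cast_nonneg (α := ℝ) ⌊t / τ⌋₊]
  obtain ⟨a, b, hab, hsub, hxab, hno⟩ := hx i (by omega)
  by_contra! hcon
  refine hno ⟨v, hv, fun y hy k => ?_⟩
  rw [pow_zero, mul_one]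
  have h1 : ∀ k, |(D.P (i * τ) (ω * τ) x).mulVec (fun i => (v i : ℝ)) k| ≤ 1 / 3 := by
    intro k
    have h2 := hcon k
    rw [D.P_mulVec, abs_mul] at h2 ⊢
    have h3 : |D.d (i * τ) (ω * τ) k| ≤ Real.exp (τ + ω * τ) * |D.d t 0 k| := by
      rw [d, d, Real.abs_exp, Real.abs_exp, ← Real.exp_add, Real.exp_le_exp]
      have hωk : D.ω k ≤ 1 := by
        by_cases h : k = D.o
        · rw [h, D.ω_o]
        · linarith [D.ω_le k h, D.r₀_pos]
      have h4 : (i * τ - t) * D.ω k ≤ τ := by nlinarith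
      split_ifs <;> nlinarith [mul_pos hω0 hτ]
    calc _ ≤ Real.exp (τ + ω * τ) * |D.d t 0 k| * |∑ l, D.M x k l * (v l : ℝ)| := by gcongr
      _ ≤ Real.exp (τ + ω * τ) * (Real.exp (-(τ + ω * τ)) / 3) := by
        rw [mul_assoc]; gcongr
      _ = 1 / 3 := by rw [← mul_div_assoc, ← Real.exp_add]; simp
  have h5 := D.P_mulVec_stable (convex_Icc _ _) (hsub hxab) (hsub hy) (ℓ := T.len)
    (by nlinarith) (by positivity) T.len_pos.le hlen1 hlenB (by
      rw [← hab, abs_le]; constructor <;> linarith [hxab.1, hxab.2, hy.1, hy.2]) h1 k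
  refine h5.trans ?_
  have : 1 ≤ Real.exp (ω * τ / (2 * Fintype.card I)) := Real.one_le_exp (by positivity)
  linarith

/-- A gap tree contains a gap tree on whose limit set no integer vector is contracted by the
flow. -/
theorem exists_homogeneous_subtree (hT : T.IsGap) {C : ℝ} {κ : ℕ} (hκ : 1 ≤ κ) (hC : 1 ≤ C)
    (hsg : ∀ k ≤ Fintype.card I, ∀ (Z : Matrix I (Fin k) ℤ) S (a : ℝ),
      SepGood C κ (fun x => a * minor (D.M x * Z.map (Int.cast : ℤ → ℝ)) S) (T.cell []))
    (hlen1 : T.len ≤ 1) (hlenB : T.len * (2 * D.B ^ 3 * Fintype.card I) ≤ 1) :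
    ∃ T' : NTree Bool, T'.IsGap ∧ T'.Sub T ∧ ∃ c > 0, ∀ x ∈ T'.lim, ∀ t : ℝ, 0 ≤ t →
      ∀ v : I → ℤ, v ≠ 0 → ∃ i, c < |(D.P t 0 x).mulVec (fun i => (v i : ℝ)) i| := by
  obtain ⟨K, hK, α, hα, hcount⟩ := D.exists_count hT hκ hC hsg
  have hm := D.card_pos
  set m := (Fintype.card I : ℝ) with hmdef
  have hr₀ := D.r₀_pos
  have hbd := D.one_le_bd
  have hc₃ := D.c₃_pos
  set c₀ := min (D.c₃ / D.bd) 1 / 2 with hc₀def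
  have hmin : 0 < min (D.c₃ / D.bd) 1 := lt_min (by positivity) one_pos
  have hc₀ : 0 < c₀ := by positivity
  have hc₁ : c₀ ≤ 1 := by have := min_le_right (D.c₃ / D.bd) 1; linarith
  have hc : c₀ < D.c₃ / D.bd := by have := min_le_left (D.c₃ / D.bd) 1; linarith
  set Q := max (6 * m) (1 / c₀) with hQdef
  have hQ : 6 * m ≤ Q := le_max_left _ _
  have hQ' : 1 / c₀ ≤ Q := le_max_right _ _
  have hQ0 : 0 < Q := by linarith
  set ω := D.r₀ / 8 with hω
  have hω0 : 0 < ω := by positivity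
  have hω1 : ω ≤ 1 := by linarith [D.ω_e_le, D.neg_one_le_ω_e]
  set A := 2 * (K * Q ^ α) with hA
  have hA0 : 0 < A := by positivity
  have hq : 0 < Real.log T.q := Real.log_pos (by linarith [T.two_le])
  have hωe : 0 < 1 - D.ω D.e := by linarith [D.ω_e_le]
  set τ₀ := Real.log T.q / (1 - D.ω D.e) with hτ₀
  have hτ₀0 : 0 < τ₀ := by positivity
  have hwd := D.one_le_wd T.len_pos hlen1
  obtain ⟨N₁, hN₁⟩ := exists_nat_exp_neg_lt (c := α * (ω * τ₀ / (4 * m)))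
    (θ := 1 / (4 * (1 + A))) (by positivity) (by positivity)
  obtain ⟨N₂, hN₂⟩ := exists_nat_exp_neg_lt (c := ω * τ₀ / m)
    (θ := 1 / (6 * m)) (by positivity) (by positivity)
  obtain ⟨N₃, hN₃⟩ := exists_nat_exp_neg_lt (c := D.r₀ * τ₀ / 2)
    (θ := (1 / (3 * m)) ^ Fintype.card I / ((Fintype.card I).factorial * D.wd T.len))
    (by positivity) (by positivity)
  set h := N₁ + N₂ + N₃ + 1 with hh
  set τ := τ₀ * h with hτdef
  have hh0 : (0 : ℝ) < h := by rw [hh]; push_cast; positivity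
  have hτ : 0 < τ := by positivity
  have hτh : τ * (1 - D.ω D.e) = h * Real.log T.q := by rw [hτdef, hτ₀]; field_simp
  have hR1 : 4 * Real.exp (-(ω * τ / (4 * m))) ^ α * (1 + A) ≤ 1 := by
    have := (hN₁ h (by omega)).le
    rw [le_div_iff₀ (by positivity)] at this
    rw [← Real.exp_mul]
    refine (le_of_eq ?_).trans this
    rw [hτdef, show -(ω * (τ₀ * h) / (4 * m)) * α = -(α * (ω * τ₀ / (4 * m)) * h) by ring]
    ring
  have hR2 : 6 * m ≤ Real.exp (ω * τ / m) := by
    have := (hN₂ h (by omega)).le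
    rw [Real.exp_neg, ← one_div, one_div_le_one_div (Real.exp_pos _) (by positivity)] at this
    refine this.trans (le_of_eq ?_)
    rw [hτdef]; ring_nf
  have hR3 : (Fintype.card I).factorial * D.wd T.len * Real.exp (-(D.r₀ * τ / 2)) <
      (1 / (3 * m)) ^ Fintype.card I := by
    have := hN₃ h (by omega)
    rw [lt_div_iff₀ (by positivity)] at this
    refine (le_of_eq ?_).trans_lt this
    rw [mul_comm, hτdef]
    congr 3
    ring
  have hh1 : 1 ≤ h := by omega
  obtain ⟨alive, hal, halive⟩ := exists_alive (β := Fin h → Bool)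
    (fun w => w ≠ [] ∧ D.InE ω τ w.length 0 (T.cell (NTree.flat w))) (D.Ty ω τ)
    (fun _ p => A * (Real.exp (-(ω * τ / (4 * m))) ^ α) ^ p) (by simp)
    (fun w hw => D.exists_ty hw.1 hw.2)
    (fun w p hp hw => by
      refine (D.ty_count hK hα hcount hlen1 hlenB hω hτ hτh hR2 hR3 hc₀ hc₁ hc hQ hQ' hp
        fun h1 h2 => hw w List.suffix_rfl ⟨h1, h2⟩).trans (le_of_eq ?_)
      rw [Real.mul_rpow hQ0.le (Real.exp_pos _).le, hA, ← Real.exp_mul, ← Real.exp_mul,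
        ← Real.exp_nat_mul]
      simp only [Fintype.card_pi, Fintype.card_bool, Finset.prod_const, Finset.card_univ,
          Fintype.card_fin, Nat.cast_pow, Nat.cast_ofNat, pow_mul]
      rw [show -(ω * p * τ / (4 * Fintype.card I)) * α = p * (-(ω * τ / (4 * m)) * α) by
        rw [← hmdef]; ring]
      ring)
    (fun _ _ => by positivity)
    (fun i => by
      have := mul_sum_pow_le_one (A := A) (x := 4 * Real.exp (-(ω * τ / (4 * m))) ^ α)
        (by positivity) hR1 i
      refine (Finset.sum_congr rfl fun p _ => ?_).trans_le this
      rw [mul_pow]; ring)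
  obtain ⟨T', hT', -, -, hcells⟩ := hT.exists_subtree hh1 alive hal fun w hw => (halive w hw).2
  refine ⟨T', hT', (NTree.sub_of_cells hcells).trans (T.block_sub hh1), Real.exp (-(τ + ω * τ)) / 3,
    by positivity, fun x hx t ht v hv => ?_⟩
  refine D.lower_bound_of_levels hlen1 hlenB hω0 hω1 hτ (fun i hi => ?_) ht hv
  obtain ⟨w, hw, hxw⟩ := hx i
  obtain ⟨u, hu, hua, huc⟩ := hcells w
  rw [huc, T.block_cell] at hxw
  have hlen : (NTree.flat u).length = h * i := by rw [NTree.flat_length, hu, hw]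
  refine ⟨_, _, ?_, T.cell_subset_of_suffix List.nil_suffix, hxw, fun hE => (halive u hua).1 ⟨?_, ?_⟩⟩
  · rw [add_sub_cancel_left, cell_len T hτh hlen]
  · rintro rfl; simp at hu; omega
  · rw [hu, hw]; exact hE
end CurveData

namespace NTree

theorem tendsto_size {β : Type} (T : NTree β) : Tendsto T.size atTop (nhds 0) := by
  have h1 : Tendsto (fun n : ℕ => T.len * (T.q⁻¹) ^ n) atTop (nhds (T.len * 0)) :=
    (tendsto_pow_atTop_nhds_zero_of_lt_one (inv_nonneg.mpr T.q_pos.le)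
      (inv_lt_one_of_one_lt₀ (by linarith [T.two_le]))).const_mul _
  rw [mul_zero] at h1
  refine h1.congr fun n => ?_
  rw [size, inv_pow, div_eq_mul_inv]

theorem exists_cell_subset {β : Type} (T : NTree β) {x : ℝ} (hx : x ∈ T.lim) {s : Set ℝ}
    (hs : s ∈ nhds x) {θ : ℝ} (hθ : 0 < θ) :
    ∃ w, x ∈ T.cell w ∧ T.cell w ⊆ s ∧ T.size w.length ≤ θ := by
  obtain ⟨ε, hε, hεs⟩ := Metric.mem_nhds_iff.mp hs
  obtain ⟨n, hn⟩ := (T.tendsto_size.eventually (gt_mem_nhds (lt_min hε hθ))).exists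
  obtain ⟨w, hw, hxw⟩ := hx n
  refine ⟨w, hxw, fun y hy => hεs ?_, ?_⟩
  · rw [Metric.mem_ball, Real.dist_eq]
    have := T.abs_sub_le hy hxw
    rw [hw] at this
    linarith [min_le_left ε θ]
  · rw [hw]; linarith [min_le_right ε θ]

theorem IsGap.exists_lim_ne_zero {T : NTree Bool} (hT : T.IsGap) {U : Set ℝ}
    (hUc : IsPreconnected U) (hTU : T.cell [] ⊆ U) {h : ℝ → ℝ} (hh : AnalyticOnNhd ℝ h U)
    (hne : ∃ x ∈ U, h x ≠ 0) : ∃ x ∈ T.lim, h x ≠ 0 := by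
  obtain ⟨x, -, hx⟩ := T.exists_mem_lim []
  have hxU := hTU (T.mem_cell_nil_of_mem_lim hx)
  rcases (hh x hxU).eventually_eq_zero_or_eventually_ne_zero with h0 | h0
  · obtain ⟨y, hyU, hy⟩ := hne
    exact absurd (hh.eqOn_zero_of_preconnected_of_eventuallyEq_zero hUc hxU h0 hyU) hy
  rw [eventually_nhdsWithin_iff] at h0
  obtain ⟨w, -, hws, -⟩ := T.exists_cell_subset hx h0 one_pos
  obtain ⟨y, hy, hyl⟩ := T.exists_mem_lim (false :: w)
  obtain ⟨z, hz, hzl⟩ := T.exists_mem_lim (true :: w)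
  have hyz : y < z := by
    have h1 := hT w
    have h2 := hy.2
    have h3 := hz.1
    have h4 := T.size_pos (w.length + 1)
    simp only [List.length_cons] at h2
    linarith
  by_cases hyx : y = x
  · exact ⟨z, hzl, hws (T.cell_cons_subset _ _ hz) (by rw [← hyx]; exact hyz.ne')⟩
  · exact ⟨y, hyl, hws (T.cell_cons_subset _ _ hy) hyx⟩

end NTree

theorem SepGood.mono {C : ℝ} {k : ℕ} {f : ℝ → ℝ} {s t : Set ℝ} (h : SepGood C k f t)
    (hst : s ⊆ t) : SepGood C k f s :=
  fun a b hab hs => h a b hab (hs.trans hst)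

theorem exists_sup_ge_of_linearIndependent {I : Type*} [Fintype I] {g : I → ℝ → ℝ} {a b : ℝ}
    (hg : ∀ i, ContinuousOn (g i) (Icc a b))
    (hind : ∀ c : I → ℝ, (∀ x ∈ Icc a b, ∑ i, c i * g i x = 0) → c = 0) :
    ∃ c₃ > 0, ∀ c : I → ℤ, c ≠ 0 → ∃ x ∈ Icc a b, c₃ ≤ |∑ i, (c i : ℝ) * g i x| := by
  let L : (I → ℝ) →ₗ[ℝ] C(Icc a b, ℝ) :=
    { toFun := fun c => ⟨fun x => ∑ i, c i * g i x,
        continuous_finsetSum _ fun i _ => continuous_const.mul (hg i).domRestrict⟩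
      map_add' := fun c c' => by ext x; simp [add_mul, Finset.sum_add_distrib]
      map_smul' := fun r c => by ext x; simp [Finset.mul_sum, mul_assoc] }
  have hL : ∀ c x, L c x = ∑ i, c i * g i x := fun _ _ => rfl
  obtain ⟨K, hK, hanti⟩ := L.exists_antilipschitzWith (by
    rw [LinearMap.ker_eq_bot']
    intro c hc
    refine hind c fun x hx => ?_
    have := hL c ⟨x, hx⟩
    rw [hc] at this
    exact this.symm)
  have hK' : (0 : ℝ) < K := hK
  refine ⟨1 / (2 * K), by positivity, fun c hc => ?_⟩
  by_contra! hcon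
  have h1 : ‖L fun i => (c i : ℝ)‖ ≤ 1 / (2 * K) := by
    rw [ContinuousMap.norm_le _ (by positivity)]
    intro x
    rw [hL, Real.norm_eq_abs]
    exact (hcon x x.2).le
  have h2 := hanti.le_mul_dist (fun i => (c i : ℝ)) 0
  rw [map_zero, dist_zero_right, dist_zero_right] at h2
  obtain ⟨i, hi⟩ := Function.ne_iff.mp hc
  have h3 : (1 : ℝ) ≤ ‖fun i => (c i : ℝ)‖ := by
    refine le_trans ?_ (norm_le_pi_norm _ i)
    rw [Real.norm_eq_abs]
    exact_mod_cast Int.one_le_abs hi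
  have h4 : (K : ℝ) * (1 / (2 * K)) = 1 / 2 := by field_simp
  nlinarith [mul_le_mul_of_nonneg_left h1 hK'.le]

theorem linearIndependent_on_Icc {I : Type*} [Fintype I] {g : I → ℝ → ℝ} {U : Set ℝ}
    (hUc : IsPreconnected U) (hg : ∀ i, AnalyticOnNhd ℝ (g i) U)
    (hind : ∀ c : I → ℝ, (∀ x ∈ U, ∑ i, c i * g i x = 0) → c = 0) {a b : ℝ} (hab : a < b)
    (hs : Icc a b ⊆ U) (c : I → ℝ) (hc : ∀ x ∈ Icc a b, ∑ i, c i * g i x = 0) : c = 0 := by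
  refine hind c ?_
  have hmid : (a + b) / 2 ∈ Ioo a b := ⟨by linarith, by linarith⟩
  have han : AnalyticOnNhd ℝ (fun x => ∑ i, c i * g i x) U :=
    fun x hx => AnalyticAt.sum_const_mul c fun i => hg i x hx
  refine han.eqOn_zero_of_preconnected_of_eventuallyEq_zero hUc
    (hs (Ioo_subset_Icc_self hmid)) ?_
  filter_upwards [isOpen_Ioo.mem_nhds hmid] with x hx
  exact hc x (Ioo_subset_Icc_self hx)

theorem exists_bound_family {I : Type*} [Fintype I] {g : I → ℝ → ℝ} {s : Set ℝ} (hs : IsCompact s)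
    (hg : ∀ i, ContinuousOn (g i) s) : ∃ B : ℝ, ∀ i, ∀ x ∈ s, |g i x| ≤ B := by
  choose C hC using fun i => hs.exists_bound_of_continuousOn (hg i)
  refine ⟨∑ i, |C i|, fun i x hx => (hC i x hx).trans ((le_abs_self _).trans ?_)⟩
  exact Finset.single_le_sum (f := fun i => |C i|) (fun _ _ => abs_nonneg _) (Finset.mem_univ i)

theorem exists_sepGood_minor {I : Type*} [Fintype I] {A : ℝ → Matrix I I ℝ} {x₀ : ℝ}
    (hA : ∀ i l, AnalyticAt ℝ (fun x => A x i l) x₀) :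
    ∃ δ > 0, ∃ κ : ℕ, 1 ≤ κ ∧ ∃ C : ℝ, 1 ≤ C ∧ ∀ k ≤ Fintype.card I,
      ∀ (Z : Matrix I (Fin k) ℤ) S (a : ℝ),
      SepGood C κ (fun x => a * minor (A x * Z.map (Int.cast : ℤ → ℝ)) S)
        (Icc (x₀ - δ) (x₀ + δ)) := by
  classical
  let J := Σ k : Fin (Fintype.card I + 1), (Fin k → I) × (Fin k → I)
  obtain ⟨δ, hδ, κ, hκ, C, hC, h⟩ := exists_sepGood
    (g := fun (j : J) x => ∏ a, A x (j.2.1 a) (j.2.2 a)) (x₀ := x₀)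
    (fun j => Finset.analyticAt_fun_prod _ fun a _ => hA _ _)
  refine ⟨δ, hδ, κ, hκ, C, hC, fun k hk Z S a => ?_⟩
  have := h fun j => if hj : (j.1 : ℕ) = k then
    if j.2.1 = fun b => S (Fin.cast hj b) then
      a * minor (Z.map (Int.cast : ℤ → ℝ)) (fun b => j.2.2 (Fin.cast hj.symm b)) else 0 else 0
  convert this using 2 with x
  symm
  rw [Fintype.sum_sigma, Finset.sum_eq_single ⟨k, by omega⟩]
  · rw [Fintype.sum_prod_type, Finset.sum_eq_single S]
    · rw [minor_mul]
      simp only [dite_true, Fin.cast_refl, id, if_true, Finset.mul_sum]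
      exact Finset.sum_congr rfl fun T _ => by ring
    · intro S' _ hS'
      refine Finset.sum_eq_zero fun T _ => ?_
      simp [hS']
    · simp
  · intro k' _ hk'
    refine Finset.sum_eq_zero fun T _ => ?_
    have : (k' : ℕ) ≠ k := fun h => hk' (Fin.ext h)
    simp [this]
  · simp

section
variable {ι : Type} [Fintype ι] [DecidableEq ι]

/-- A curve with the constant function `1` added. -/
def homog (f : ι → ℝ → ℝ) (i : Option ι) : ℝ → ℝ := i.elim (fun _ => 1) f

omit [Fintype ι] [DecidableEq ι] in
theorem analyticOnNhd_homog {f : ι → ℝ → ℝ} {U : Set ℝ} (hf : ∀ i, AnalyticOnNhd ℝ (f i) U)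
    (i : Option ι) : AnalyticOnNhd ℝ (homog f i) U := by
  cases i with
  | none => exact analyticOnNhd_const
  | some i => exact hf i

omit [DecidableEq ι] in
theorem homog_independent {f : ι → ℝ → ℝ} {U : Set ℝ}
    (hnd : ∀ (a : ℝ) (b : ι → ℝ), (∀ x ∈ U, a + ∑ k, b k * f k x = 0) → a = 0 ∧ b = 0)
    (c : Option ι → ℝ) (hc : ∀ x ∈ U, ∑ i, c i * homog f i x = 0) : c = 0 := by
  obtain ⟨h1, h2⟩ := hnd (c none) (fun i => c (some i)) fun x hx => by
    have := hc x hx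
    rw [Fintype.sum_option] at this
    simpa [homog] using this
  ext i
  cases i with
  | none => exact h1
  | some i => exact congrFun h2 i

theorem exists_deriv_ne_zero {f : ι → ℝ → ℝ} {U : Set ℝ} (hU : IsOpen U)
    (hUc : IsPreconnected U) (hf : ∀ i, AnalyticOnNhd ℝ (f i) U)
    (hnd : ∀ (a : ℝ) (b : ι → ℝ), (∀ x ∈ U, a + ∑ k, b k * f k x = 0) → a = 0 ∧ b = 0) (i : ι) :
    ∃ x ∈ U, deriv (f i) x ≠ 0 := by
  by_contra! hcon
  obtain ⟨a, ha⟩ := hU.exists_is_const_of_deriv_eq_zero hUc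
    (fun x hx => (hf i x hx).differentiableAt.differentiableWithinAt) hcon
  have := (hnd (-a) (Pi.single i 1) fun x hx => by
    rw [Finset.sum_eq_single i]
    · simp [ha x hx]
    · intro j _ hj; simp [hj]
    · simp).2
  simpa using congrFun this i

theorem exists_curveData {r : ι → ℝ} (hr : ∀ i, 0 < r i) (hr1 : ∑ i, r i = 1) {i₁ : ι}
    (hi₁ : ∀ i, r i ≤ r i₁) {U : Set ℝ} (hU : IsOpen U) (hUc : IsPreconnected U)
    {f : ι → ℝ → ℝ} (hf : ∀ i, AnalyticOnNhd ℝ (f i) U)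
    (hnd : ∀ (a : ℝ) (b : ι → ℝ), (∀ x ∈ U, a + ∑ k, b k * f k x = 0) → a = 0 ∧ b = 0)
    {T : NTree Bool} (hT : T.IsGap) (hTU : T.cell [] ⊆ U) :
    ∃ u, ∃ D : CurveData (Option ι) ((T.root u).cell []), D.o = none ∧ D.e = some i₁ ∧
      (∀ i, D.ω (some i) = -r i) ∧ D.g = homog f ∧ D.g1 = (fun i => deriv (homog f i)) ∧
      (∃ κ : ℕ, 1 ≤ κ ∧ ∃ C : ℝ, 1 ≤ C ∧ ∀ k ≤ Fintype.card (Option ι),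
        ∀ (Z : Matrix (Option ι) (Fin k) ℤ) S (a : ℝ),
        SepGood C κ (fun x => a * minor (D.M x * Z.map (Int.cast : ℤ → ℝ)) S)
          ((T.root u).cell [])) ∧
      (T.root u).len ≤ 1 ∧ (T.root u).len * (2 * D.B ^ 3 * Fintype.card (Option ι)) ≤ 1 := by
  have hg := analyticOnNhd_homog hf
  have hg1 : ∀ i, AnalyticOnNhd ℝ (deriv (homog f i)) U := fun i => (hg i).deriv
  have hg2 : ∀ i, AnalyticOnNhd ℝ (deriv (deriv (homog f i))) U := fun i => (hg1 i).deriv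
  have hcomp : IsCompact (T.cell []) := isCompact_Icc
  obtain ⟨x₀, hx₀, hd⟩ := hT.exists_lim_ne_zero hUc hTU (hg1 (some i₁))
    (exists_deriv_ne_zero hU hUc hf hnd i₁)
  have hx₀U := hTU (T.mem_cell_nil_of_mem_lim hx₀)
  obtain ⟨B₀, hB₀⟩ := exists_bound_family hcomp fun i => (hg i).continuousOn.mono hTU
  obtain ⟨B₁, hB₁⟩ := exists_bound_family hcomp fun i => (hg1 i).continuousOn.mono hTU
  obtain ⟨B₂, hB₂⟩ := exists_bound_family hcomp fun i => (hg2 i).continuousOn.mono hTU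
  set η := |deriv (homog f (some i₁)) x₀| with hη
  have hη0 : 0 < η := abs_pos.mpr hd
  set B := 1 + |B₀| + |B₁| + |B₂| + 2 / η with hB
  have hη2 : 0 < 2 / η := by positivity
  have hB1 : 1 ≤ B := by
    rw [hB]; linarith [abs_nonneg B₀, abs_nonneg B₁, abs_nonneg B₂]
  obtain ⟨δ, hδ, κ, hκ, C, hC, hsg⟩ := exists_sepGood_minor
    (A := fun x => (Matrix.of fun i l => if i = none then homog f l x else
      if i = some i₁ then deriv (homog f l) x else if i = l then 1 else 0 :
        Matrix (Option ι) (Option ι) ℝ)) (x₀ := x₀) (fun i l => by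
      simp only [Matrix.of_apply]
      split_ifs
      · exact hg l x₀ hx₀U
      · exact hg1 l x₀ hx₀U
      · exact analyticAt_const
      · exact analyticAt_const)
  have hnear : {x | η / 2 < |deriv (homog f (some i₁)) x|} ∈ nhds x₀ :=
    (hg1 (some i₁) x₀ hx₀U).continuousAt.abs.eventually (lt_mem_nhds (by linarith))
  have hcard : (1 : ℝ) ≤ Fintype.card (Option ι) := by exact_mod_cast Fintype.card_pos
  obtain ⟨u, -, hu, hlen⟩ := T.exists_cell_subset hx₀
    (inter_mem (Icc_mem_nhds (show x₀ - δ < x₀ by linarith) (show x₀ < x₀ + δ by linarith)) hnear)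
    (θ := 1 / (2 * B ^ 3 * Fintype.card (Option ι))) (by positivity)
  have hB3 : 1 ≤ B ^ 3 := one_le_pow₀ hB1
  have huT : T.cell u ⊆ T.cell [] := T.cell_subset_of_suffix List.nil_suffix
  have hcell : (T.root u).cell [] = T.cell u := T.root_cell u []
  have huU := huT.trans hTU
  obtain ⟨c₃, hc₃, hc₃'⟩ := exists_sup_ge_of_linearIndependent
    (fun i => (hg i).continuousOn.mono huU)
    (linearIndependent_on_Icc hUc hg (homog_independent hnd)
      (by linarith [T.size_pos u.length]) huU)
  have : Nonempty ι := ⟨i₁⟩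
  obtain ⟨i₀, hi₀⟩ := Finite.exists_min r
  let D : CurveData (Option ι) ((T.root u).cell []) :=
    { o := none
      e := some i₁
      hoe := by simp
      ω := fun i => i.elim 1 fun i => -r i
      ω_o := rfl
      ω_sum := by rw [Fintype.sum_option]; simp [hr1]
      r₀ := r i₀
      r₀_pos := hr i₀
      ω_le := by
        rintro (_ | i) hi
        · exact absurd rfl hi
        · simpa using hi₀ i
      ω_e := by
        rintro (_ | i)
        · simp only [Option.elim_none, Option.elim_some]; linarith [hr i₁]
        · simpa using hi₁ i
      g := homog f
      g1 := fun i => deriv (homog f i)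
      g2 := fun i => deriv (deriv (homog f i))
      hg := fun i x hx => (hg i x (huU (hcell ▸ hx))).differentiableAt.hasDerivAt
      hg1 := fun i x hx => (hg1 i x (huU (hcell ▸ hx))).differentiableAt.hasDerivAt
      g_o := fun _ _ => rfl
      g1_o := fun x _ => by simp [homog]
      g2_o := fun x _ => by simp [homog]
      B := B
      one_le_B := hB1
      g_le := fun i x hx => (hB₀ i x (huT (hcell ▸ hx))).trans (by
        rw [hB]; linarith [abs_nonneg B₀, abs_nonneg B₁, abs_nonneg B₂, le_abs_self B₀])
      g1_le := fun i x hx => (hB₁ i x (huT (hcell ▸ hx))).trans (by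
        rw [hB]; linarith [abs_nonneg B₀, abs_nonneg B₁, abs_nonneg B₂, le_abs_self B₁])
      g2_le := fun i x hx => (hB₂ i x (huT (hcell ▸ hx))).trans (by
        rw [hB]; linarith [abs_nonneg B₀, abs_nonneg B₁, abs_nonneg B₂, le_abs_self B₂])
      le_g1 := fun x hx => by
        have h1 : η / 2 < |deriv (homog f (some i₁)) x| := (hu (hcell ▸ hx)).2
        have h2 : 2 / η ≤ B := by
          rw [hB]; linarith [abs_nonneg B₀, abs_nonneg B₁, abs_nonneg B₂]
        calc (1 : ℝ) = 2 / η * (η / 2) := by field_simp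
          _ ≤ _ := by gcongr
      c₃ := c₃
      c₃_pos := hc₃
      nondeg := fun c hc => by
        obtain ⟨x, hx, h⟩ := hc₃' c hc
        exact ⟨x, hcell ▸ hx, h⟩ }
  refine ⟨u, D, rfl, rfl, fun _ => rfl, rfl, rfl, ⟨κ, hκ, C, hC, fun k hk Z S a => ?_⟩, ?_, ?_⟩
  · exact (hsg k hk Z S a).mono (hcell ▸ fun x hx => (hu hx).1)
  · refine hlen.trans ?_
    rw [div_le_one (by positivity)]
    nlinarith
  · have h1 : T.size u.length * (2 * B ^ 3 * Fintype.card (Option ι)) ≤ 1 := by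
      rwa [le_div_iff₀ (by positivity)] at hlen
    exact h1
end

section
variable {ι : Type} [Fintype ι]

/-- Pigeonhole: a short integer vector orthogonal to `p` modulo `q`. -/
theorem exists_short_vector [Nonempty ι] {X : ι → ℝ} (hX : ∀ i, 0 < X i) {q : ℤ} (hq : q ≠ 0)
    (hprod : |(q : ℝ)| ≤ ∏ i, X i) (p : ι → ℤ) :
    ∃ a : ι → ℤ, a ≠ 0 ∧ (∀ i, |(a i : ℝ)| ≤ X i) ∧ q ∣ ∑ i, a i * p i := by
  classical
  have : NeZero q.natAbs := ⟨by simpa using hq⟩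
  let F : (∀ i, Fin (⌊X i⌋₊ + 1)) → ZMod q.natAbs := fun a => ((∑ i, ((a i : ℕ) : ℤ) * p i : ℤ) :)
  have hcard : Fintype.card (ZMod q.natAbs) < Fintype.card (∀ i, Fin (⌊X i⌋₊ + 1)) := by
    rw [ZMod.card, Fintype.card_pi]
    simp only [Fintype.card_fin]
    have h1 : ∏ i, X i < ∏ i, ((⌊X i⌋₊ : ℝ) + 1) :=
      Finset.prod_lt_prod_of_nonempty (fun i _ => hX i) (fun i _ => Nat.lt_floor_add_one _)
        Finset.univ_nonempty
    have h2 : ((q.natAbs : ℕ) : ℝ) = |(q : ℝ)| := by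
      rw [← Int.cast_abs, Int.abs_eq_natAbs]; simp
    have h3 : ((q.natAbs : ℕ) : ℝ) < ((∏ i, (⌊X i⌋₊ + 1) : ℕ) : ℝ) := by
      rw [h2]; push_cast; linarith
    exact_mod_cast h3
  obtain ⟨a, b, hab, hF⟩ := Fintype.exists_ne_map_eq_of_card_lt F hcard
  refine ⟨fun i => ((b i : ℕ) : ℤ) - ((a i : ℕ) : ℤ), fun h0 => hab ?_, fun i => ?_, ?_⟩
  · ext i
    have := congrFun h0 i
    simp only [Pi.zero_apply] at this
    omega
  · have h1 : ∀ c : Fin (⌊X i⌋₊ + 1), ((c : ℕ) : ℝ) ≤ X i := fun c =>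
      (Nat.cast_le.mpr (Nat.le_of_lt_succ c.2)).trans (Nat.floor_le (hX i).le)
    push_cast
    rw [abs_le]
    constructor <;> linarith [h1 (a i), h1 (b i), Nat.cast_nonneg (α := ℝ) (a i : ℕ),
      Nat.cast_nonneg (α := ℝ) (b i : ℕ)]
  · have h1 := (ZMod.intCast_eq_intCast_iff_dvd_sub _ _ _).mp hF
    rw [Int.natAbs_dvd, ← Finset.sum_sub_distrib] at h1
    simpa [sub_mul] using h1

theorem transference {r : ι → ℝ} (hr : ∀ i, 0 < r i) (hr1 : ∑ i, r i = 1) {i₁ : ι}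
    (hi₁ : ∀ i, r i ≤ r i₁) {c B : ℝ} (hc : 0 < c) (hB : 1 ≤ B) :
    ∃ c' > 0, ∀ y y1 : ι → ℝ, (∀ i, |y1 i| ≤ B) →
      (∀ t : ℝ, 0 ≤ t → ∀ (a₀ : ℤ) (a : ι → ℤ), a ≠ 0 →
        c < Real.exp t * |a₀ + ∑ i, y i * (a i : ℝ)| ∨
        c < Real.exp (-(t * r i₁)) * |∑ i, y1 i * (a i : ℝ)| ∨
        ∃ i, c < Real.exp (-(t * r i)) * |(a i : ℝ)|) →
      ∀ q : ℤ, q ≠ 0 → ∀ p : ι → ℤ, ∃ i, c' * |(q : ℝ)| ^ (-r i) < |q * y i - p i| := by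
  have hne : Nonempty ι := ⟨i₁⟩
  set n := (Fintype.card ι : ℝ) with hn
  have hn1 : 1 ≤ n := by rw [hn]; exact_mod_cast Fintype.card_pos
  set ε := min 1 (c / (n * B)) with hε
  have hε0 : 0 < ε := lt_min one_pos (by positivity)
  have hε1 : ε ≤ 1 := min_le_left _ _
  have hεc : n * B * ε ≤ c := by
    have := min_le_right 1 (c / (n * B))
    rw [← hε, le_div_iff₀ (by positivity)] at this
    linarith
  have hεc' : ε ≤ c := by nlinarith [mul_le_mul hn1 hB zero_le_one (by linarith)]
  set E := ε ^ Fintype.card ι with hE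
  have hE0 : 0 < E := by positivity
  have hE1 : E ≤ 1 := pow_le_one₀ hε0.le hε1
  refine ⟨c * E ^ 2 / n, by positivity, fun y y1 hy1 hdual q hq p => ?_⟩
  by_contra! hcon
  have hq1 : 1 ≤ |(q : ℝ)| := by exact_mod_cast Int.one_le_abs hq
  have hq0 : 0 < |(q : ℝ)| := by linarith
  set Q := |(q : ℝ)| with hQ
  set t := Real.log (Q / E) with ht
  have hQE : 1 ≤ Q / E := by rw [le_div_iff₀ hE0]; linarith
  have ht0 : 0 ≤ t := Real.log_nonneg hQE
  have hexp : Real.exp t = Q / E := Real.exp_log (by positivity)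
  have hri : ∀ i, r i ≤ 1 := fun i => by
    rw [← hr1]; exact Finset.single_le_sum (f := r) (fun j _ => (hr j).le) (Finset.mem_univ i)
  have hexpr : ∀ i, Real.exp (t * r i) ≤ Q ^ r i / E := fun i => by
    rw [Real.exp_mul, hexp, Real.div_rpow hq0.le hE0.le]
    have : E ≤ E ^ r i := by
      conv_lhs => rw [← Real.rpow_one E]
      exact Real.rpow_le_rpow_of_exponent_ge hE0 hE1 (hri i)
    gcongr
  obtain ⟨a, ha0, haX, k, hk⟩ := exists_short_vector (X := fun i => ε * Real.exp (t * r i))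
    (fun i => by positivity) hq (by
      rw [Finset.prod_mul_distrib, Finset.prod_const, Finset.card_univ, ← Real.exp_sum,
        ← Finset.mul_sum, hr1, mul_one, hexp, ← hE]
      exact le_of_eq (by rw [mul_div_cancel₀ _ hE0.ne'])) p
  have hkR : ∑ i, (a i : ℝ) * p i = q * k := by exact_mod_cast hk
  have hexpn : ∀ i, Real.exp (-(t * r i)) * Real.exp (t * r i) = 1 := fun i => by
    rw [← Real.exp_add]; simp
  rcases hdual t ht0 (-k) a ha0 with h | h | ⟨i, h⟩
  · have hform : (q : ℝ) * (((-k : ℤ) : ℝ) + ∑ i, y i * (a i : ℝ)) =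
        ∑ i, (a i : ℝ) * (q * y i - p i) := by
      simp only [mul_sub, Finset.sum_sub_distrib]
      rw [hkR, mul_add, Finset.mul_sum]
      push_cast
      have : ∀ i, (q : ℝ) * (y i * a i) = a i * (q * y i) := fun i => by ring
      simp only [this]
      ring
    have hbound : Q * |((-k : ℤ) : ℝ) + ∑ i, y i * (a i : ℝ)| ≤ ε * c * E := by
      rw [hQ, ← abs_mul, hform]
      refine (Finset.abs_sum_le_sum_abs _ _).trans ?_
      calc _ ≤ ∑ _i : ι, ε * c * E / n := Finset.sum_le_sum fun i _ => by
            rw [abs_mul]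
            calc _ ≤ (ε * (Q ^ r i / E)) * (c * E ^ 2 / n * Q ^ (-r i)) := by
                  refine mul_le_mul ((haX i).trans ?_) (hcon i) (abs_nonneg _) (by positivity)
                  gcongr
                  exact hexpr i
              _ = ε * c * E / n * (Q ^ r i * Q ^ (-r i)) := by field_simp
              _ = _ := by rw [← Real.rpow_add hq0]; simp
        _ = _ := by
          rw [Finset.sum_const, Finset.card_univ, nsmul_eq_mul, ← hn]; field_simp
    rw [hexp, div_mul_eq_mul_div, lt_div_iff₀ hE0] at h
    have : ε * c * E ≤ 1 * c * E := by gcongr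
    linarith
  · have h2 : |∑ i, y1 i * (a i : ℝ)| ≤ n * B * ε * Real.exp (t * r i₁) := by
      refine (Finset.abs_sum_le_sum_abs _ _).trans ?_
      calc _ ≤ ∑ _i : ι, B * (ε * Real.exp (t * r i₁)) := Finset.sum_le_sum fun i _ => by
            rw [abs_mul]
            refine mul_le_mul (hy1 i) ((haX i).trans ?_) (abs_nonneg _) (by linarith)
            have := hi₁ i
            gcongr
        _ = _ := by rw [Finset.sum_const, Finset.card_univ, nsmul_eq_mul, ← hn]; ring
    have h3 := mul_le_mul_of_nonneg_left h2 (Real.exp_pos (-(t * r i₁))).le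
    have h4 : Real.exp (-(t * r i₁)) * (n * B * ε * Real.exp (t * r i₁)) = n * B * ε := by
      linear_combination (n * B * ε) * hexpn i₁
    linarith
  · have h3 := mul_le_mul_of_nonneg_left (haX i) (Real.exp_pos (-(t * r i))).le
    have h4 : Real.exp (-(t * r i)) * (ε * Real.exp (t * r i)) = ε := by
      linear_combination ε * hexpn i
    linarith

theorem exists_homogeneous [DecidableEq ι] {r : ι → ℝ} (hr : ∀ i, 0 < r i) (hr1 : ∑ i, r i = 1)
    {i₁ : ι} (hi₁ : ∀ i, r i ≤ r i₁) {U : Set ℝ} (hU : IsOpen U) (hUc : IsPreconnected U)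
    {f : ι → ℝ → ℝ} (hf : ∀ i, AnalyticOnNhd ℝ (f i) U)
    (hnd : ∀ (a : ℝ) (b : ι → ℝ), (∀ x ∈ U, a + ∑ k, b k * f k x = 0) → a = 0 ∧ b = 0)
    {T : NTree Bool} (hT : T.IsGap) (hTU : T.cell [] ⊆ U) :
    ∃ T' : NTree Bool, T'.IsGap ∧ T'.Sub T ∧ ∃ B : ℝ, 1 ≤ B ∧
      (∀ x ∈ T'.cell [], 1 ≤ B * |deriv (f i₁) x| ∧ ∀ i, |deriv (f i) x| ≤ B) ∧
      ∃ c > 0, ∀ x ∈ T'.lim, ∀ q : ℤ, q ≠ 0 → ∀ p : ι → ℤ,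
        ∃ i, c * |(q : ℝ)| ^ (-r i) < |q * f i x - p i| := by
  obtain ⟨u, D, ho, he, hω, hg, hg1, ⟨κ, hκ, C, hC, hsg⟩, hlen, hlenB⟩ :=
    exists_curveData hr hr1 hi₁ hU hUc hf hnd hT hTU
  obtain ⟨T', hT', hsub, c, hc, hdual⟩ :=
    D.exists_homogeneous_subtree (hT.root u) hκ hC hsg hlen hlenB
  have hcell : T'.cell [] ⊆ (T.root u).cell [] := by
    obtain ⟨u', -, hu'⟩ := hsub []
    exact hu'.trans ((T.root u).cell_subset_of_suffix List.nil_suffix)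
  obtain ⟨c', hc', h⟩ := transference hr hr1 hi₁ hc D.one_le_B
  have hderiv : ∀ i x, D.g1 (some i) x = deriv (f i) x := fun i x => by rw [hg1]; rfl
  have hDb : ∀ x ∈ T'.cell [], ∀ i, |deriv (f i) x| ≤ D.B := fun x hx i => by
    rw [← hderiv]; exact D.g1_le _ x (hcell hx)
  refine ⟨T', hT', hsub.trans (T.root_sub u), D.B, D.one_le_B, fun x hx => ⟨?_, hDb x hx⟩, c', hc',
    fun x hx => h (fun i => f i x) (fun i => deriv (f i) x)
      (hDb x (T'.mem_cell_nil_of_mem_lim hx)) fun t ht a₀ a ha => ?_⟩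
  · rw [← hderiv, ← he]; exact D.le_g1 x (hcell hx)
  · have hxT := hcell (T'.mem_cell_nil_of_mem_lim hx)
    obtain ⟨i, hi⟩ := hdual x hx t ht (fun i => i.elim a₀ a) (fun h0 => ha (by
      ext i; exact congrFun h0 (some i)))
    rw [D.P_mulVec, abs_mul, CurveData.d, Real.abs_exp, zero_mul, add_zero, Fintype.sum_option] at hi
    cases i with
    | none =>
      left
      rw [← ho, D.M_o, D.ω_o, ho, mul_one, hg] at hi
      simpa [homog] using hi
    | some i =>
      right
      by_cases hie : i = i₁
      · left
        subst hie
        rw [← he, D.M_e, he, hω] at hi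
        have h0 : D.g1 none x = 0 := by rw [← ho]; exact D.g1_o x hxT
        simp only [Option.elim_none, Option.elim_some] at hi
        rw [h0] at hi
        simpa [hderiv] using hi
      · right
        refine ⟨i, ?_⟩
        rw [D.M_of_ne x (by simp [ho]) (by simpa [he] using hie), hω] at hi
        simpa [Pi.single_apply] using hi
end

theorem rpow_neg_le_of_rpow_neg_le {a b Q ρ σ : ℝ} (ha : 0 < a) (hb : 0 < b) (hQ : 1 ≤ Q)
    (hρ : 0 ≤ ρ) (hσ : 0 < σ) (hρσ : ρ ≤ σ) (h : a ^ (-σ) ≤ Q * b ^ (-σ)) :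
    a ^ (-ρ) ≤ Q * b ^ (-ρ) := by
  have key : ∀ x : ℝ, 0 < x → x ^ (-ρ) = (x ^ (-σ)) ^ (ρ / σ) := fun x hx => by
    rw [← Real.rpow_mul hx.le]; congr 1; field_simp
  have ht1 : ρ / σ ≤ 1 := (div_le_one hσ).mpr hρσ
  have hQ1 : Q ^ (ρ / σ) ≤ Q := by
    conv_rhs => rw [← Real.rpow_one Q]
    exact Real.rpow_le_rpow_of_exponent_le hQ ht1
  rw [key a ha, key b hb]
  calc _ ≤ (Q * b ^ (-σ)) ^ (ρ / σ) := by gcongr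
    _ = Q ^ (ρ / σ) * (b ^ (-σ)) ^ (ρ / σ) := Real.mul_rpow (by linarith) (by positivity)
    _ ≤ _ := by gcongr

namespace NTree

/-- Points of distinct children of a node of a block tree are far apart. -/
theorem IsGap.eq_of_abs_sub_lt {T : NTree Bool} (hT : T.IsGap) {h : ℕ} (hh : 1 ≤ h)
    {w : List (Fin h → Bool)} {b b' : Fin h → Bool} {x y : ℝ} (hx : x ∈ (T.block h hh).cell (b :: w))
    (hy : y ∈ (T.block h hh).cell (b' :: w))
    (hxy : |x - y| < (T.block h hh).size (w.length + 1)) : b = b' := by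
  by_contra hne
  rw [abs_lt] at hxy
  have h1 := hx.1
  have h2 := hx.2
  have h3 := hy.1
  have h4 := hy.2
  rw [List.length_cons] at h2 h4
  rcases hT.block_separated hh w hne with h | h <;> linarith [hxy.1, hxy.2]

theorem IsGap.exists_subtree_of_subsingleton {T : NTree Bool} (hT : T.IsGap)
    (bad : ℕ → ℝ → Prop)
    (hbad : ∀ w x y, x ∈ (T.block 2 one_le_two).cell w → y ∈ (T.block 2 one_le_two).cell w →
      bad w.length x → bad w.length y → |x - y| < (T.block 2 one_le_two).size (w.length + 1)) :
    ∃ T' : NTree Bool, T'.IsGap ∧ T'.Sub T ∧ ∀ x ∈ T'.lim, ∀ n, ¬ bad n x := by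
  classical
  set S := T.block 2 one_le_two
  have huniq : ∀ w b b', (∃ x ∈ S.cell (b :: w), bad w.length x) →
      (∃ x ∈ S.cell (b' :: w), bad w.length x) → b = b' := by
    rintro w b b' ⟨x, hx, hbx⟩ ⟨y, hy, hby⟩
    exact hT.eq_of_abs_sub_lt one_le_two hx hy
      (hbad w x y (S.cell_cons_subset _ _ hx) (S.cell_cons_subset _ _ hy) hbx hby)
  let alive : List (Fin 2 → Bool) → Prop
    | [] => True
    | b :: w => ¬ ∃ x ∈ S.cell (b :: w), bad w.length x
  obtain ⟨T', hT', -, -, hcell⟩ := S.exists_gap_subtree alive trivial fun w _ => by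
    have hcard : 2 < (Finset.univ : Finset (Fin 2 → Bool)).card := by simp
    obtain ⟨b₀, hb₀⟩ : ∃ b₀, ∀ b, b ≠ b₀ → alive (b :: w) := by
      by_cases h : ∃ b₀, ¬ alive (b₀ :: w)
      · obtain ⟨b₀, h₀⟩ := h
        refine ⟨b₀, fun b hb hdead => hb (huniq w b b₀ hdead (not_not.mp h₀))⟩
      · push Not at h
        exact ⟨fun _ => true, fun b _ => h b⟩
    have hcard' : 1 < (Finset.univ.erase b₀ : Finset (Fin 2 → Bool)).card := by
      rw [Finset.card_erase_of_mem (Finset.mem_univ _)]; simp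
    obtain ⟨b, hb, b', hb', hne⟩ := Finset.one_lt_card.mp hcard'
    have h1 := hb₀ b (Finset.ne_of_mem_erase hb)
    have h2 := hb₀ b' (Finset.ne_of_mem_erase hb')
    rcases hT.block_separated one_le_two w hne with h | h
    · exact ⟨b, b', h1, h2, h⟩
    · exact ⟨b', b, h2, h1, h⟩
  refine ⟨T', hT', fun w => ?_, fun x hx n hn => ?_⟩
  · obtain ⟨u, hu, -, hwu⟩ := hcell w
    obtain ⟨v, hv, huv⟩ := T.block_sub one_le_two u
    exact ⟨v, by omega, hwu.le.trans huv⟩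
  · obtain ⟨w, hw, hxw⟩ := hx (n + 1)
    obtain ⟨u, hu, hau, hwu⟩ := hcell w
    rw [hwu] at hxw
    cases u with
    | nil => simp at hu; omega
    | cons b u =>
      simp only [List.length_cons] at hu
      have hun : u.length = n := by omega
      exact hau ⟨x, hxw, by rwa [hun]⟩

/-- The index of the level whose scale is comparable to a given small number. -/
theorem exists_level {β : Type} (T : NTree β) {X : ℝ} (hX0 : 0 < X) (hX : X < T.size 0) :
    ∃ n, T.size n ≤ X ∧ X < T.q * T.size n := by
  have hex : ∃ n, T.size n ≤ X :=
    ((T.tendsto_size.eventually (gt_mem_nhds hX0)).exists).imp fun _ h => le_of_lt h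
  classical
  refine ⟨Nat.find hex, Nat.find_spec hex, ?_⟩
  obtain ⟨m, hm⟩ : ∃ m, Nat.find hex = m + 1 := Nat.exists_eq_succ_of_ne_zero fun h0 => by
    have := Nat.find_spec hex
    rw [h0] at this
    linarith
  rw [hm, size_succ, mul_div_cancel₀ _ T.q_pos.ne']
  exact not_le.mp (Nat.find_min hex (by omega))

theorem IsGap.exists_inhomogeneous_subtree {ι : Type} [Fintype ι] {T : NTree Bool}
    (hT : T.IsGap) {r : ι → ℝ} (hr : ∀ i, 0 < r i) (hr1 : ∀ i, r i ≤ 1) {i₁ : ι}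
    (hi₁ : ∀ i, r i ≤ r i₁) {f Θ : ι → ℝ → ℝ} {B d c : ℝ} (hB : 1 ≤ B) (hd : 0 ≤ d) (hc : 0 < c)
    (hlow : ∀ x ∈ T.cell [], ∀ y ∈ T.cell [], |x - y| ≤ B * |f i₁ x - f i₁ y|)
    (hup : ∀ i, ∀ x ∈ T.cell [], ∀ y ∈ T.cell [], |f i x - f i y| ≤ B * |x - y|)
    (hΘ : ∀ i, ∀ x ∈ T.cell [], ∀ y ∈ T.cell [], |Θ i x - Θ i y| ≤ d * |x - y|)
    (hhom : ∀ x ∈ T.lim, ∀ q : ℤ, q ≠ 0 → ∀ p : ι → ℤ,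
      ∃ i, c * |(q : ℝ)| ^ (-r i) < |q * f i x - p i|) :
    ∃ T' : NTree Bool, T'.IsGap ∧ T'.Sub T ∧ ∃ c' > 0, ∃ N : ℝ, ∀ x ∈ T'.lim, ∀ q : ℤ,
      N ≤ |(q : ℝ)| → ∀ p : ι → ℤ, ∃ i, c' * |(q : ℝ)| ^ (-r i) < |q * f i x - p i - Θ i x| := by
  classical
  set S := T.block 2 one_le_two with hS
  have hScell : ∀ w, S.cell w ⊆ T.cell [] := fun w => by
    rw [hS, block_cell]; exact T.cell_subset_of_suffix List.nil_suffix
  set Q := S.q with hQdef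
  have hQ2 : 2 ≤ Q := S.two_le
  set ε := min (c / (2 * (1 + Q))) (1 / 4) with hε
  have hε0 : 0 < ε := lt_min (by positivity) (by norm_num)
  have hεc : (1 + Q) * ε ≤ c / 2 := by
    have := min_le_left (c / (2 * (1 + Q))) (1 / 4)
    rw [← hε, le_div_iff₀ (by positivity)] at this
    linarith
  have hε4 : ε ≤ 1 / 4 := min_le_right _ _
  set κ := ε / (2 * (B + d)) with hκ
  have hκ0 : 0 < κ := by positivity
  have hκε : (B + d) * κ = ε / 2 := by rw [hκ]; field_simp
  set c' := min (ε / 2) (κ / (4 * B * Q ^ 2)) with hc'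
  have hc'0 : 0 < c' := lt_min (by positivity) (by positivity)
  have hc'ε : c' + (B + d) * κ ≤ ε := by
    have := min_le_left (ε / 2) (κ / (4 * B * Q ^ 2))
    rw [← hc'] at this
    linarith
  have hc'κ : 4 * B * Q ^ 2 * c' ≤ κ := by
    have := min_le_right (ε / 2) (κ / (4 * B * Q ^ 2))
    rw [← hc', le_div_iff₀ (by positivity)] at this
    linarith
  set σ := 1 + r i₁ with hσ
  have hσ1 : 1 < σ := by linarith [hr i₁]
  set N := max 1 (max (2 * B * d) (2 * κ / S.size 0)) with hN
  have hN1 : 1 ≤ N := le_max_left _ _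
  let close : ℤ → (ι → ℤ) → ℝ → Prop := fun q p x =>
    ∀ i, |q * f i x - p i - Θ i x| ≤ c' * |(q : ℝ)| ^ (-r i)
  let lev : ℕ → ℤ → Prop := fun n q =>
    N ≤ |(q : ℝ)| ∧ S.size n ≤ κ * |(q : ℝ)| ^ (-σ) ∧ κ * |(q : ℝ)| ^ (-σ) < Q * S.size n
  have hperturb : ∀ w q p x z, x ∈ S.cell w → z ∈ S.cell w → lev w.length q → close q p x →
      ∀ i, |q * f i z - p i - Θ i z| ≤ ε * |(q : ℝ)| ^ (-r i) := by
    intro w q p x z hx hz hl hcl i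
    have hq1 : 1 ≤ |(q : ℝ)| := hN1.trans hl.1
    have hq0 : 0 < |(q : ℝ)| := by linarith
    have hzx : |z - x| ≤ κ * |(q : ℝ)| ^ (-σ) := (S.abs_sub_le hz hx).trans hl.2.1
    have e1 : |(q : ℝ)| * |(q : ℝ)| ^ (-σ) = |(q : ℝ)| ^ (-r i₁) := by
      conv_lhs => rw [← Real.rpow_one_add' hq0.le (by rw [hσ]; linarith [hr i₁])]
      congr 1; rw [hσ]; ring
    have e2 : |(q : ℝ)| ^ (-r i₁) ≤ |(q : ℝ)| ^ (-r i) :=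
      Real.rpow_le_rpow_of_exponent_le hq1 (by linarith [hi₁ i])
    have hdecomp : q * f i z - p i - Θ i z =
        (q * f i x - p i - Θ i x) + (q * (f i z - f i x) - (Θ i z - Θ i x)) := by ring
    rw [hdecomp]
    calc _ ≤ |q * f i x - p i - Θ i x| + (|q * (f i z - f i x)| + |Θ i z - Θ i x|) :=
          (abs_add_le _ _).trans (by gcongr; exact abs_sub _ _)
      _ ≤ c' * |(q : ℝ)| ^ (-r i) + (|(q : ℝ)| * (B * |z - x|) + |(q : ℝ)| * (d * |z - x|)) := by
          rw [abs_mul]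
          have h1 := hup i z (hScell w hz) x (hScell w hx)
          have h2 := hΘ i z (hScell w hz) x (hScell w hx)
          have h3 : d * |z - x| ≤ |(q : ℝ)| * (d * |z - x|) :=
            le_mul_of_one_le_left (by positivity) hq1
          have h4 := hcl i
          have h5 := mul_le_mul_of_nonneg_left h1 hq0.le
          linarith
      _ = c' * |(q : ℝ)| ^ (-r i) + (B + d) * (|(q : ℝ)| * |z - x|) := by ring
      _ ≤ c' * |(q : ℝ)| ^ (-r i) + (B + d) * (κ * |(q : ℝ)| ^ (-r i)) := by
          have : |(q : ℝ)| * |z - x| ≤ κ * |(q : ℝ)| ^ (-r i) := by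
            calc _ ≤ |(q : ℝ)| * (κ * |(q : ℝ)| ^ (-σ)) := by gcongr
              _ = κ * |(q : ℝ)| ^ (-r i₁) := by rw [← e1]; ring
              _ ≤ _ := by gcongr
          gcongr
      _ = (c' + (B + d) * κ) * |(q : ℝ)| ^ (-r i) := by ring
      _ ≤ _ := by gcongr
  have hcomp : ∀ n q q', lev n q → lev n q' → ∀ i,
      |(q : ℝ)| ^ (-r i) ≤ Q * |(q' : ℝ)| ^ (-r i) := by
    intro n q q' hl hl' i
    refine rpow_neg_le_of_rpow_neg_le (σ := σ) (by linarith [hl.1]) (by linarith [hl'.1]) (by linarith)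
      (hr i).le (by linarith) (by rw [hσ]; linarith [hi₁ i]) ?_
    have h1 : κ * |(q : ℝ)| ^ (-σ) ≤ κ * (Q * |(q' : ℝ)| ^ (-σ)) := by
      have := mul_le_mul_of_nonneg_left hl'.2.1 (by linarith : (0 : ℝ) ≤ Q)
      linarith [hl.2.2]
    exact le_of_mul_le_mul_left h1 hκ0
  have huniq : ∀ w q p x q' p' x', x ∈ S.cell w → x' ∈ S.cell w → lev w.length q →
      lev w.length q' → close q p x → close q' p' x' → |(q' : ℝ)| ≤ |(q : ℝ)| →
      q = q' ∧ p = p' := by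
    intro w q p x q' p' x' hx hx' hl hl' hcl hcl' hle
    obtain ⟨z, hz, hzl⟩ := S.exists_mem_lim w
    have hq1 : 1 ≤ |(q : ℝ)| := hN1.trans hl.1
    have hq0 : 0 < |(q : ℝ)| := by linarith
    have h1 := hperturb w q p x z hx hz hl hcl
    have h2 := hperturb w q' p' x' z hx' hz hl' hcl'
    have hdiff : ∀ i, |((q - q' : ℤ) : ℝ) * f i z - ((p i - p' i : ℤ) : ℝ)| ≤
        ε * (|(q : ℝ)| ^ (-r i) + |(q' : ℝ)| ^ (-r i)) := fun i => by
      have e : ((q - q' : ℤ) : ℝ) * f i z - ((p i - p' i : ℤ) : ℝ) =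
          (q * f i z - p i - Θ i z) - (q' * f i z - p' i - Θ i z) := by push_cast; ring
      rw [e, mul_add]
      exact (abs_sub _ _).trans (add_le_add (h1 i) (h2 i))
    have hqq : q = q' := by
      by_contra hne
      obtain ⟨i, hi⟩ := hhom z ((T.block_sub one_le_two).lim_subset hzl) (q - q')
        (sub_ne_zero.mpr hne) (fun i => p i - p' i)
      have hd0 : 0 < |((q - q' : ℤ) : ℝ)| := abs_pos.mpr (by exact_mod_cast sub_ne_zero.mpr hne)
      have hd2 : |((q - q' : ℤ) : ℝ)| ≤ 2 * |(q : ℝ)| := by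
        push_cast
        linarith [abs_sub (q : ℝ) q']
      have h3 : 2⁻¹ * |(q : ℝ)| ^ (-r i) ≤ |((q - q' : ℤ) : ℝ)| ^ (-r i) := by
        calc _ ≤ (2 : ℝ) ^ (-r i) * |(q : ℝ)| ^ (-r i) := by
              gcongr
              rw [← Real.rpow_neg_one]
              exact Real.rpow_le_rpow_of_exponent_le one_le_two (by linarith [hr1 i])
          _ = (2 * |(q : ℝ)|) ^ (-r i) := (Real.mul_rpow zero_le_two hq0.le).symm
          _ ≤ _ := Real.rpow_le_rpow_of_nonpos hd0 hd2 (by linarith [hr i])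
      have h4 := hdiff i
      have h5 := hcomp _ q' q hl' hl i
      have h6 : 0 < |(q : ℝ)| ^ (-r i) := by positivity
      have h7 : ε * (|(q : ℝ)| ^ (-r i) + |(q' : ℝ)| ^ (-r i)) ≤ c / 2 * |(q : ℝ)| ^ (-r i) := by
        calc _ ≤ ε * (|(q : ℝ)| ^ (-r i) + Q * |(q : ℝ)| ^ (-r i)) := by gcongr
          _ = (1 + Q) * ε * |(q : ℝ)| ^ (-r i) := by ring
          _ ≤ _ := by gcongr
      have h8 := mul_le_mul_of_nonneg_left h3 hc.le
      linarith
    refine ⟨hqq, funext fun i => ?_⟩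
    subst hqq
    have h3 := hdiff i
    have h4 : |(q : ℝ)| ^ (-r i) ≤ 1 := Real.rpow_le_one_of_one_le_of_nonpos hq1 (by linarith [hr i])
    have h5 : |(((p i - p' i : ℤ)) : ℝ)| < 1 := by
      simp only [sub_self, Int.cast_zero, zero_mul, zero_sub, abs_neg] at h3
      nlinarith
    have h6 : |p i - p' i| < 1 := by exact_mod_cast h5
    have := Int.abs_lt_one_iff.mp h6
    omega
  obtain ⟨T', hT', hsub, hgood⟩ := hT.exists_subtree_of_subsingleton
    (fun n x => ∃ q p, lev n q ∧ close q p x) (by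
      rintro w x y hx hy ⟨q, p, hl, hcl⟩ ⟨q', p', hl', hcl'⟩
      have hqp : q = q' ∧ p = p' := by
        rcases le_total |(q' : ℝ)| |(q : ℝ)| with h | h
        · exact huniq w q p x q' p' y hx hy hl hl' hcl hcl' h
        · have := huniq w q' p' y q p x hy hx hl' hl hcl' hcl h
          exact ⟨this.1.symm, this.2.symm⟩
      obtain ⟨rfl, rfl⟩ := hqp
      have hq1 : 1 ≤ |(q : ℝ)| := hN1.trans hl.1
      have hq0 : 0 < |(q : ℝ)| := by linarith
      have hNd : 2 * B * d ≤ |(q : ℝ)| :=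
        ((le_max_left _ _).trans (le_max_right _ _)).trans hl.1
      have h1 := hlow x (hScell w hx) y (hScell w hy)
      have h2 := hΘ i₁ x (hScell w hx) y (hScell w hy)
      have h3 : |(q : ℝ)| * |f i₁ x - f i₁ y| ≤ 2 * (c' * |(q : ℝ)| ^ (-r i₁)) + d * |x - y| := by
        rw [← abs_mul]
        have e : (q : ℝ) * (f i₁ x - f i₁ y) = (q * f i₁ x - p i₁ - Θ i₁ x) -
          (q * f i₁ y - p i₁ - Θ i₁ y) + (Θ i₁ x - Θ i₁ y) := by ring
        rw [e]
        refine (abs_add_le _ _).trans ?_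
        have := abs_sub (q * f i₁ x - p i₁ - Θ i₁ x) (q * f i₁ y - p i₁ - Θ i₁ y)
        linarith [hcl i₁, hcl' i₁]
      have h4 : |(q : ℝ)| * |x - y| ≤ 4 * B * c' * |(q : ℝ)| ^ (-r i₁) := by
        have h5 := mul_le_mul_of_nonneg_left h1 hq0.le
        have h6 := mul_le_mul_of_nonneg_left h3 (by linarith : 0 ≤ B)
        have h7 := mul_le_mul_of_nonneg_right hNd (abs_nonneg (x - y))
        linarith
      have e1 : |(q : ℝ)| * |(q : ℝ)| ^ (-σ) = |(q : ℝ)| ^ (-r i₁) := by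
        conv_lhs => rw [← Real.rpow_one_add' hq0.le (by rw [hσ]; linarith [hr i₁])]
        congr 1; rw [hσ]; ring
      have h8 : |x - y| ≤ 4 * B * c' * |(q : ℝ)| ^ (-σ) := by
        refine le_of_mul_le_mul_left ?_ hq0
        rw [mul_left_comm, e1]; exact h4
      have h9 : Q ^ 2 * |x - y| < Q * S.size w.length := by
        calc _ ≤ Q ^ 2 * (4 * B * c' * |(q : ℝ)| ^ (-σ)) := by gcongr
          _ = 4 * B * Q ^ 2 * c' * |(q : ℝ)| ^ (-σ) := by ring
          _ ≤ κ * |(q : ℝ)| ^ (-σ) := by gcongr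
          _ < _ := hl.2.2
      change |x - y| < S.size (w.length + 1)
      rw [size_succ, ← hQdef, lt_div_iff₀ (by linarith)]
      have : Q * (|x - y| * Q) < Q * S.size w.length := by linarith
      exact lt_of_mul_lt_mul_left this (by linarith))
  refine ⟨T', hT', hsub, c', hc'0, N, fun x hx q hq p => ?_⟩
  by_contra! hcon
  have hq1 : 1 ≤ |(q : ℝ)| := hN1.trans hq
  have hq0 : 0 < |(q : ℝ)| := by linarith
  have hX : κ * |(q : ℝ)| ^ (-σ) < S.size 0 := by
    have h1 : 2 * κ / S.size 0 ≤ |(q : ℝ)| :=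
      ((le_max_right _ _).trans (le_max_right _ _)).trans hq
    rw [div_le_iff₀ (S.size_pos 0)] at h1
    have h2 : |(q : ℝ)| ^ (-σ) ≤ |(q : ℝ)| ^ (-1 : ℝ) :=
      Real.rpow_le_rpow_of_exponent_le hq1 (by linarith)
    rw [Real.rpow_neg_one] at h2
    calc _ ≤ κ * |(q : ℝ)|⁻¹ := by gcongr
      _ < S.size 0 := by
        rw [← div_eq_mul_inv, div_lt_iff₀ hq0]; linarith
  obtain ⟨n, hn1, hn2⟩ := S.exists_level (by positivity) hX
  exact hgood x hx n ⟨q, p, ⟨hq, hn1, hn2⟩, hcon⟩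

end NTree

theorem badLiminf_pos {n : ℕ} {r y θv : Fin n → ℝ} {c N : ℝ} (hc : 0 < c)
    (h : ∀ q : ℤ, N ≤ |(q : ℝ)| → ∀ p : Fin n → ℤ,
      ∃ i, 0 < r i ∧ c * |(q : ℝ)| ^ (-r i) < |q * y i - p i - θv i|) :
    0 < badLiminf r y θv := by
  set c' : ℝ := ∏ i, min 1 (c ^ (1 / r i)) with hc'
  have hf0 : ∀ i, 0 < min 1 (c ^ (1 / r i)) := fun i => lt_min one_pos (by positivity)
  have hc'0 : 0 < c' := Finset.prod_pos fun i _ => hf0 i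
  have hc'i : ∀ i, c' ≤ c ^ (1 / r i) := fun i => by
    rw [hc', ← Finset.mul_prod_erase _ _ (Finset.mem_univ i)]
    exact (mul_le_of_le_one_right (hf0 i).le
      (Finset.prod_le_one (fun j _ => (hf0 j).le) fun j _ => min_le_left _ _)).trans
      (min_le_right _ _)
  refine lt_of_lt_of_le (ENNReal.ofReal_pos.mpr hc'0) (le_liminf_of_le (by isBoundedDefault) ?_)
  filter_upwards [tendsto_comap.eventually (eventually_ge_atTop (max 1 ⌈N⌉))] with q hq
  have hq1 : (1 : ℝ) ≤ |(q : ℝ)| := by exact_mod_cast (le_max_left _ _).trans hq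
  have hq0 : 0 < |(q : ℝ)| := by linarith
  have hqN : N ≤ |(q : ℝ)| := by
    have : ((⌈N⌉ : ℤ) : ℝ) ≤ |(q : ℝ)| := by exact_mod_cast (le_max_right _ _).trans hq
    exact (Int.le_ceil N).trans this
  obtain ⟨i, hri, hi⟩ := h q hqN fun i => round (q * y i - θv i)
  rw [sub_right_comm] at hi
  refine ENNReal.ofReal_le_ofReal ?_
  calc c' ≤ c ^ (1 / r i) := hc'i i
    _ = (c * |(q : ℝ)| ^ (-r i)) ^ (1 / r i) * |(q : ℝ)| := by
      rw [Real.mul_rpow hc.le (by positivity), ← Real.rpow_mul hq0.le]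
      have : -r i * (1 / r i) = -1 := by field_simp
      rw [this, Real.rpow_neg_one, mul_assoc, inv_mul_cancel₀ hq0.ne', mul_one]
    _ ≤ wpow (distInt (q * y i - θv i)) (r i) * |(q : ℝ)| := by
      rw [wpow, if_neg hri.ne', distInt]
      gcongr
    _ ≤ _ := by
      gcongr
      exact le_ciSup (f := fun i => wpow (distInt (q * y i - θv i)) (r i))
        (Set.finite_range _).bddAbove i

theorem AnalyticOnNhd.exists_lipschitz_Icc {E : Type*} [NormedAddCommGroup E] [NormedSpace ℝ E]
    [CompleteSpace E] {f : ℝ → E} {U : Set ℝ} (hf : AnalyticOnNhd ℝ f U) {a b : ℝ}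
    (hab : Icc a b ⊆ U) :
    ∃ C, 0 ≤ C ∧ ∀ x ∈ Icc a b, ∀ y ∈ Icc a b, ‖f x - f y‖ ≤ C * |x - y| := by
  obtain ⟨C, hC⟩ := isCompact_Icc.exists_bound_of_continuousOn (hf.deriv.continuousOn.mono hab)
  refine ⟨max C 0, le_max_right _ _, fun x hx y hy => ?_⟩
  exact (convex_Icc a b).norm_image_sub_le_of_norm_deriv_le
    (fun z hz => (hf z (hab hz)).differentiableAt) (fun z hz => (hC z hz).trans (le_max_left _ _))
    hy hx

theorem abs_sub_le_of_one_le_deriv {f : ℝ → ℝ} {a b B : ℝ}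
    (hf : ∀ x ∈ Icc a b, DifferentiableAt ℝ f x) (h : ∀ x ∈ Icc a b, 1 ≤ B * |deriv f x|) :
    ∀ x ∈ Icc a b, ∀ y ∈ Icc a b, |x - y| ≤ B * |f x - f y| := by
  have key : ∀ x ∈ Icc a b, ∀ y ∈ Icc a b, x < y → |x - y| ≤ B * |f x - f y| := by
    intro x hx y hy hxy
    have hsub : Icc x y ⊆ Icc a b := Icc_subset_Icc hx.1 hy.2
    obtain ⟨z, hz, hzd⟩ := exists_deriv_eq_slope f hxy
      (fun w hw => (hf w (hsub hw)).continuousAt.continuousWithinAt)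
      (fun w hw => (hf w (hsub (Ioo_subset_Icc_self hw))).differentiableWithinAt)
    have h1 := h z (hsub (Ioo_subset_Icc_self hz))
    have hpos : 0 < |y - x| := abs_pos.mpr (by linarith)
    rw [hzd, abs_div, ← mul_div_assoc, le_div_iff₀ hpos, one_mul] at h1
    rwa [abs_sub_comm x, abs_sub_comm (f x)]
  intro x hx y hy
  rcases lt_trichotomy x y with hxy | rfl | hxy
  · exact key x hx y hy hxy
  · simp
  · rw [abs_sub_comm x, abs_sub_comm (f x)]; exact key y hy x hx hxy

/-- Inside every tree there is a tree all of whose limit points are badly approximable. -/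
theorem NTree.IsGap.exists_bad_subtree {T : NTree Bool} (hT : T.IsGap) {n : ℕ} {r : Fin n → ℝ}
    (hr : ∀ k, 0 ≤ r k) (hr1 : ∑ k, r k = 1) {θ : (Fin n → ℝ) → Fin n → ℝ}
    (hθ : ∀ k, ∃ d > 0, ∀ x y, |θ x k - θ y k| ≤ d * ‖x - y‖)
    {U : Set ℝ} (hU : IsOpen U) (hUc : IsPreconnected U) {φ : ℝ → Fin n → ℝ}
    (hφ : AnalyticOnNhd ℝ φ U)
    (hnd : ∀ (a : ℝ) (b : Fin n → ℝ), (∀ x ∈ U, a + ∑ k, b k * φ x k = 0) → a = 0 ∧ b = 0)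
    (hTU : T.cell [] ⊆ U) :
    ∃ T' : NTree Bool, T'.IsGap ∧ T'.Sub T ∧
      ∀ x ∈ T'.lim, 0 < badLiminf r (φ x) (θ (φ x)) := by
  classical
  let ι := {k : Fin n // 0 < r k}
  have hsub : ∀ F : Fin n → ℝ, (∀ k, ¬ 0 < r k → F k = 0) → ∑ i : ι, F i = ∑ k, F k := by
    intro F hF
    rw [← Finset.sum_subtype (Finset.univ.filter fun k => 0 < r k) (by simp) F]
    exact Finset.sum_filter_of_ne fun k _ hk => by_contra fun h => hk (hF k h)
  have hsum : ∑ i : ι, r i = 1 := by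
    rw [← hr1]
    exact hsub r fun k hk => le_antisymm (not_lt.mp hk) (hr k)
  have hne : Nonempty ι := by
    by_contra h
    rw [not_nonempty_iff] at h
    simp at hsum
  obtain ⟨i₁, hi₁⟩ := Finite.exists_max fun i : ι => r i
  have hφk : ∀ k, AnalyticOnNhd ℝ (fun x => φ x k) U := fun k x hx =>
    ((ContinuousLinearMap.proj (R := ℝ) (φ := fun _ : Fin n => ℝ) k).analyticAt _).comp (hφ x hx)
  obtain ⟨T₁, hT₁, hsub₁, B, hB, hder, c, hc, hhom⟩ := exists_homogeneous (ι := ι)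
    (r := fun i => r i) (fun i => i.2) hsum hi₁ hU hUc (f := fun i x => φ x i)
    (fun i => hφk i) (fun a b hab => by
      have := hnd a (fun k => if h : 0 < r k then b ⟨k, h⟩ else 0) fun x hx => by
        refine Eq.trans ?_ (hab x hx)
        rw [← hsub _ fun k hk => by rw [dif_neg hk, zero_mul]]
        congr 1
        exact Finset.sum_congr rfl fun i _ => by rw [dif_pos i.2]
      refine ⟨this.1, funext fun i => ?_⟩
      have h2 := congrFun this.2 i
      simpa [i.2] using h2) hT hTU
  have hcell₁ : T₁.cell [] ⊆ U := by
    obtain ⟨u, -, hu⟩ := hsub₁ []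
    exact hu.trans ((T.cell_subset_of_suffix List.nil_suffix).trans hTU)
  obtain ⟨C, hC, hCφ⟩ := hφ.exists_lipschitz_Icc hcell₁
  choose d hd hdθ using hθ
  set D := ∑ k, d k with hD
  have hdD : ∀ k, d k ≤ D := fun k =>
    Finset.single_le_sum (f := d) (fun j _ => (hd j).le) (Finset.mem_univ k)
  have hD0 : 0 ≤ D := Finset.sum_nonneg fun k _ => (hd k).le
  obtain ⟨T₂, hT₂, hsub₂, c', hc', N, hbad⟩ := hT₁.exists_inhomogeneous_subtree (ι := ι)
    (r := fun i => r i) (fun i => i.2)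
    (fun i => by
      rw [← hr1]; exact Finset.single_le_sum (f := r) (fun j _ => hr j) (Finset.mem_univ i.1))
    hi₁ (f := fun i x => φ x i) (Θ := fun i x => θ (φ x) i) hB (mul_nonneg hD0 hC) hc
    (abs_sub_le_of_one_le_deriv
      (fun x hx => (hφk _ x (hcell₁ hx)).differentiableAt) fun x hx => (hder x hx).1)
    (fun i x hx y hy => (convex_Icc _ _).norm_image_sub_le_of_norm_deriv_le
      (fun z hz => (hφk i z (hcell₁ hz)).differentiableAt) (fun z hz => (hder z hz).2 i) hy hx)
    (fun i x hx y hy => by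
      calc _ ≤ d i * ‖φ x - φ y‖ := hdθ _ _ _
        _ ≤ D * (C * |x - y|) := by
          gcongr
          · exact hdD _
          · exact hCφ x hx y hy
        _ = _ := by ring)
    hhom
  refine ⟨T₂, hT₂, hsub₂.trans hsub₁, fun x hx => badLiminf_pos (N := N) hc' fun q hq p => ?_⟩
  obtain ⟨i, hi⟩ := hbad x hx q hq fun i => p i
  exact ⟨i, i.2, hi⟩

namespace NTree

/-- The tree of `M`-adic subintervals of an interval. -/
noncomputable def full (a ℓ : ℝ) (M : ℕ) (hℓ : 0 < ℓ) (hM : 2 ≤ M) : NTree (Fin M) where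
  len := ℓ
  q := M
  c w := w.rec a fun b w x => x + (b : ℕ) * (ℓ / (M : ℝ) ^ (w.length + 1))
  len_pos := hℓ
  two_le := by exact_mod_cast hM
  left b w := le_add_of_nonneg_right (by positivity)
  right b w := by
    have h1 : ((b : ℕ) : ℝ) + 1 ≤ M := by exact_mod_cast b.2
    have h2 : (M : ℝ) * (ℓ / (M : ℝ) ^ (w.length + 1)) = ℓ / (M : ℝ) ^ w.length := by
      have : (M : ℝ) ≠ 0 := by positivity
      field_simp
      ring
    have h3 : 0 ≤ ℓ / (M : ℝ) ^ (w.length + 1) := by positivity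
    have := mul_le_mul_of_nonneg_right h1 h3
    simp only
    linarith

section full
variable {a ℓ : ℝ} {M : ℕ} (hℓ : 0 < ℓ) (hM : 2 ≤ M)

theorem full_c_cons (b : Fin M) (w : List (Fin M)) :
    (full a ℓ M hℓ hM).c (b :: w) =
      (full a ℓ M hℓ hM).c w + (b : ℕ) * (full a ℓ M hℓ hM).size (w.length + 1) := rfl

/-- Few intervals of a given level of the `M`-adic tree meet a short interval. -/
theorem full_csum_meet_le (x y : ℝ) (p : ℕ) (w : List (Fin M)) :
    csum (ind fun u => ((full a ℓ M hℓ hM).cell u ∩ Icc x y).Nonempty) p w *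
        (full a ℓ M hℓ hM).size (w.length + p) ≤
      max 0 (y - x + 2 * (full a ℓ M hℓ hM).size (w.length + p)) := by
  set T := full a ℓ M hℓ hM with hT
  have key : ∀ p w, ∀ L, L = T.size (w.length + p) → 0 ≤ y - x + 2 * L →
      csum (ind fun u => (T.cell u ∩ Icc x y).Nonempty) p w * L ≤
      max (x - L) (min (y + L) (T.c w + T.size w.length)) - max (x - L) (min (y + L) (T.c w)) := by
    intro p
    induction p with
    | zero =>
      rintro w L hL hxy
      rw [add_zero] at hL
      have hL0 : 0 < L := by rw [hL]; exact T.size_pos _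
      rw [← hL]
      simp only [csum, ind]
      split_ifs with h
      · obtain ⟨z, hz, hz'⟩ := h
        have h1 := hz.1
        have h2 := hz.2
        rw [← hL] at h2
        rw [min_eq_right (by linarith [hz'.2]), max_eq_right (by linarith [hz'.1]),
          min_eq_right (by linarith [hz'.2]), max_eq_right (by linarith [hz'.1])]
        linarith
      · rw [zero_mul, sub_nonneg]
        gcongr
        linarith
    | succ p ih =>
      intro w L hL hxy
      set F : ℝ → ℝ := fun t => max (x - L) (min (y + L) t)
      set S := T.size (w.length + 1)
      have h1 : ∀ b : Fin M, csum (ind fun u => (T.cell u ∩ Icc x y).Nonempty) p (b :: w) * L ≤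
          F (T.c w + ((b : ℕ) + 1 : ℕ) * S) - F (T.c w + (b : ℕ) * S) := fun b => by
        have := ih (b :: w) L (by rw [hL, List.length_cons, add_assoc, add_comm 1]) hxy
        rw [full_c_cons, List.length_cons] at this
        refine this.trans (le_of_eq ?_)
        simp only [F]
        congr 3
        push_cast
        rw [add_mul, one_mul, ← add_assoc]
      have hMS : (M : ℝ) * S = T.size w.length := by
        have : S = T.size w.length / M := T.size_succ _
        rw [this, mul_div_cancel₀]
        exact_mod_cast (by omega : M ≠ 0)
      calc _ = ∑ b : Fin M, csum (ind fun u => (T.cell u ∩ Icc x y).Nonempty) p (b :: w) * L := by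
            rw [← Finset.sum_mul]; rfl
        _ ≤ ∑ b : Fin M, (F (T.c w + ((b : ℕ) + 1 : ℕ) * S) - F (T.c w + (b : ℕ) * S)) :=
            Finset.sum_le_sum fun b _ => h1 b
        _ = F (T.c w + (M : ℕ) * S) - F (T.c w + (0 : ℕ) * S) := by
            rw [Fin.sum_univ_eq_sum_range (fun k : ℕ => F (T.c w + ((k + 1 : ℕ) : ℝ) * S) - F (T.c w + (k : ℝ) * S)) M,
              Finset.sum_range_sub (fun k : ℕ => F (T.c w + (k : ℝ) * S))]
        _ = _ := by rw [hMS]; simp [F]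
  set L := T.size (w.length + p) with hL
  have hL0 : 0 < L := T.size_pos _
  by_cases hxy : 0 ≤ y - x + 2 * L
  · refine (key p w L hL hxy).trans ((?_ : _ ≤ _).trans (le_max_right _ _))
    have h1 : max (x - L) (min (y + L) (T.c w + T.size w.length)) ≤ y + L :=
      max_le (by linarith) (min_le_left _ _)
    have h2 := le_max_left (x - L) (min (y + L) (T.c w))
    linarith
  · have : Icc x y = ∅ := Icc_eq_empty (by intro h; apply hxy; linarith)
    simp only [this, inter_empty, Set.not_nonempty_empty]
    rw [csum_eq_zero_of, zero_mul]
    · exact le_max_left _ _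
    all_goals simp

end full

/-- There is a tree whose limit set avoids a given family of intervals of small total size. -/
theorem exists_avoiding {a b s : ℝ} (hab : a < b) (hs0 : 0 < s) (hs1 : s < 1) :
    ∃ η > 0, ∀ z ρ : ℕ → ℝ, (∀ j, 0 < ρ j) → Summable (fun j => ρ j ^ s) →
      ∑' j, ρ j ^ s ≤ η → ∃ T : NTree Bool, T.IsGap ∧ T.cell [] ⊆ Icc a b ∧
        ∀ x ∈ T.lim, ∀ j, x ∉ Icc (z j - ρ j) (z j + ρ j) := by
  classical
  obtain ⟨M, hM4, hMs⟩ : ∃ M : ℕ, 4 ≤ M ∧ (4 : ℝ) ≤ (M : ℝ) ^ (1 - s) :=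
    ((eventually_ge_atTop 4).and (((tendsto_rpow_atTop (by linarith : 0 < 1 - s)).comp
      tendsto_natCast_atTop_atTop).eventually_ge_atTop 4)).exists
  have hM0 : (0 : ℝ) < M := by positivity
  have hMs' : 4 * (M : ℝ) ^ s ≤ M := by
    calc _ ≤ (M : ℝ) ^ (1 - s) * (M : ℝ) ^ s := by gcongr
      _ = M := by rw [← Real.rpow_add hM0]; simp
  set T := full a (b - a) M (by linarith) (by omega) with hT
  have hL : ∀ i, T.size (i + 1) ^ s * ((M : ℝ) ^ s) ^ i = T.size 1 ^ s := fun i => by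
    rw [add_comm, size_add, Real.div_rpow (T.size_pos _).le (by exact (pow_pos T.q_pos _).le),
      Real.rpow_pow_comm hM0.le]
    exact div_mul_cancel₀ _ (by have : T.q = M := rfl
                                rw [this]; positivity)
  have hL1 : 0 < T.size 1 ^ s := by have := T.size_pos 1; positivity
  refine ⟨T.size 1 ^ s / 5, by positivity, fun z ρ hρ hsum htsum => ?_⟩
  let J : ℕ → Set ℕ := fun i => {j | T.size (i + 1) ≤ ρ j ∧ ρ j < T.size i}
  have hJfin : ∀ i, (J i).Finite := fun i => by
    have h1 := hsum.tendsto_cofinite_zero.eventually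
      (gt_mem_nhds (Real.rpow_pos_of_pos (T.size_pos (i + 1)) s))
    rw [eventually_cofinite] at h1
    refine h1.subset fun j hj => ?_
    simp only [mem_ofPred_eq, not_lt]
    exact Real.rpow_le_rpow (T.size_pos _).le hj.1 hs0.le
  have hJcard : ∀ i, ((hJfin i).toFinset.card : ℝ) * T.size (i + 1) ^ s ≤ T.size 1 ^ s / 5 :=
    fun i => by
      calc _ = ∑ j ∈ (hJfin i).toFinset, T.size (i + 1) ^ s := by simp
        _ ≤ ∑ j ∈ (hJfin i).toFinset, ρ j ^ s := Finset.sum_le_sum fun j hj => by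
          rw [Set.Finite.mem_toFinset] at hj
          exact Real.rpow_le_rpow (T.size_pos _).le hj.1 hs0.le
        _ ≤ ∑' j, ρ j ^ s :=
          hsum.sum_le_tsum _ fun j _ => (Real.rpow_pos_of_pos (hρ j) s).le
        _ ≤ _ := htsum
  let meet : ℕ → List (Fin M) → Prop := fun j u =>
    (T.cell u ∩ Icc (z j - ρ j) (z j + ρ j)).Nonempty
  let rm : List (Fin M) → Prop := fun u => 1 ≤ u.length ∧ ∃ j ∈ J u.length, meet j u
  have hcount : ∀ i, csum (ind rm) i [] ≤ 4 * ((hJfin i).toFinset.card : ℝ) := fun i => by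
    calc _ ≤ csum (fun u => ∑ j ∈ (hJfin i).toFinset, ind (meet j) u) i [] := by
          refine csum_mono i [] fun u _ hu => ?_
          have hui : u.length = i := by simpa using hu
          by_cases h : rm u
          · obtain ⟨-, j, hj, hm⟩ := h
            rw [hui] at hj
            calc ind rm u ≤ 1 := by unfold ind; split_ifs <;> norm_num
              _ = ind (meet j) u := (if_pos hm).symm
              _ ≤ _ := Finset.single_le_sum (f := fun j => ind (meet j) u)
                (fun j _ => ind_nonneg _ _) ((hJfin i).mem_toFinset.mpr hj)
          · rw [ind_of_not h]
            exact Finset.sum_nonneg fun j _ => ind_nonneg _ _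
      _ = ∑ j ∈ (hJfin i).toFinset, csum (ind (meet j)) i [] := csum_finset_sum _ _ _ _
      _ ≤ ∑ _j ∈ (hJfin i).toFinset, (4 : ℝ) := Finset.sum_le_sum fun j hj => by
          have hj2 := ((hJfin i).mem_toFinset.mp hj).2
          have h1 := full_csum_meet_le (a := a) (ℓ := b - a) (M := M) (by linarith) (by omega)
            (z j - ρ j) (z j + ρ j) i []
          rw [← hT, List.length_nil, zero_add] at h1
          have h2 := T.size_pos i
          refine le_of_mul_le_mul_right (h1.trans (max_le (by positivity) ?_)) h2
          linarith
      _ = _ := by simp [mul_comm]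
  have : Nonempty (Fin M) := ⟨⟨0, by omega⟩⟩
  obtain ⟨alive, hal0, hal⟩ := exists_alive rm (fun p u => u.length = p ∧ rm u)
    (fun i p => if i = p then 4 * ((hJfin i).toFinset.card : ℝ) / (M : ℝ) ^ p else 0)
    (fun h => by simpa using h.1)
    (fun w hw => ⟨w.length, hw.1, le_rfl, rfl, hw⟩)
    (fun w p hp _ => by
      rw [Fintype.card_fin]
      by_cases hw : w = []
      · subst hw
        rw [List.length_nil, zero_add, if_pos rfl, div_mul_cancel₀ _ (by positivity)]
        exact (csum_ind_mono _ _ fun u _ _ h => h.2).trans (hcount p)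
      · have := List.length_pos_iff.mpr hw
        rw [csum_eq_zero_of, if_neg (by omega), zero_mul]
        rintro u - hu ⟨hup, -⟩
        omega)
    (fun i p => by split_ifs <;> positivity)
    (fun i => by
      simp only [ite_mul, zero_mul, Finset.sum_ite_eq]
      split_ifs with hi
      · rw [div_mul_eq_mul_div, div_le_one (by positivity)]
        have h1 := mul_le_mul_of_nonneg_right (hJcard i)
          (by positivity : 0 ≤ ((M : ℝ) ^ s) ^ i * (4 * 4 ^ i))
        have h2 : (4 : ℝ) ^ i * ((M : ℝ) ^ s) ^ i ≤ (M : ℝ) ^ i := by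
          rw [← mul_pow]; gcongr
        refine le_of_mul_le_mul_left ?_ hL1
        calc _ = ((hJfin i).toFinset.card : ℝ) * (T.size (i + 1) ^ s * ((M : ℝ) ^ s) ^ i) *
              (4 * 4 ^ i) := by rw [hL]; ring
          _ ≤ T.size 1 ^ s / 5 * (((M : ℝ) ^ s) ^ i * (4 * 4 ^ i)) := by linarith
          _ = 4 / 5 * (T.size 1 ^ s * (4 ^ i * ((M : ℝ) ^ s) ^ i)) := by ring
          _ ≤ 4 / 5 * (T.size 1 ^ s * (M : ℝ) ^ i) := by gcongr
          _ ≤ _ := by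
            have : 0 ≤ T.size 1 ^ s * (M : ℝ) ^ i := by positivity
            linarith
      · exact zero_le_one)
  obtain ⟨T', hT', -, -, hcell⟩ := T.exists_gap_subtree alive hal0 fun w hw => by
    have h1 := (hal w hw).2
    have hdead : csum (ind fun u => ¬ alive u) 1 w =
        (Finset.univ.filter fun b => ¬ alive (b :: w)).card := by
      simp only [csum, ind]
      rw [← Finset.sum_boole]
      exact Finset.sum_congr rfl fun b _ => by congr
    rw [hdead, Fintype.card_fin] at h1
    have h1' : 2 * (Finset.univ.filter fun b => ¬ alive (b :: w)).card < M := by exact_mod_cast h1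
    set A := Finset.univ.filter fun b => alive (b :: w) with hA
    have h2 := Finset.card_filter_add_card_filter_not (s := (Finset.univ : Finset (Fin M)))
      (fun b => alive (b :: w))
    rw [Finset.card_univ, Fintype.card_fin, ← hA] at h2
    have hA3 : 3 ≤ A.card := by omega
    have hAne : A.Nonempty := Finset.card_pos.mp (by omega)
    have h3 : A ⊆ Finset.Icc (A.min' hAne) (A.max' hAne) := fun b hb =>
      Finset.mem_Icc.mpr ⟨A.min'_le b hb, A.le_max' b hb⟩
    have h4 := Finset.card_le_card h3
    rw [Fin.card_Icc] at h4
    have h5 : ((A.min' hAne : ℕ) : ℝ) + 2 ≤ (A.max' hAne : ℕ) := by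
      exact_mod_cast (by omega : (A.min' hAne : ℕ) + 2 ≤ (A.max' hAne : ℕ))
    refine ⟨A.min' hAne, A.max' hAne, (Finset.mem_filter.mp (A.min'_mem hAne)).2,
      (Finset.mem_filter.mp (A.max'_mem hAne)).2, ?_⟩
    rw [hT, full_c_cons, full_c_cons, ← hT]
    have := mul_le_mul_of_nonneg_right h5 (T.size_pos (w.length + 1)).le
    linarith
  refine ⟨T', hT', ?_, fun x hx j hxj => ?_⟩
  · obtain ⟨u, hu, -, hcu⟩ := hcell []
    rw [hcu, List.length_eq_zero_iff.mp hu]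
    refine Icc_subset_Icc le_rfl ?_
    rw [List.length_nil, size_zero]
    change a + (b - a) ≤ b
    linarith
  · have hρ1 : ρ j < T.size 1 := by
      have h1 : ρ j ^ s ≤ T.size 1 ^ s / 5 :=
        (hsum.le_tsum j fun k _ => (Real.rpow_pos_of_pos (hρ k) s).le).trans htsum
      by_contra! h
      have := Real.rpow_le_rpow (T.size_pos 1).le h hs0.le
      linarith
    obtain ⟨n, hn1, hn2⟩ := T.exists_level (hρ j) (hρ1.trans_le (T.size_anti zero_le_one))
    have hn : 2 ≤ n := by
      by_contra! h
      have := T.size_anti (by omega : n ≤ 1)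
      linarith
    obtain ⟨i, rfl⟩ : ∃ i, n = i + 1 := ⟨n - 1, by omega⟩
    rw [size_succ T i, mul_div_cancel₀ _ T.q_pos.ne'] at hn2
    obtain ⟨w, hw, hxw⟩ := hx i
    obtain ⟨u, hu, hau, hcu⟩ := hcell w
    rw [hcu] at hxw
    have hui : u.length = i := by omega
    exact (hal u hau).1 ⟨by omega, j, by rw [hui]; exact ⟨hn1, hn2⟩, x, hxw, hxj⟩

end NTree

/-- A set of Hausdorff measure zero has covers by intervals of arbitrarily small total size. -/
theorem exists_cover_of_hausdorffMeasure_eq_zero {E : Set ℝ} {s : ℝ} (hs : 0 < s)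
    (hE : MeasureTheory.Measure.hausdorffMeasure s E = 0) {η : ℝ} (hη : 0 < η) :
    ∃ z ρ : ℕ → ℝ, (∀ j, 0 < ρ j) ∧ Summable (fun j => ρ j ^ s) ∧ ∑' j, ρ j ^ s ≤ η ∧
      E ⊆ ⋃ j, Icc (z j - ρ j) (z j + ρ j) := by
  rw [MeasureTheory.Measure.hausdorffMeasure_apply] at hE
  have h1 := le_of_eq hE
  simp only [iSup_le_iff] at h1
  have h2 := h1 1 one_pos
  have h3 := lt_of_le_of_lt h2 (ENNReal.ofReal_pos.mpr (half_pos hη))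
  simp only [iInf_lt_iff] at h3
  obtain ⟨t, hEt, htd, hts⟩ := h3
  have hterm : ∀ n, (⨆ _ : (t n).Nonempty, Metric.ediam (t n) ^ s) = Metric.ediam (t n) ^ s := by
    intro n
    rcases (t n).eq_empty_or_nonempty with h | h
    · simp [h, hs]
    · simp [h]
  simp only [hterm] at hts
  have hfin : ∀ n, Metric.ediam (t n) ≠ ∞ := fun n => ((htd n).trans_lt ENNReal.one_lt_top).ne
  set δ : ℕ → ℝ := fun n => (Metric.ediam (t n)).toReal with hδ
  have hδs : ∀ n, (Metric.ediam (t n) ^ s).toReal = δ n ^ s := fun n =>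
    (ENNReal.toReal_rpow _ _).symm
  have hsumδ : Summable fun n => δ n ^ s := by
    simp only [← hδs]
    exact ENNReal.summable_toReal (hts.trans ENNReal.ofReal_lt_top).ne
  have htsumδ : ∑' n, δ n ^ s ≤ η / 2 := by
    simp only [← hδs]
    rw [← ENNReal.tsum_toReal_eq fun n => (ENNReal.rpow_lt_top_of_nonneg hs.le (hfin n)).ne]
    exact ENNReal.toReal_le_of_le_ofReal (half_pos hη).le hts.le
  have hgeo : HasSum (fun n : ℕ => η / 2 / 2 * (1 / 2) ^ n) (η / 2) := by
    simpa using hasSum_geometric_two.mul_left (η / 2 / 2)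
  have hpos : ∀ n, 0 < δ n ^ s + η / 2 / 2 * (1 / 2) ^ n := fun n => by
    have : 0 ≤ δ n ^ s := Real.rpow_nonneg ENNReal.toReal_nonneg _
    positivity
  have hρs : ∀ n, ((δ n ^ s + η / 2 / 2 * (1 / 2) ^ n) ^ (1 / s)) ^ s =
      δ n ^ s + η / 2 / 2 * (1 / 2) ^ n := fun n => by
    rw [← Real.rpow_mul (hpos n).le, one_div_mul_cancel hs.ne', Real.rpow_one]
  have hz : ∀ n, ∃ z, t n ⊆ Icc (z - δ n) (z + δ n) := fun n => by
    rcases (t n).eq_empty_or_nonempty with h | ⟨z, hz⟩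
    · exact ⟨0, by simp [h]⟩
    · refine ⟨z, fun x hx => ?_⟩
      rw [← Real.closedBall_eq_Icc, Metric.mem_closedBall, dist_edist]
      exact ENNReal.toReal_mono (hfin n) (Metric.edist_le_ediam_of_mem hx hz)
  choose z hz using hz
  refine ⟨z, fun n => (δ n ^ s + η / 2 / 2 * (1 / 2) ^ n) ^ (1 / s),
    fun n => Real.rpow_pos_of_pos (hpos n) _, ?_, ?_, fun x hx => ?_⟩
  · simp only [hρs]
    exact hsumδ.add hgeo.summable
  · simp only [hρs]
    rw [hsumδ.tsum_add hgeo.summable, hgeo.tsum_eq]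
    linarith
  · obtain ⟨n, hn⟩ := mem_iUnion.mp (hEt hx)
    refine mem_iUnion.mpr ⟨n, ?_⟩
    have h4 : δ n ≤ (δ n ^ s + η / 2 / 2 * (1 / 2) ^ n) ^ (1 / s) := by
      have h0 : 0 ≤ δ n := ENNReal.toReal_nonneg
      calc δ n = (δ n ^ s) ^ (1 / s) := by
            rw [← Real.rpow_mul h0, mul_one_div_cancel hs.ne', Real.rpow_one]
        _ ≤ _ := by
          gcongr
          exact le_add_of_nonneg_right (by positivity)
    exact Icc_subset_Icc (by linarith) (by linarith) (hz n hn)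

namespace NTree

theorem exists_mem_lim_forall {T : NTree Bool} (hT : T.IsGap) (P : ℕ → Set ℝ)
    (hP : ∀ k, ∀ T' : NTree Bool, T'.IsGap → T'.cell [] ⊆ T.cell [] →
      ∃ T'' : NTree Bool, T''.IsGap ∧ T''.Sub T' ∧ T''.lim ⊆ P k) :
    ∃ x ∈ T.lim, ∀ k, x ∈ P k := by
  let X := {T' : NTree Bool // T'.IsGap ∧ T'.cell [] ⊆ T.cell []}
  have hstep : ∀ k (Y : X), ∃ Z : X, Z.1.Sub (Y.1.root [false]) ∧ Z.1.lim ⊆ P k := by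
    rintro k ⟨Y, hY, hYT⟩
    have h1 : (Y.root [false]).cell [] ⊆ T.cell [] := by
      rw [root_cell]
      exact (Y.cell_subset_of_suffix List.nil_suffix).trans hYT
    obtain ⟨Z, hZ, hZs, hZP⟩ := hP k _ (hY.root [false]) h1
    obtain ⟨u, -, hu⟩ := hZs []
    exact ⟨⟨Z, hZ, hu.trans (((Y.root [false]).cell_subset_of_suffix List.nil_suffix).trans h1)⟩,
      hZs, hZP⟩
  choose F hF hFP using hstep
  let Y : ℕ → X := fun k => k.rec ⟨T, hT, subset_rfl⟩ F
  have hdepth : ∀ m k w, ∃ u, w.length + m ≤ u.length ∧ (Y (k + m)).1.cell w ⊆ (Y k).1.cell u := by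
    intro m k
    induction m with
    | zero => exact fun w => ⟨w, by simp, subset_rfl⟩
    | succ m ih =>
      intro w
      obtain ⟨v, hv, hwv⟩ := hF (k + m) (Y (k + m)) w
      rw [root_cell] at hwv
      obtain ⟨u, hu, hvu⟩ := ih (v ++ [false])
      rw [List.length_append, List.length_singleton] at hu
      exact ⟨u, by omega, hwv.trans hvu⟩
  obtain ⟨x, hx⟩ := IsCompact.nonempty_iInter_of_sequence_nonempty_isCompact_isClosed
    (fun k => (Y k).1.cell [])
    (fun k => by
      obtain ⟨u, -, hu⟩ := hdepth 1 k []
      exact hu.trans ((Y k).1.cell_subset_of_suffix List.nil_suffix))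
    (fun k => ⟨_, (Y k).1.c_mem _⟩) isCompact_Icc (fun k => isClosed_Icc)
  rw [mem_iInter] at hx
  have hlim : ∀ k, x ∈ (Y k).1.lim := fun k n => by
    obtain ⟨u, hu, hs⟩ := hdepth n k []
    exact ⟨u.drop (u.length - n), by simp at hu ⊢; omega,
      (Y k).1.cell_subset_of_suffix (List.drop_suffix _ _) (hs (hx (k + n)))⟩
  exact ⟨x, hlim 0, fun k => hFP k (Y k) (hlim (k + 1))⟩

/-- A countable intersection of sets, each containing the limit set of a subtree of every tree in
`U`, has full dimension. -/
theorem one_le_dimH_iInter {U : Set ℝ} (hU : IsOpen U) (hUne : U.Nonempty) (P : ℕ → Set ℝ)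
    (hP : ∀ k, ∀ T : NTree Bool, T.IsGap → T.cell [] ⊆ U →
      ∃ T' : NTree Bool, T'.IsGap ∧ T'.Sub T ∧ T'.lim ⊆ P k) :
    1 ≤ dimH (⋂ k, P k) := by
  by_contra! hlt
  obtain ⟨s, hs, hs1⟩ := ENNReal.lt_iff_exists_nnreal_btwn.mp hlt
  have hs0 : (0 : ℝ) < s := by
    have : (0 : ℝ≥0∞) < s := (zero_le).trans_lt hs
    exact_mod_cast this
  have hs1' : (s : ℝ) < 1 := by exact_mod_cast hs1
  obtain ⟨x₀, hx₀⟩ := hUne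
  obtain ⟨ε, hε, hεU⟩ := Metric.isOpen_iff.mp hU x₀ hx₀
  have hsub : Icc x₀ (x₀ + ε / 2) ⊆ U := fun y hy => hεU (by
    rw [Metric.mem_ball, Real.dist_eq, abs_of_nonneg (by linarith [hy.1])]
    linarith [hy.2])
  obtain ⟨η, hη, htree⟩ := exists_avoiding (a := x₀) (b := x₀ + ε / 2) (by linarith) hs0 hs1'
  obtain ⟨z, ρ, hρ, hsum, htsum, hcov⟩ := exists_cover_of_hausdorffMeasure_eq_zero hs0
    (hausdorffMeasure_of_dimH_lt hs) hη
  obtain ⟨T, hT, hTc, havoid⟩ := htree z ρ hρ hsum htsum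
  obtain ⟨x, hx, hxP⟩ := exists_mem_lim_forall hT P fun k T' hT' hc =>
    hP k T' hT' (hc.trans (hTc.trans hsub))
  obtain ⟨j, hj⟩ := mem_iUnion.mp (hcov (mem_iInter.mpr hxP))
  exact havoid x hx j hj

end NTree

theorem stmt2 (n : ℕ → ℕ)
    (θ : (i : ℕ) → ℕ → (Fin (n i) → ℝ) → (Fin (n i) → ℝ))
    -- each coordinate of each `θ^i_j` is Lipschitz (w.r.t. the sup norm on `Fin (n i) → ℝ`)
    (hθ_lip : ∀ i j k, ∃ d > 0, ∀ x y : Fin (n i) → ℝ,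
      |θ i j x k - θ i j y k| ≤ d * ‖x - y‖)
    (W : (i : ℕ) → Set (Fin (n i) → ℝ))
    (hW_count : ∀ i, (W i).Countable)
    (hW_weight : ∀ i, ∀ r ∈ W i, (∀ k, 0 ≤ r k) ∧ ∑ k, r k = 1)
    (U : Set ℝ) (hU_open : IsOpen U) (hU_conn : U.OrdConnected) (hU_ne : U.Nonempty)
    (φ : (i : ℕ) → ℝ → Fin (n i) → ℝ)
    (hφ_an : ∀ i, AnalyticOnNhd ℝ (φ i) U)
    -- nondegeneracy of each `φᵢ`
    (hφ_nd : ∀ i, ∀ (a : ℝ) (b : Fin (n i) → ℝ),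
      (∀ x ∈ U, a + ∑ k, b k * φ i x k = 0) → a = 0 ∧ b = 0) :
    dimH (⋂ i, ⋂ r ∈ W i, ⋂ j,
        {x ∈ U | 0 < badLiminf r (φ i x) (θ i j (φ i x))}) = 1 := by
  classical
  refine le_antisymm ((dimH_mono (subset_univ _)).trans_eq Real.dimH_univ) ?_
  have : ∀ i, Countable (W i) := fun i => (hW_count i).to_subtype
  let S : (Σ i, W i × ℕ) → Set ℝ := fun k =>
    {x ∈ U | 0 < badLiminf k.2.1.1 (φ k.1 x) (θ k.1 k.2.2 (φ k.1 x))}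
  obtain ⟨e, he⟩ := exists_surjective_nat (Option (Σ i, W i × ℕ))
  refine (NTree.one_le_dimH_iInter hU_open hU_ne (fun m => (e m).elim univ S)
    fun m T hT hTU => ?_).trans (dimH_mono fun x hx => ?_)
  · rcases e m with _ | ⟨i, ⟨r, hr⟩, j⟩
    · exact ⟨T, hT, fun w => ⟨w, le_rfl, subset_rfl⟩, subset_univ _⟩
    · obtain ⟨T', hT', hsub, hbad⟩ := hT.exists_bad_subtree (hW_weight i r hr).1
        (hW_weight i r hr).2 (hθ_lip i j) hU_open hU_conn.isPreconnected (hφ_an i) (hφ_nd i) hTU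
      exact ⟨T', hT', hsub, fun x hx =>
        ⟨hTU (T.mem_cell_nil_of_mem_lim (hsub.lim_subset hx)), hbad x hx⟩⟩
  · simp only [mem_iInter] at hx ⊢
    intro i r hr j
    obtain ⟨m, hm⟩ := he (some ⟨i, ⟨r, hr⟩, j⟩)
    have := hx m
    rwa [hm] at this
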